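/- For every exponent p in (1,2) ∪ (2,∞) there exists an integer d_p ≥ 2 such that for every integer d ≥ d_p the following holds: for every measurable set A ⊆ ℝ^d × ℝ^d with positive upper Banach density δ̄_{2d}(A) > 0 there exists λ₀ > 0 such that for every real number λ ≥ λ₀ there exist x, y, s ∈ ℝ^d with (x,y) ∈ A, (x+s,y) ∈ A, (x,y+s) ∈ A and ‖s‖_{ℓ^p} = λ. -/

import Mathlib

open MeasureTheory Filter
open scoped ENNReal

/-- The `ℓ^p` norm of a vector in `ℝ^d`. -/
noncomputable def lpNorm {d : ℕ} (p : ℝ) (s : Fin d → ℝ) : ℝ :=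
  (∑ i, |s i| ^ p) ^ (1 / p)

/-- Upper Banach density of a subset of `ℝ^d × ℝ^d`, viewed as `ℝ^{2d}`. -/
noncomputable def upperBanachDensityProd (d : ℕ) (A : Set ((Fin d → ℝ) × (Fin d → ℝ))) : ℝ≥0∞ :=
  Filter.limsup (fun N : ℝ =>
    ⨆ z : (Fin d → ℝ) × (Fin d → ℝ),
      volume (A ∩ (Set.Icc z.1 (z.1 + fun _ => N) ×ˢ Set.Icc z.2 (z.2 + fun _ => N))) /
        ENNReal.ofReal (N ^ (2 * d))) Filter.atTop

namespace Corners

open scoped Topology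

/-! ### Bounded functions with bounded support -/

section BoundedSupport

variable {E F : Type*} [NormedAddCommGroup E] [MeasurableSpace E] [ProperSpace E]
  {μ : Measure E} [IsFiniteMeasureOnCompacts μ] [NormedAddCommGroup F]

lemma integrable_of_bounded_support {g : E → F} (hg : AEStronglyMeasurable g μ) (C R : ℝ)
    (hC : ∀ x, ‖g x‖ ≤ C) (hR : ∀ x, g x ≠ 0 → ‖x‖ ≤ R) : Integrable g μ := by
  have hsub : Function.support g ⊆ Metric.closedBall 0 R := fun x hx => by
    simpa using hR x hx
  rw [← integrableOn_iff_integrable_of_support_subset hsub]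
  exact Measure.integrableOn_of_bounded (M := C)
    (isCompact_closedBall (0 : E) R).measure_lt_top.ne hg (Eventually.of_forall hC)

lemma memLp_two_of_bounded_support {g : E → ℝ} (hg : AEStronglyMeasurable g μ) (C R : ℝ)
    (hC : ∀ x, ‖g x‖ ≤ C) (hR : ∀ x, g x ≠ 0 → ‖x‖ ≤ R) : MemLp g 2 μ := by
  rw [memLp_two_iff_integrable_sq hg]
  refine integrable_of_bounded_support (hg.pow 2) (C ^ 2) R (fun x => ?_) (fun x hx => hR x ?_)
  · rw [norm_pow]
    exact pow_le_pow_left₀ (norm_nonneg _) (hC x) 2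
  · rintro h
    simp [h] at hx

end BoundedSupport

/-- Translations act continuously on `L¹`. -/
lemma tendsto_integral_norm_translate_sub {E : Type*} [NormedAddCommGroup E] [NormedSpace ℝ E]
    [FiniteDimensional ℝ E] [MeasurableSpace E] [BorelSpace E] (μ : Measure E)
    [μ.IsAddHaarMeasure] {f : E → ℝ} (hf : Integrable f μ) :
    Tendsto (fun v => ∫ x, ‖f (x + v) - f x‖ ∂μ) (𝓝 0) (𝓝 0) := by
  have : ProperSpace E := FiniteDimensional.proper_real E
  have key : ∀ v, ∫ x, ‖f (x + v) - f x‖ ∂μ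
      = dist (DomAddAct.mk v +ᵥ hf.toL1 f) (hf.toL1 f) := by
    intro v
    have h2 : DomAddAct.mk v +ᵥ hf.toL1 f
        = ((memLp_one_iff_integrable.2 hf).comp_measurePreserving
            (measurePreserving_vadd v μ)).toLp (fun x => f (v +ᵥ x)) :=
      DomAddAct.mk_vadd_toLp v (memLp_one_iff_integrable.2 hf)
    have h3 : Integrable (fun x => f (v +ᵥ x)) μ := by
      simpa [vadd_eq_add, add_comm] using hf.comp_add_right v
    have h4 : DomAddAct.mk v +ᵥ hf.toL1 f = h3.toL1 (fun x => f (v +ᵥ x)) := h2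
    rw [h4, L1.dist_eq_integral_dist]
    refine integral_congr_ae ?_
    filter_upwards [h3.coeFn_toL1, hf.coeFn_toL1] with x hx hx'
    rw [hx, hx', dist_eq_norm, vadd_eq_add, add_comm v x]
  simp_rw [key]
  have : Fact ((1 : ℝ≥0∞) ≠ ∞) := ⟨ENNReal.one_ne_top⟩
  have hc : Continuous fun v : E => DomAddAct.mk v +ᵥ hf.toL1 f := by
    have : Continuous fun v : E => DomAddAct.mk v := DomAddAct.continuous_mk
    exact this.vadd continuous_const
  have := (hc.dist (continuous_const (y := hf.toL1 f))).tendsto 0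
  simpa using this

variable {d : ℕ}

instance : (volume : Measure ((Fin d → ℝ) × (Fin d → ℝ))).IsAddHaarMeasure :=
  Measure.prod.instIsAddHaarMeasure volume volume

/-! ### Weights on boxes and the corner counting function -/

/-- A measurable function with values in `[0, 1]` that vanishes outside the product of two cubes
of side length `N`. -/
structure IsBoxWeight (N : ℝ) (f : (Fin d → ℝ) × (Fin d → ℝ) → ℝ) : Prop where
  measurable : Measurable f
  nonneg : ∀ q, 0 ≤ f q
  le_one : ∀ q, f q ≤ 1
  support : ∃ a b : Fin d → ℝ, ∀ q, f q ≠ 0 →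
    q ∈ Set.Icc a (a + fun _ => N) ×ˢ Set.Icc b (b + fun _ => N)

/-- The weighted measure of the set of corners with side `s`. -/
noncomputable def cornerCount (f : (Fin d → ℝ) × (Fin d → ℝ) → ℝ) (s : Fin d → ℝ) : ℝ :=
  ∫ q : (Fin d → ℝ) × (Fin d → ℝ), f q * f (q.1 + s, q.2) * f (q.1, q.2 + s)

lemma volume_Icc_cube (a : Fin d → ℝ) {N : ℝ} (hN : 0 ≤ N) :
    volume (Set.Icc a (a + fun _ => N)) = ENNReal.ofReal (N ^ d) := by
  rw [Real.volume_Icc_pi]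
  simp [ENNReal.ofReal_pow hN]

lemma volume_box (a b : Fin d → ℝ) {N : ℝ} (hN : 0 ≤ N) :
    volume (Set.Icc a (a + fun _ => N) ×ˢ Set.Icc b (b + fun _ => N))
      = ENNReal.ofReal (N ^ (2 * d)) := by
  rw [Measure.volume_eq_prod, Measure.prod_prod, volume_Icc_cube a hN, volume_Icc_cube b hN,
    ← ENNReal.ofReal_mul (by positivity), ← pow_add, two_mul]

lemma norm_le_of_mem_Icc_cube {a x : Fin d → ℝ} {N : ℝ} (hN : 0 ≤ N)
    (hx : x ∈ Set.Icc a (a + fun _ => N)) : ‖x‖ ≤ ‖a‖ + N := by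
  rw [pi_norm_le_iff_of_nonneg (by positivity)]
  intro i
  have h1 := hx.1 i
  have h2 := hx.2 i
  have h3 := norm_le_pi_norm a i
  simp only [Pi.add_apply, Real.norm_eq_abs, abs_le] at h1 h2 h3 ⊢
  constructor <;> linarith

/-- The integral of a function bounded by `C` and supported in a box. -/
lemma abs_integral_le_of_box {a b : Fin d → ℝ} {N C : ℝ} (hN : 0 ≤ N)
    {g : (Fin d → ℝ) × (Fin d → ℝ) → ℝ} (hC : ∀ q, |g q| ≤ C)
    (hg : ∀ q, g q ≠ 0 → q ∈ Set.Icc a (a + fun _ => N) ×ˢ Set.Icc b (b + fun _ => N)) :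
    |∫ q, g q| ≤ C * N ^ (2 * d) := by
  rw [← setIntegral_eq_integral_of_forall_compl_eq_zero
    (s := Set.Icc a (a + fun _ => N) ×ˢ Set.Icc b (b + fun _ => N))
    (fun q hq => by_contra fun h => hq (hg q h))]
  have := norm_setIntegral_le_of_norm_le_const (μ := volume) (f := g) (C := C)
    (s := Set.Icc a (a + fun _ => N) ×ˢ Set.Icc b (b + fun _ => N))
    (by rw [volume_box a b hN]; exact ENNReal.ofReal_lt_top) (fun x _ => hC x)
  rwa [Measure.real, volume_box a b hN, ENNReal.toReal_ofReal (by positivity)] at this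

namespace IsBoxWeight

variable {N : ℝ} {f : (Fin d → ℝ) × (Fin d → ℝ) → ℝ}

lemma abs_le_one (hf : IsBoxWeight N f) (q) : |f q| ≤ 1 := by
  rw [abs_of_nonneg (hf.nonneg q)]
  exact hf.le_one q

lemma exists_norm_le (hf : IsBoxWeight N f) (hN : 0 ≤ N) :
    ∃ R, ∀ q, f q ≠ 0 → ‖q‖ ≤ R := by
  obtain ⟨a, b, h⟩ := hf.support
  refine ⟨max (‖a‖ + N) (‖b‖ + N), fun q hq => ?_⟩
  exact max_le_max (norm_le_of_mem_Icc_cube hN (h q hq).1) (norm_le_of_mem_Icc_cube hN (h q hq).2)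

lemma integrable (hf : IsBoxWeight N f) (hN : 0 ≤ N) : Integrable f := by
  obtain ⟨R, hR⟩ := hf.exists_norm_le hN
  exact integrable_of_bounded_support hf.measurable.aestronglyMeasurable 1 R hf.abs_le_one hR

lemma cornerCount_nonneg (hf : IsBoxWeight N f) (s) : 0 ≤ cornerCount f s :=
  integral_nonneg fun _ => mul_nonneg (mul_nonneg (hf.nonneg _) (hf.nonneg _)) (hf.nonneg _)

lemma cornerCount_le (hf : IsBoxWeight N f) (hN : 0 ≤ N) (s) :
    cornerCount f s ≤ N ^ (2 * d) := by
  obtain ⟨a, b, h⟩ := hf.support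
  have := abs_integral_le_of_box (C := 1) hN
    (g := fun q => f q * f (q.1 + s, q.2) * f (q.1, q.2 + s)) (fun q => ?_) (fun q hq => h q ?_)
  · rw [one_mul] at this
    exact (le_abs_self _).trans this
  · rw [abs_mul, abs_mul]
    exact mul_le_one₀ (mul_le_one₀ (hf.abs_le_one _) (abs_nonneg _) (hf.abs_le_one _))
      (abs_nonneg _) (hf.abs_le_one _)
  · intro h0
    simp [h0] at hq

lemma continuous_cornerCount (hf : IsBoxWeight N f) (hN : 0 ≤ N) :
    Continuous (cornerCount f) := by
  obtain ⟨R, hR⟩ := hf.exists_norm_le hN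
  have hm := hf.measurable
  have hInt : ∀ s, Integrable fun q : (Fin d → ℝ) × (Fin d → ℝ) =>
      f q * f (q.1 + s, q.2) * f (q.1, q.2 + s) := by
    intro s
    refine integrable_of_bounded_support (by fun_prop) 1 R (fun q => ?_) (fun q hq => hR q ?_)
    · rw [norm_mul, norm_mul]
      exact mul_le_one₀ (mul_le_one₀ (hf.abs_le_one _) (abs_nonneg _) (hf.abs_le_one _))
        (abs_nonneg _) (hf.abs_le_one _)
    · intro h0
      simp [h0] at hq
  rw [continuous_iff_continuousAt]
  intro s
  have ht := tendsto_integral_norm_translate_sub volume (hf.integrable hN)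
  have hlim : Tendsto (fun s' => (∫ q, ‖f (q + (s' - s, 0)) - f q‖)
      + ∫ q, ‖f (q + (0, s' - s)) - f q‖) (𝓝 s) (𝓝 (0 + 0)) := by
    refine Tendsto.add (ht.comp ?_) (ht.comp ?_)
    · exact Continuous.tendsto' (by fun_prop) _ _ (by simp)
    · exact Continuous.tendsto' (by fun_prop) _ _ (by simp)
  rw [add_zero] at hlim
  rw [ContinuousAt, tendsto_iff_norm_sub_tendsto_zero]
  refine squeeze_zero (fun _ => norm_nonneg _) (fun s' => ?_) hlim
  have e1 : ∫ q, ‖f (q + (s' - s, 0)) - f q‖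
      = ∫ q : (Fin d → ℝ) × (Fin d → ℝ), ‖f (q.1 + s', q.2) - f (q.1 + s, q.2)‖ := by
    rw [← integral_add_right_eq_self _ ((s, 0) : (Fin d → ℝ) × (Fin d → ℝ))]
    refine integral_congr_ae (Eventually.of_forall fun q => ?_)
    simp only [Prod.add_def]
    congr 4
    · abel
    · abel
    · abel
  have e2 : ∫ q, ‖f (q + (0, s' - s)) - f q‖
      = ∫ q : (Fin d → ℝ) × (Fin d → ℝ), ‖f (q.1, q.2 + s') - f (q.1, q.2 + s)‖ := by
    rw [← integral_add_right_eq_self _ ((0, s) : (Fin d → ℝ) × (Fin d → ℝ))]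
    refine integral_congr_ae (Eventually.of_forall fun q => ?_)
    simp only [Prod.add_def]
    congr 4
    · abel
    · abel
    · abel
  have i1 : Integrable fun q : (Fin d → ℝ) × (Fin d → ℝ) =>
      ‖f (q.1 + s', q.2) - f (q.1 + s, q.2)‖ := by
    have := ((hf.integrable hN).comp_add_right (s', 0)).sub
      ((hf.integrable hN).comp_add_right (s, 0))
    simpa [Prod.add_def] using this.norm
  have i2 : Integrable fun q : (Fin d → ℝ) × (Fin d → ℝ) =>
      ‖f (q.1, q.2 + s') - f (q.1, q.2 + s)‖ := by
    have := ((hf.integrable hN).comp_add_right (0, s')).sub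
      ((hf.integrable hN).comp_add_right (0, s))
    simpa [Prod.add_def] using this.norm
  rw [cornerCount, cornerCount, ← integral_sub (hInt s') (hInt s), e1, e2, ← integral_add i1 i2]
  refine norm_integral_le_of_norm_le (i1.add i2) (Eventually.of_forall fun q => ?_)
  have h1 := hf.abs_le_one q
  have h2 := hf.abs_le_one (q.1 + s, q.2)
  have h3 := hf.abs_le_one (q.1, q.2 + s')
  have e : f q * f (q.1 + s', q.2) * f (q.1, q.2 + s') - f q * f (q.1 + s, q.2) * f (q.1, q.2 + s)
      = f q * f (q.1, q.2 + s') * (f (q.1 + s', q.2) - f (q.1 + s, q.2))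
        + f q * f (q.1 + s, q.2) * (f (q.1, q.2 + s') - f (q.1, q.2 + s)) := by ring
  rw [e]
  refine (norm_add_le _ _).trans (add_le_add ?_ ?_)
  · rw [norm_mul, norm_mul]
    exact mul_le_of_le_one_left (norm_nonneg _) (mul_le_one₀ h1 (abs_nonneg _) h3)
  · rw [norm_mul, norm_mul]
    exact mul_le_of_le_one_left (norm_nonneg _) (mul_le_one₀ h1 (abs_nonneg _) h2)

end IsBoxWeight

end Corners

namespace Corners

open scoped Topology

/-! ### Almost orthogonality -/

lemma sq_sum_abs_inner_le {E : Type*} [NormedAddCommGroup E] [InnerProductSpace ℝ E] {ι : Type*}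
    (t : Finset ι) (x : E) (y : ι → E) :
    (∑ j ∈ t, |inner ℝ x (y j)|) ^ 2 ≤ ‖x‖ ^ 2 * ∑ j ∈ t, ∑ k ∈ t, |inner ℝ (y j) (y k)| := by
  set S : E := ∑ j ∈ t, (SignType.sign (inner ℝ x (y j)) : ℝ) • y j with hS
  have h1 : ∑ j ∈ t, |inner ℝ x (y j)| = inner ℝ x S := by
    rw [hS, inner_sum]
    refine Finset.sum_congr rfl fun j _ => ?_
    rw [inner_smul_right, mul_comm, self_mul_sign]
  have h2 : ‖S‖ ^ 2 ≤ ∑ j ∈ t, ∑ k ∈ t, |inner ℝ (y j) (y k)| := by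
    rw [← real_inner_self_eq_norm_sq]
    nth_rewrite 1 [hS]
    rw [hS, sum_inner]
    refine Finset.sum_le_sum fun j _ => ?_
    rw [inner_sum]
    refine Finset.sum_le_sum fun k _ => ?_
    rw [inner_smul_left, inner_smul_right]
    refine (le_abs_self _).trans ?_
    rw [abs_mul, abs_mul]
    have hs : ∀ r : ℝ, |((SignType.sign r : SignType) : ℝ)| ≤ 1 := by
      intro r
      rcases lt_trichotomy r 0 with h | h | h <;> simp [h]
    refine mul_le_of_le_one_left (by positivity) (hs _) |>.trans ?_
    exact mul_le_of_le_one_left (abs_nonneg _) (hs _)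
  calc (∑ j ∈ t, |inner ℝ x (y j)|) ^ 2 = |inner ℝ x S| ^ 2 := by rw [h1, sq_abs]
    _ ≤ (‖x‖ * ‖S‖) ^ 2 := pow_le_pow_left₀ (abs_nonneg _) (abs_real_inner_le_norm _ _) 2
    _ = ‖x‖ ^ 2 * ‖S‖ ^ 2 := mul_pow _ _ _
    _ ≤ _ := mul_le_mul_of_nonneg_left h2 (by positivity)

lemma sq_sum_abs_integral_mul_le {α : Type*} [MeasurableSpace α] {μ : Measure α} {ι : Type*}
    (t : Finset ι) {P : α → ℝ} {T : ι → α → ℝ} (hP : MemLp P 2 μ) (hT : ∀ j, MemLp (T j) 2 μ) :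
    (∑ j ∈ t, |∫ q, P q * T j q ∂μ|) ^ 2
      ≤ (∫ q, P q * P q ∂μ) * ∑ j ∈ t, ∑ k ∈ t, |∫ q, T j q * T k q ∂μ| := by
  have key : ∀ {g h : α → ℝ} (hg : MemLp g 2 μ) (hh : MemLp h 2 μ),
      inner ℝ (hg.toLp g) (hh.toLp h) = ∫ q, g q * h q ∂μ := by
    intro g h hg hh
    rw [L2.inner_def]
    refine integral_congr_ae ?_
    filter_upwards [hg.coeFn_toLp, hh.coeFn_toLp] with q h1 h2
    rw [h1, h2]
    simp [mul_comm]
  have := sq_sum_abs_inner_le t (hP.toLp P) (fun j => (hT j).toLp (T j))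
  simp only [key, ← real_inner_self_eq_norm_sq] at this
  exact this

lemma integral_swap_of_bounded_support {E F : Type*} [NormedAddCommGroup E] [MeasurableSpace E]
    [ProperSpace E] [NormedAddCommGroup F] [MeasurableSpace F] [ProperSpace F]
    {μ : Measure E} {ν : Measure F} [IsFiniteMeasureOnCompacts μ] [IsFiniteMeasureOnCompacts ν]
    [SFinite μ] [SFinite ν] [OpensMeasurableSpace E] [OpensMeasurableSpace F]
    {g : E → F → ℝ} (hg : Measurable (Function.uncurry g)) (C R₁ R₂ : ℝ)
    (hC : ∀ x y, |g x y| ≤ C) (hR : ∀ x y, g x y ≠ 0 → ‖x‖ ≤ R₁ ∧ ‖y‖ ≤ R₂) :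
    ∫ x, ∫ y, g x y ∂ν ∂μ = ∫ y, ∫ x, g x y ∂μ ∂ν := by
  refine integral_integral_swap ?_
  refine integrable_of_bounded_support hg.aestronglyMeasurable C (max R₁ R₂)
    (fun z => hC z.1 z.2) (fun z hz => ?_)
  exact max_le_max (hR _ _ hz).1 (hR _ _ hz).2

variable {d : ℕ}

/-- A bounded measurable kernel with bounded support, vanishing integral, and `L¹` norm at most
`L`. -/
structure IsKernel (L : ℝ) (ψ : (Fin d → ℝ) → ℝ) : Prop where
  measurable : Measurable ψ
  bounded : ∃ C, ∀ s, |ψ s| ≤ C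
  support : ∃ R, ∀ s, ψ s ≠ 0 → ‖s‖ ≤ R
  integral_abs_le : ∫ s, |ψ s| ≤ L
  integral_eq_zero : ∫ s, ψ s = 0

namespace IsKernel

variable {L : ℝ} {ψ : (Fin d → ℝ) → ℝ}

lemma integrable (h : IsKernel L ψ) : Integrable ψ := by
  obtain ⟨C, hC⟩ := h.bounded
  obtain ⟨R, hR⟩ := h.support
  exact integrable_of_bounded_support h.measurable.aestronglyMeasurable C R hC hR

lemma nonneg (h : IsKernel L ψ) : 0 ≤ L :=
  (integral_nonneg fun _ => abs_nonneg _).trans h.integral_abs_le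

lemma abs_integral_mul_le (h : IsKernel L ψ) {g : (Fin d → ℝ) → ℝ} (hg : ∀ s, |g s| ≤ 1) :
    |∫ s, g s * ψ s| ≤ L := by
  rw [← Real.norm_eq_abs]
  refine (norm_integral_le_of_norm_le h.integrable.norm
    (Eventually.of_forall fun s => ?_)).trans h.integral_abs_le
  rw [norm_mul]
  exact mul_le_of_le_one_left (norm_nonneg _) (hg s)

/-- The `L¹` modulus of continuity controls the effect of translating the kernel. -/
lemma abs_integral_mul_translate_sub_le (h : IsKernel L ψ) {g : (Fin d → ℝ) → ℝ}
    (hgm : Measurable g) (hg : ∀ s, |g s| ≤ 1) (s : Fin d → ℝ) :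
    |(∫ r, g r * ψ (r + s)) - ∫ r, g r * ψ r| ≤ ∫ r, |ψ (r + s) - ψ r| := by
  have h1 : Integrable fun r => ψ (r + s) := h.integrable.comp_add_right s
  have hb : ∀ {k : (Fin d → ℝ) → ℝ}, Integrable k → Integrable fun r => g r * k r := fun hk =>
    hk.bdd_mul hgm.aestronglyMeasurable (Eventually.of_forall hg)
  rw [← integral_sub (hb h1) (hb h.integrable)]
  rw [← Real.norm_eq_abs]
  refine norm_integral_le_of_norm_le (h1.sub h.integrable).norm
    (Eventually.of_forall fun r => ?_)
  rw [← mul_sub, norm_mul]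
  exact mul_le_of_le_one_left (norm_nonneg _) (hg r)

lemma measurable_modulus (h : IsKernel L ψ) :
    Measurable fun s => ∫ r, |ψ (r + s) - ψ r| := by
  have hm := h.measurable
  have : StronglyMeasurable fun z : (Fin d → ℝ) × (Fin d → ℝ) => |ψ (z.2 + z.1) - ψ z.2| :=
    Measurable.stronglyMeasurable (by fun_prop)
  exact this.integral_prod_right'.measurable

lemma modulus_le (h : IsKernel L ψ) (s) : ∫ r, |ψ (r + s) - ψ r| ≤ 2 * L := by
  have h1 : Integrable fun r => ψ (r + s) := h.integrable.comp_add_right s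
  calc ∫ r, |ψ (r + s) - ψ r| ≤ ∫ r, (|ψ (r + s)| + |ψ r|) :=
        integral_mono (h1.sub h.integrable).norm (h1.norm.add h.integrable.norm)
          fun r => abs_sub _ _
    _ = (∫ r, |ψ (r + s)|) + ∫ r, |ψ r| := integral_add h1.norm h.integrable.norm
    _ = (∫ r, |ψ r|) + ∫ r, |ψ r| := by
        rw [integral_add_right_eq_self (fun r => |ψ r|) s]
    _ ≤ 2 * L := by linarith [h.integral_abs_le]

lemma integrable_mul_modulus (h : IsKernel L ψ) {L' : ℝ} {ψ' : (Fin d → ℝ) → ℝ}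
    (h' : IsKernel L' ψ') : Integrable fun s => |ψ s| * ∫ r, |ψ' (r + s) - ψ' r| := by
  refine h.integrable.norm.mul_bdd (c := 2 * L') h'.measurable_modulus.aestronglyMeasurable
    (Eventually.of_forall fun s => ?_)
  rw [Real.norm_eq_abs, abs_of_nonneg (integral_nonneg fun _ => abs_nonneg _)]
  exact h'.modulus_le s

end IsKernel

/-- Convolution of `R` with `ψ` along the antidiagonal. -/
noncomputable def antidiagConv (R : (Fin d → ℝ) × (Fin d → ℝ) → ℝ) (ψ : (Fin d → ℝ) → ℝ)
    (q : (Fin d → ℝ) × (Fin d → ℝ)) : ℝ :=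
  ∫ s, R (q.1 - s, q.2 + s) * ψ s

section AntidiagConv

variable {R : (Fin d → ℝ) × (Fin d → ℝ) → ℝ} {ψ ψ' : (Fin d → ℝ) → ℝ} {L L' N : ℝ}

lemma measurable_antidiagConv (hR : Measurable R) (hψ : Measurable ψ) :
    Measurable (antidiagConv R ψ) := by
  have : StronglyMeasurable fun z : ((Fin d → ℝ) × (Fin d → ℝ)) × (Fin d → ℝ) =>
      R (z.1.1 - z.2, z.1.2 + z.2) * ψ z.2 := Measurable.stronglyMeasurable (by fun_prop)
  exact this.integral_prod_right'.measurable

lemma memLp_antidiagConv (hN : 0 ≤ N) (hR : IsBoxWeight N R) (hψ : IsKernel L ψ) :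
    MemLp (antidiagConv R ψ) 2 := by
  obtain ⟨ρ, hρ⟩ := hR.exists_norm_le hN
  obtain ⟨σ, hσ⟩ := hψ.support
  refine memLp_two_of_bounded_support
    (measurable_antidiagConv hR.measurable hψ.measurable).aestronglyMeasurable L (ρ + σ)
    (fun q => hψ.abs_integral_mul_le fun s => hR.abs_le_one _) (fun q hq => ?_)
  by_contra hlt
  refine hq ?_
  rw [antidiagConv, integral_eq_zero_of_ae]
  refine Eventually.of_forall fun s => ?_
  by_contra hne
  have hne' : R (q.1 - s, q.2 + s) * ψ s ≠ 0 := hne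
  have h1 := hρ _ (left_ne_zero_of_mul hne')
  have h2 := hσ _ (right_ne_zero_of_mul hne')
  refine hlt ?_
  have e : q = (q.1 - s, q.2 + s) + (s, -s) := by ext <;> simp
  rw [e]
  refine (norm_add_le _ _).trans (add_le_add h1 ?_)
  simpa [Prod.norm_def] using h2

lemma abs_integral_antidiagConv_mul_le (hN : 0 ≤ N) (hR : IsBoxWeight N R) (hψ : IsKernel L ψ)
    (hψ' : IsKernel L' ψ') :
    |∫ q, antidiagConv R ψ q * antidiagConv R ψ' q|
      ≤ (∫ s, |ψ s| * ∫ r, |ψ' (r + s) - ψ' r|) * N ^ (2 * d) := by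
  obtain ⟨a, b, hab⟩ := hR.support
  obtain ⟨ρ, hρ⟩ := hR.exists_norm_le hN
  obtain ⟨σ, hσ⟩ := hψ.support
  obtain ⟨C, hC⟩ := hψ.bounded
  have hm := hR.measurable
  have hψm := hψ.measurable
  have hTm : Measurable (antidiagConv R ψ') := measurable_antidiagConv hR.measurable hψ'.measurable
  have hTb : ∀ q, |antidiagConv R ψ' q| ≤ L' :=
    fun q => hψ'.abs_integral_mul_le fun s => hR.abs_le_one _
  have hL' := hψ'.nonneg
  have hC0 : 0 ≤ C := (abs_nonneg _).trans (hC 0)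
  have hintR : ∀ v, Integrable fun q => R q * antidiagConv R ψ' (q + v) := by
    intro v
    refine (hR.integrable hN).mul_bdd (c := L')
      (hTm.comp (measurable_add_const v)).aestronglyMeasurable
      (Eventually.of_forall fun q => hTb _)
  have e1 : ∫ q, antidiagConv R ψ q * antidiagConv R ψ' q
      = ∫ s, ψ s * ∫ q, R q * antidiagConv R ψ' (q + (s, -s)) := by
    calc ∫ q, antidiagConv R ψ q * antidiagConv R ψ' q
        = ∫ q : (Fin d → ℝ) × (Fin d → ℝ), ∫ s,
            R (q.1 - s, q.2 + s) * ψ s * antidiagConv R ψ' q := by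
          refine integral_congr_ae (Eventually.of_forall fun q => ?_)
          simp only [antidiagConv]
          rw [← integral_mul_const]
      _ = ∫ s, ∫ q : (Fin d → ℝ) × (Fin d → ℝ),
            R (q.1 - s, q.2 + s) * ψ s * antidiagConv R ψ' q := by
          refine integral_swap_of_bounded_support ?_ (1 * C * L') (ρ + σ) σ (fun q s => ?_)
            (fun q s hqs => ?_)
          · simp only [Function.uncurry_def]
            fun_prop
          · rw [abs_mul, abs_mul]
            gcongr
            · exact hR.abs_le_one _
            · exact hC s
            · exact hTb q
          · have h1 := hρ _ (left_ne_zero_of_mul (left_ne_zero_of_mul hqs))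
            have h2 := hσ _ (right_ne_zero_of_mul (left_ne_zero_of_mul hqs))
            refine ⟨?_, h2⟩
            have e : q = (q.1 - s, q.2 + s) + (s, -s) := by ext <;> simp
            rw [e]
            refine (norm_add_le _ _).trans (add_le_add h1 ?_)
            simpa [Prod.norm_def] using h2
      _ = _ := by
          refine integral_congr_ae (Eventually.of_forall fun s => ?_)
          simp only
          rw [← integral_add_right_eq_self _ ((s, -s) : (Fin d → ℝ) × (Fin d → ℝ)),
            ← integral_const_mul]
          refine integral_congr_ae (Eventually.of_forall fun q => ?_)
          simp only [Prod.fst_add, Prod.snd_add, add_sub_cancel_right, neg_add_cancel_right]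
          ring
  have hT : ∀ q s, |antidiagConv R ψ' (q + (s, -s)) - antidiagConv R ψ' q|
      ≤ ∫ r, |ψ' (r + s) - ψ' r| := by
    intro q s
    have e : antidiagConv R ψ' (q + (s, -s)) = ∫ r, R (q.1 - r, q.2 + r) * ψ' (r + s) := by
      rw [antidiagConv, ← integral_add_right_eq_self _ s]
      refine integral_congr_ae (Eventually.of_forall fun r => ?_)
      simp only [Prod.fst_add, Prod.snd_add]
      congr 3
      · abel
      · abel
    rw [e]
    exact hψ'.abs_integral_mul_translate_sub_le (by fun_prop) (fun _ => hR.abs_le_one _) s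
  have e2 : ∫ s, ψ s * ∫ q, R q * antidiagConv R ψ' (q + (s, -s))
      = ∫ s, ψ s * ∫ q, R q * (antidiagConv R ψ' (q + (s, -s)) - antidiagConv R ψ' q) := by
    have h0 : ∫ s, ψ s * (∫ q, R q * antidiagConv R ψ' q) = 0 := by
      rw [integral_mul_const, hψ.integral_eq_zero, zero_mul]
    have hmeas : Measurable fun s => ∫ q, R q * antidiagConv R ψ' (q + (s, -s)) := by
      have : StronglyMeasurable fun z : (Fin d → ℝ) × ((Fin d → ℝ) × (Fin d → ℝ)) =>
          R z.2 * antidiagConv R ψ' (z.2 + (z.1, -z.1)) :=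
        Measurable.stronglyMeasurable (by fun_prop)
      exact this.integral_prod_right'.measurable
    have hbd : ∀ s, |∫ q, R q * antidiagConv R ψ' (q + (s, -s))| ≤ (1 * L') * N ^ (2 * d) := by
      intro s
      refine abs_integral_le_of_box hN (fun q => ?_) (fun q hq => hab q (left_ne_zero_of_mul hq))
      rw [abs_mul]
      gcongr
      · exact hR.abs_le_one _
      · exact hTb _
    have hi : Integrable fun s => ψ s * ∫ q, R q * antidiagConv R ψ' (q + (s, -s)) :=
      hψ.integrable.mul_bdd hmeas.aestronglyMeasurable (Eventually.of_forall hbd)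
    rw [← sub_zero (∫ s, ψ s * ∫ q, R q * antidiagConv R ψ' (q + (s, -s))), ← h0,
      ← integral_sub hi (hψ.integrable.mul_const _)]
    refine integral_congr_ae (Eventually.of_forall fun s => ?_)
    simp only
    rw [← mul_sub, ← integral_sub (hintR _) (by simpa using hintR 0)]
    simp only [mul_sub]
  rw [e1, e2, ← integral_mul_const, ← Real.norm_eq_abs]
  refine norm_integral_le_of_norm_le ((hψ.integrable_mul_modulus hψ').mul_const _)
    (Eventually.of_forall fun s => ?_)
  rw [norm_mul, mul_assoc]
  refine mul_le_mul_of_nonneg_left ?_ (norm_nonneg _)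
  refine abs_integral_le_of_box hN (fun q => ?_) (fun q hq => hab q (left_ne_zero_of_mul hq))
  rw [abs_mul]
  exact (mul_le_of_le_one_left (abs_nonneg _) (hR.abs_le_one q)).trans (hT q s)

end AntidiagConv

end Corners

namespace Corners

open scoped Topology

lemma sum_sum_le_of_symm {a b : ℕ → ℕ → ℝ} {c : ℝ} (J : ℕ) (hsymm : ∀ j k, a j k = a k j)
    (hb : ∀ j k, 0 ≤ b j k) (hdiag : ∀ j < J, a j j ≤ c)
    (hlt : ∀ j k, j < k → k < J → a j k ≤ b j k) :
    ∑ j ∈ Finset.range J, ∑ k ∈ Finset.range J, a j k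
      ≤ J * c + 2 * ∑ k ∈ Finset.range J, ∑ j ∈ Finset.range J, b j k := by
  have h1 : ∀ j ∈ Finset.range J, ∀ k ∈ Finset.range J,
      a j k ≤ (if j = k then c else 0) + (b j k + b k j) := by
    intro j hj k hk
    rw [Finset.mem_range] at hj hk
    rcases lt_trichotomy j k with h | h | h
    · rw [if_neg h.ne]
      linarith [hlt j k h hk, hb k j]
    · subst h
      rw [if_pos rfl]
      linarith [hdiag j hj, hb j j]
    · rw [if_neg h.ne']
      linarith [hlt k j h hj, hb j k, hsymm j k]
  refine (Finset.sum_le_sum fun j hj => Finset.sum_le_sum fun k hk => h1 j hj k hk).trans ?_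
  simp only [Finset.sum_add_distrib]
  have h2 : ∑ j ∈ Finset.range J, ∑ k ∈ Finset.range J, (if j = k then c else 0) = J * c := by
    rw [Finset.sum_congr rfl (g := fun _ => c)]
    · simp
    · intro j hj
      rw [Finset.sum_ite_eq, if_pos hj]
  rw [h2, Finset.sum_comm (f := fun j k => b j k), two_mul]

variable {d : ℕ}

/-- A finite family of kernels, each of which is almost constant, in an `L¹` sense, at the scale
of the preceding ones. -/
structure IsLacunary (J : ℕ) (L γ : ℝ) (ψ : ℕ → (Fin d → ℝ) → ℝ) : Prop where
  isKernel : ∀ j, IsKernel L (ψ j)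
  modulus_le : ∀ j k, j < k → k < J → ∫ s, |ψ j s| * ∫ r, |ψ k (r + s) - ψ k r| ≤ γ

section

variable {J : ℕ} {L γ N : ℝ} {ψ : ℕ → (Fin d → ℝ) → ℝ}

lemma integral_mul_self_le {P : (Fin d → ℝ) × (Fin d → ℝ) → ℝ} (hN : 0 ≤ N)
    (hP : IsBoxWeight N P) : ∫ q, P q * P q ≤ N ^ (2 * d) := by
  obtain ⟨a, b, hab⟩ := hP.support
  rw [← one_mul (N ^ (2 * d))]
  refine (le_abs_self _).trans (abs_integral_le_of_box hN (fun q => ?_)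
    fun q hq => hab q (left_ne_zero_of_mul hq))
  rw [abs_mul]
  exact mul_le_one₀ (hP.abs_le_one q) (abs_nonneg _) (hP.abs_le_one q)

lemma IsBoxWeight.memLp_two {P : (Fin d → ℝ) × (Fin d → ℝ) → ℝ} (hN : 0 ≤ N)
    (hP : IsBoxWeight N P) : MemLp P 2 := by
  obtain ⟨R, hR⟩ := hP.exists_norm_le hN
  exact memLp_two_of_bounded_support hP.measurable.aestronglyMeasurable 1 R hP.abs_le_one hR

lemma sum_abs_integral_antidiagConv_le (hN : 0 ≤ N) (hγ : 0 ≤ γ)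
    {P R : (Fin d → ℝ) × (Fin d → ℝ) → ℝ} (hP : IsBoxWeight N P) (hR : IsBoxWeight N R)
    (hψ : IsLacunary J L γ ψ) :
    ∑ j ∈ Finset.range J, |∫ q, P q * antidiagConv R (ψ j) q|
      ≤ √(2 * L ^ 2 * J + 2 * γ * J ^ 2) * N ^ (2 * d) := by
  set v := N ^ (2 * d) with hv
  have hv0 : 0 ≤ v := by positivity
  have hdiag : ∀ j, ∫ s, |ψ j s| * ∫ r, |ψ j (r + s) - ψ j r| ≤ 2 * L ^ 2 := by
    intro j
    have hk := hψ.isKernel j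
    calc ∫ s, |ψ j s| * ∫ r, |ψ j (r + s) - ψ j r| ≤ ∫ s, |ψ j s| * (2 * L) :=
          integral_mono (hk.integrable_mul_modulus hk) (hk.integrable.norm.mul_const _)
            fun s => mul_le_mul_of_nonneg_left (hk.modulus_le s) (abs_nonneg _)
      _ = (∫ s, |ψ j s|) * (2 * L) := integral_mul_const _ _
      _ ≤ L * (2 * L) := mul_le_mul_of_nonneg_right hk.integral_abs_le
          (by linarith [hk.nonneg])
      _ = 2 * L ^ 2 := by ring
  have hsum := sum_sum_le_of_symm (b := fun _ _ => γ * v) (c := 2 * L ^ 2 * v) J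
    (a := fun j k => |∫ q, antidiagConv R (ψ j) q * antidiagConv R (ψ k) q|)
    (fun j k => by simp only [mul_comm]) (fun _ _ => by positivity)
    (fun j _ => (abs_integral_antidiagConv_mul_le hN hR (hψ.isKernel j) (hψ.isKernel j)).trans
      (mul_le_mul_of_nonneg_right (hdiag j) hv0))
    (fun j k hjk hk => (abs_integral_antidiagConv_mul_le hN hR (hψ.isKernel j)
      (hψ.isKernel k)).trans (mul_le_mul_of_nonneg_right (hψ.modulus_le j k hjk hk) hv0))
  have hsq := sq_sum_abs_integral_mul_le (Finset.range J) (hP.memLp_two hN)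
    (fun j => memLp_antidiagConv hN hR (hψ.isKernel j))
  refine (abs_le_of_sq_le_sq' (b := √(2 * L ^ 2 * J + 2 * γ * J ^ 2) * v) ?_ (by positivity)).2
  rw [mul_pow, Real.sq_sqrt (by positivity)]
  refine hsq.trans ((mul_le_mul (integral_mul_self_le hN hP) hsum
    (Finset.sum_nonneg fun _ _ => Finset.sum_nonneg fun _ _ => abs_nonneg _) hv0).trans
    (le_of_eq ?_))
  simp only [Finset.sum_const, Finset.card_range, nsmul_eq_mul]
  ring

/-- The average, weighted by `ψ`, of the last two factors in the corner counting function. -/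
noncomputable def cornerConv (f : (Fin d → ℝ) × (Fin d → ℝ) → ℝ) (φ : (Fin d → ℝ) → ℝ)
    (q : (Fin d → ℝ) × (Fin d → ℝ)) : ℝ :=
  ∫ s, f (q.1 + s, q.2) * f (q.1, q.2 + s) * φ s

variable {f : (Fin d → ℝ) × (Fin d → ℝ) → ℝ} {φ φ' : (Fin d → ℝ) → ℝ} {L' : ℝ}

lemma measurable_cornerConv (hf : Measurable f) (hφ : Measurable φ) :
    Measurable (cornerConv f φ) := by
  have : StronglyMeasurable fun z : ((Fin d → ℝ) × (Fin d → ℝ)) × (Fin d → ℝ) =>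
      f (z.1.1 + z.2, z.1.2) * f (z.1.1, z.1.2 + z.2) * φ z.2 :=
    Measurable.stronglyMeasurable (by fun_prop)
  exact this.integral_prod_right'.measurable

lemma abs_mul_le_one {x y : ℝ} (hx : |x| ≤ 1) (hy : |y| ≤ 1) : |x * y| ≤ 1 := by
  rw [abs_mul]
  exact mul_le_one₀ hx (abs_nonneg _) hy

lemma abs_cornerConv_le (hf : IsBoxWeight N f) (hφ : IsKernel L φ) (q) :
    |cornerConv f φ q| ≤ L :=
  hφ.abs_integral_mul_le fun _ => abs_mul_le_one (hf.abs_le_one _) (hf.abs_le_one _)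

lemma cornerConv_support {a b : Fin d → ℝ} (h : ∀ q, f q ≠ 0 →
      q ∈ Set.Icc a (a + fun _ => N) ×ˢ Set.Icc b (b + fun _ => N)) (q)
    (hq : cornerConv f φ q ≠ 0) :
    q ∈ Set.Icc a (a + fun _ => N) ×ˢ Set.Icc b (b + fun _ => N) := by
  by_contra hlt
  refine hq ?_
  rw [cornerConv, integral_eq_zero_of_ae]
  refine Eventually.of_forall fun s => ?_
  by_contra hne
  have hne' : f (q.1 + s, q.2) * f (q.1, q.2 + s) * φ s ≠ 0 := hne
  have h1 := h _ (left_ne_zero_of_mul (left_ne_zero_of_mul hne'))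
  have h2 := h _ (right_ne_zero_of_mul (left_ne_zero_of_mul hne'))
  exact hlt ⟨h2.1, h1.2⟩

lemma memLp_cornerConv (hN : 0 ≤ N) (hf : IsBoxWeight N f) (hφ : IsKernel L φ) :
    MemLp (cornerConv f φ) 2 := by
  obtain ⟨a, b, hab⟩ := hf.support
  refine memLp_two_of_bounded_support
    (measurable_cornerConv hf.measurable hφ.measurable).aestronglyMeasurable L
    (max (‖a‖ + N) (‖b‖ + N)) (abs_cornerConv_le hf hφ) (fun q hq => ?_)
  have := cornerConv_support hab q hq
  exact max_le_max (norm_le_of_mem_Icc_cube hN this.1) (norm_le_of_mem_Icc_cube hN this.2)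

lemma integral_cornerCount_mul (hN : 0 ≤ N) (hf : IsBoxWeight N f) (hφ : IsKernel L φ) :
    ∫ s, cornerCount f s * φ s = ∫ q, f q * cornerConv f φ q := by
  obtain ⟨ρ, hρ⟩ := hf.exists_norm_le hN
  obtain ⟨σ, hσ⟩ := hφ.support
  obtain ⟨C, hC⟩ := hφ.bounded
  have hm := hf.measurable
  have hφm := hφ.measurable
  calc ∫ s, cornerCount f s * φ s
      = ∫ s, ∫ q : (Fin d → ℝ) × (Fin d → ℝ),
          f q * (f (q.1 + s, q.2) * f (q.1, q.2 + s) * φ s) := by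
        refine integral_congr_ae (Eventually.of_forall fun s => ?_)
        simp only [cornerCount]
        rw [← integral_mul_const]
        simp only [mul_assoc]
    _ = ∫ q : (Fin d → ℝ) × (Fin d → ℝ), ∫ s,
          f q * (f (q.1 + s, q.2) * f (q.1, q.2 + s) * φ s) := by
        refine integral_swap_of_bounded_support ?_ (1 * (1 * C)) σ ρ (fun s q => ?_)
          (fun s q h => ⟨hσ _ (right_ne_zero_of_mul (right_ne_zero_of_mul h)),
            hρ _ (left_ne_zero_of_mul h)⟩)
        · simp only [Function.uncurry_def]
          fun_prop
        · rw [abs_mul, abs_mul _ (φ s)]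
          gcongr
          · exact hf.abs_le_one _
          · exact abs_mul_le_one (hf.abs_le_one _) (hf.abs_le_one _)
          · exact hC s
    _ = _ := by simp only [integral_const_mul, cornerConv]

lemma IsBoxWeight.mul_right {h : (Fin d → ℝ) × (Fin d → ℝ) → ℝ} (hf : IsBoxWeight N f)
    (hm : Measurable h) (h0 : ∀ q, 0 ≤ h q) (h1 : ∀ q, h q ≤ 1) :
    IsBoxWeight N fun q => f q * h q := by
  obtain ⟨a, b, hab⟩ := hf.support
  exact ⟨hf.measurable.mul hm, fun q => mul_nonneg (hf.nonneg q) (h0 q),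
    fun q => mul_le_one₀ (hf.le_one q) (h0 q) (h1 q),
    a, b, fun q hq => hab q (left_ne_zero_of_mul hq)⟩

lemma IsBoxWeight.mul_translate_fst (hf : IsBoxWeight N f) (r : Fin d → ℝ) :
    IsBoxWeight N fun q => f q * f (q.1 + r, q.2) := by
  have hm := hf.measurable
  exact hf.mul_right (by fun_prop) (fun _ => hf.nonneg _) (fun _ => hf.le_one _)

lemma IsBoxWeight.mul_translate_snd (hf : IsBoxWeight N f) (r : Fin d → ℝ) :
    IsBoxWeight N fun q => f q * f (q.1, q.2 + r) := by
  have hm := hf.measurable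
  exact hf.mul_right (by fun_prop) (fun _ => hf.nonneg _) (fun _ => hf.le_one _)

/-- The bilinear form obtained from `f` by a Cauchy–Schwarz step with shift `r`. -/
noncomputable def shiftedForm (f : (Fin d → ℝ) × (Fin d → ℝ) → ℝ) (φ : (Fin d → ℝ) → ℝ)
    (r : Fin d → ℝ) : ℝ :=
  ∫ q : (Fin d → ℝ) × (Fin d → ℝ), (f q * f (q.1 + r, q.2))
    * antidiagConv (fun q => f q * f (q.1, q.2 + r)) φ q

lemma measurable_shiftedForm (hf : Measurable f) (hφ : Measurable φ) :
    Measurable (shiftedForm f φ) := by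
  have h1 : StronglyMeasurable fun z :
      ((Fin d → ℝ) × ((Fin d → ℝ) × (Fin d → ℝ))) × (Fin d → ℝ) =>
      f (z.1.2.1 - z.2, z.1.2.2 + z.2) * f (z.1.2.1 - z.2, z.1.2.2 + z.2 + z.1.1) * φ z.2 :=
    Measurable.stronglyMeasurable (by fun_prop)
  have h2 : StronglyMeasurable fun z : (Fin d → ℝ) × ((Fin d → ℝ) × (Fin d → ℝ)) =>
      (f z.2 * f (z.2.1 + z.1, z.2.2))
        * ∫ s, f (z.2.1 - s, z.2.2 + s) * f (z.2.1 - s, z.2.2 + s + z.1) * φ s :=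
    (Measurable.stronglyMeasurable (by fun_prop)).mul h1.integral_prod_right'
  exact h2.integral_prod_right'.measurable

lemma abs_shiftedForm_le (hN : 0 ≤ N) (hf : IsBoxWeight N f) (hφ : IsKernel L φ) (r) :
    |shiftedForm f φ r| ≤ (1 * L) * N ^ (2 * d) := by
  obtain ⟨a, b, hab⟩ := hf.support
  refine abs_integral_le_of_box hN (fun q => ?_)
    (fun q hq => hab q (left_ne_zero_of_mul (left_ne_zero_of_mul hq)))
  rw [abs_mul]
  gcongr
  · exact abs_mul_le_one (hf.abs_le_one _) (hf.abs_le_one _)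
  · exact hφ.abs_integral_mul_le fun _ => abs_mul_le_one (hf.abs_le_one _) (hf.abs_le_one _)

lemma shiftedForm_eq (hN : 0 ≤ N) (hf : IsBoxWeight N f) (hφ : IsKernel L φ) (r : Fin d → ℝ) :
    shiftedForm f φ r = ∫ q : (Fin d → ℝ) × (Fin d → ℝ), ∫ s,
      (f (q.1 + s, q.2) * f (q.1 + s + r, q.2)) * (f (q.1, q.2 + s) * f (q.1, q.2 + s + r))
        * φ s := by
  obtain ⟨a, b, hab⟩ := hf.support
  obtain ⟨ρ, hρ⟩ := hf.exists_norm_le hN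
  obtain ⟨σ, hσ⟩ := hφ.support
  obtain ⟨C, hC⟩ := hφ.bounded
  have hm := hf.measurable
  have hφm := hφ.measurable
  have hb : ∀ (q : (Fin d → ℝ) × (Fin d → ℝ)) (s : Fin d → ℝ),
      |f (q.1 + s, q.2) * f (q.1 + s + r, q.2)
      * (f (q.1, q.2 + s) * f (q.1, q.2 + s + r)) * φ s| ≤ 1 * C := by
    intro q s
    rw [abs_mul _ (φ s)]
    gcongr
    · exact abs_mul_le_one (abs_mul_le_one (hf.abs_le_one _) (hf.abs_le_one _))
        (abs_mul_le_one (hf.abs_le_one _) (hf.abs_le_one _))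
    · exact hC s
  symm
  calc ∫ q : (Fin d → ℝ) × (Fin d → ℝ), ∫ s,
      (f (q.1 + s, q.2) * f (q.1 + s + r, q.2)) * (f (q.1, q.2 + s) * f (q.1, q.2 + s + r)) * φ s
      = ∫ s, ∫ q : (Fin d → ℝ) × (Fin d → ℝ),
          (f (q.1 + s, q.2) * f (q.1 + s + r, q.2)) * (f (q.1, q.2 + s) * f (q.1, q.2 + s + r))
            * φ s := by
        refine integral_swap_of_bounded_support ?_ (1 * C) (max (‖a‖ + N) (‖b‖ + N)) σ hb
          (fun q s h => ⟨?_, hσ _ (right_ne_zero_of_mul h)⟩)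
        · simp only [Function.uncurry_def]
          fun_prop
        · have h1 := hab _ (left_ne_zero_of_mul (left_ne_zero_of_mul (left_ne_zero_of_mul h)))
          have h2 := hab _ (left_ne_zero_of_mul (right_ne_zero_of_mul (left_ne_zero_of_mul h)))
          exact max_le_max (norm_le_of_mem_Icc_cube hN h2.1) (norm_le_of_mem_Icc_cube hN h1.2)
    _ = ∫ s, ∫ q : (Fin d → ℝ) × (Fin d → ℝ), (f q * f (q.1 + r, q.2))
          * ((f (q.1 - s, q.2 + s) * f (q.1 - s, q.2 + s + r)) * φ s) := by
        refine integral_congr_ae (Eventually.of_forall fun s => ?_)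
        simp only
        rw [← integral_add_right_eq_self (fun q : (Fin d → ℝ) × (Fin d → ℝ) =>
          (f q * f (q.1 + r, q.2)) * ((f (q.1 - s, q.2 + s) * f (q.1 - s, q.2 + s + r)) * φ s))
          (s, 0)]
        refine integral_congr_ae (Eventually.of_forall fun q => ?_)
        simp only [Prod.add_def, add_zero, add_sub_cancel_right, mul_assoc]
    _ = ∫ q : (Fin d → ℝ) × (Fin d → ℝ), ∫ s, (f q * f (q.1 + r, q.2))
          * ((f (q.1 - s, q.2 + s) * f (q.1 - s, q.2 + s + r)) * φ s) := by
        refine integral_swap_of_bounded_support ?_ (1 * (1 * C)) σ ρ (fun s q => ?_)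
          (fun s q h => ⟨hσ _ (right_ne_zero_of_mul (right_ne_zero_of_mul h)),
            hρ _ (left_ne_zero_of_mul (left_ne_zero_of_mul h))⟩)
        · simp only [Function.uncurry_def]
          fun_prop
        · rw [abs_mul, abs_mul _ (φ s)]
          gcongr
          · exact abs_mul_le_one (hf.abs_le_one _) (hf.abs_le_one _)
          · exact abs_mul_le_one (hf.abs_le_one _) (hf.abs_le_one _)
          · exact hC s
    _ = _ := by simp only [integral_const_mul, shiftedForm, antidiagConv]

lemma abs_integral_cornerConv_mul_le (hN : 0 ≤ N) (hf : IsBoxWeight N f) (hφ : IsKernel L φ)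
    (hφ' : IsKernel L' φ') :
    |∫ q, cornerConv f φ q * cornerConv f φ' q|
      ≤ (∫ s, |φ s| * ∫ r, |φ' (r + s) - φ' r|) * N ^ (2 * d)
        + ∫ r, |φ' r| * |shiftedForm f φ r| := by
  obtain ⟨a, b, hab⟩ := hf.support
  obtain ⟨ρ, hρ⟩ := hf.exists_norm_le hN
  obtain ⟨σ, hσ⟩ := hφ.support
  obtain ⟨σ', hσ'⟩ := hφ'.support
  obtain ⟨C, hC⟩ := hφ.bounded
  obtain ⟨C', hC'⟩ := hφ'.bounded
  have hm := hf.measurable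
  have hφm := hφ.measurable
  have hφm' := hφ'.measurable
  set M : (Fin d → ℝ) × (Fin d → ℝ) → (Fin d → ℝ) → ℝ := fun q s =>
    ∫ r, f (q.1 + s + r, q.2) * f (q.1, q.2 + s + r) * φ' r with hM
  have hMm : Measurable (Function.uncurry M) := by
    have : StronglyMeasurable fun z : (((Fin d → ℝ) × (Fin d → ℝ)) × (Fin d → ℝ)) × (Fin d → ℝ) =>
        f (z.1.1.1 + z.1.2 + z.2, z.1.1.2) * f (z.1.1.1, z.1.1.2 + z.1.2 + z.2) * φ' z.2 :=
      Measurable.stronglyMeasurable (by fun_prop)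
    exact this.integral_prod_right'.measurable
  have hMb : ∀ q s, |M q s| ≤ L' := fun q s =>
    hφ'.abs_integral_mul_le fun _ => abs_mul_le_one (hf.abs_le_one _) (hf.abs_le_one _)
  have hM1 : ∀ q, Measurable (M q) := fun q => hMm.comp measurable_prodMk_left
  -- replacing the second average by a shifted one
  have hshift : ∀ q s, |cornerConv f φ' q - M q s| ≤ ∫ r, |φ' (r + s) - φ' r| := by
    intro q s
    have e : cornerConv f φ' q
        = ∫ r, f (q.1 + s + r, q.2) * f (q.1, q.2 + s + r) * φ' (r + s) := by
      rw [cornerConv, ← integral_add_right_eq_self _ s]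
      refine integral_congr_ae (Eventually.of_forall fun r => ?_)
      simp only [add_assoc, add_comm r s]
    rw [e]
    exact hφ'.abs_integral_mul_translate_sub_le (by fun_prop)
      (fun _ => abs_mul_le_one (hf.abs_le_one _) (hf.abs_le_one _)) s
  have hI : ∀ q : (Fin d → ℝ) × (Fin d → ℝ), Integrable fun s =>
       f (q.1 + s, q.2) * f (q.1, q.2 + s) * φ s := fun q =>
    hφ.integrable.bdd_mul (c := 1) (Measurable.aestronglyMeasurable (by fun_prop))
      (Eventually.of_forall fun s => abs_mul_le_one (hf.abs_le_one _) (hf.abs_le_one _))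
  have hIM : ∀ q : (Fin d → ℝ) × (Fin d → ℝ), Integrable fun s =>
       f (q.1 + s, q.2) * f (q.1, q.2 + s) * φ s * M q s :=
    fun q => (hI q).mul_bdd (hM1 q).aestronglyMeasurable (Eventually.of_forall (hMb q))
  set main : (Fin d → ℝ) × (Fin d → ℝ) → ℝ := fun q =>
    ∫ s, f (q.1 + s, q.2) * f (q.1, q.2 + s) * φ s * M q s with hmain
  have hmain_m : Measurable main := by
    have : StronglyMeasurable fun z : ((Fin d → ℝ) × (Fin d → ℝ)) × (Fin d → ℝ) =>
        f (z.1.1 + z.2, z.1.2) * f (z.1.1, z.1.2 + z.2) * φ z.2 * Function.uncurry M z :=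
      Measurable.stronglyMeasurable (by fun_prop)
    exact this.integral_prod_right'.measurable
  have hpt : ∀ q, |cornerConv f φ q * cornerConv f φ' q - main q|
      ≤ ∫ s, |φ s| * ∫ r, |φ' (r + s) - φ' r| := by
    intro q
    have e : cornerConv f φ q * cornerConv f φ' q - main q
        = ∫ s, f (q.1 + s, q.2) * f (q.1, q.2 + s) * φ s * (cornerConv f φ' q - M q s) := by
      simp only [mul_sub]
      rw [integral_sub ((hI q).mul_const _) (hIM q), integral_mul_const]
      rfl
    rw [e, ← Real.norm_eq_abs]
    refine norm_integral_le_of_norm_le (hφ.integrable_mul_modulus hφ')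
      (Eventually.of_forall fun s => ?_)
    rw [norm_mul, norm_mul _ (φ s)]
    refine mul_le_mul ?_ (hshift q s) (norm_nonneg _) (abs_nonneg _)
    exact mul_le_of_le_one_left (norm_nonneg _)
      (abs_mul_le_one (hf.abs_le_one _) (hf.abs_le_one _))
  have hsuppD : ∀ q, cornerConv f φ q * cornerConv f φ' q - main q ≠ 0 →
      q ∈ Set.Icc a (a + fun _ => N) ×ˢ Set.Icc b (b + fun _ => N) := by
    intro q hq
    by_contra hnot
    have h0 : ∀ s, f (q.1 + s, q.2) * f (q.1, q.2 + s) = 0 := by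
      intro s
      by_contra hne
      exact hnot ⟨(hab _ (right_ne_zero_of_mul hne)).1, (hab _ (left_ne_zero_of_mul hne)).2⟩
    refine hq ?_
    simp [hmain, cornerConv, h0]
  have hmain_supp : ∀ q, main q ≠ 0 →
      q ∈ Set.Icc a (a + fun _ => N) ×ˢ Set.Icc b (b + fun _ => N) := by
    intro q hq
    by_contra hnot
    have h0 : ∀ s, f (q.1 + s, q.2) * f (q.1, q.2 + s) = 0 := by
      intro s
      by_contra hne
      exact hnot ⟨(hab _ (right_ne_zero_of_mul hne)).1, (hab _ (left_ne_zero_of_mul hne)).2⟩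
    refine hq ?_
    simp [hmain, h0]
  have hint_main : Integrable main := by
    refine integrable_of_bounded_support hmain_m.aestronglyMeasurable (L * L')
      (max (‖a‖ + N) (‖b‖ + N)) (fun q => ?_) (fun q hq => ?_)
    · have h1 : ∀ s, ‖f (q.1 + s, q.2) * f (q.1, q.2 + s) * φ s * M q s‖ ≤ |φ s| * L' := by
        intro s
        rw [norm_mul, norm_mul _ (φ s)]
        refine mul_le_mul ?_ (hMb q s) (norm_nonneg _) (abs_nonneg _)
        exact mul_le_of_le_one_left (norm_nonneg _)
          (abs_mul_le_one (hf.abs_le_one _) (hf.abs_le_one _))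
      refine (norm_integral_le_of_norm_le (hφ.integrable.norm.mul_const L')
        (Eventually.of_forall h1)).trans ?_
      rw [integral_mul_const]
      exact mul_le_mul_of_nonneg_right hφ.integral_abs_le hφ'.nonneg
    · have := hmain_supp q hq
      exact max_le_max (norm_le_of_mem_Icc_cube hN this.1) (norm_le_of_mem_Icc_cube hN this.2)
  have hint_D : Integrable fun q => cornerConv f φ q * cornerConv f φ' q :=
    (memLp_cornerConv hN hf hφ).integrable_mul (memLp_cornerConv hN hf hφ')
  have hmain_eq : ∫ q, main q = ∫ r, φ' r * shiftedForm f φ r := by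
    set g : ((Fin d → ℝ) × (Fin d → ℝ)) × (Fin d → ℝ) → (Fin d → ℝ) → ℝ := fun m r =>
      ((f (m.1.1 + m.2, m.1.2) * f (m.1.1 + m.2 + r, m.1.2))
        * (f (m.1.1, m.1.2 + m.2) * f (m.1.1, m.1.2 + m.2 + r)) * φ m.2) * φ' r with hg
    have hgm : Measurable (Function.uncurry g) := by
      simp only [hg, Function.uncurry_def]
      fun_prop
    have hC0 : 0 ≤ C := (abs_nonneg _).trans (hC 0)
    have hgb : ∀ m r, |g m r| ≤ 1 * C * C' := by
      intro m r
      simp only [hg]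
      rw [abs_mul _ (φ' r), abs_mul _ (φ m.2)]
      gcongr
      · exact abs_mul_le_one (abs_mul_le_one (hf.abs_le_one _) (hf.abs_le_one _))
          (abs_mul_le_one (hf.abs_le_one _) (hf.abs_le_one _))
      · exact hC _
      · exact hC' _
    have hgs : ∀ m r, g m r ≠ 0 → ‖m‖ ≤ max (max (‖a‖ + N) (‖b‖ + N)) σ ∧ ‖r‖ ≤ σ' := by
      intro m r h
      have hl := left_ne_zero_of_mul h
      have h1 := hab _ (left_ne_zero_of_mul (left_ne_zero_of_mul (left_ne_zero_of_mul hl)))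
      have h2 := hab _ (left_ne_zero_of_mul (right_ne_zero_of_mul (left_ne_zero_of_mul hl)))
      refine ⟨max_le_max (max_le_max (norm_le_of_mem_Icc_cube hN h2.1)
        (norm_le_of_mem_Icc_cube hN h1.2)) (hσ _ (right_ne_zero_of_mul hl)),
        hσ' _ (right_ne_zero_of_mul h)⟩
    have hgint : Integrable (Function.uncurry g)
        ((volume.prod volume).prod volume) :=
      integrable_of_bounded_support hgm.aestronglyMeasurable (1 * C * C')
        (max (max (max (‖a‖ + N) (‖b‖ + N)) σ) σ') (fun z => hgb z.1 z.2)
        (fun z hz => max_le_max (hgs _ _ hz).1 (hgs _ _ hz).2)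
    have hgint' : ∀ r, Integrable (fun m => g m r) (volume.prod volume) := fun r =>
      integrable_of_bounded_support (hgm.comp measurable_prodMk_right).aestronglyMeasurable
        (1 * C * C') _ (fun m => hgb m r) (fun m hm => (hgs m r hm).1)
    calc ∫ q, main q = ∫ q, ∫ s, ∫ r, g (q, s) r := by
          refine integral_congr_ae (Eventually.of_forall fun q => ?_)
          refine integral_congr_ae (Eventually.of_forall fun s => ?_)
          simp only [hM, hg]
          rw [← integral_const_mul]
          refine integral_congr_ae (Eventually.of_forall fun r => ?_)
          simp only
          ring
      _ = ∫ m, ∫ r, g m r ∂volume ∂(volume.prod volume) := by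
          exact (integral_prod (fun m => ∫ r, g m r) hgint.integral_prod_left).symm
      _ = ∫ r, ∫ m, g m r ∂(volume.prod volume) := integral_integral_swap hgint
      _ = ∫ r, φ' r * shiftedForm f φ r := by
          refine integral_congr_ae (Eventually.of_forall fun r => ?_)
          simp only
          rw [integral_prod _ (hgint' r), shiftedForm_eq hN hf hφ, ← integral_const_mul]
          refine integral_congr_ae (Eventually.of_forall fun q => ?_)
          simp only
          rw [← integral_const_mul]
          simp only [hg, mul_comm (φ' r)]
  have hdecomp : ∫ q, cornerConv f φ q * cornerConv f φ' q
      = (∫ q, (cornerConv f φ q * cornerConv f φ' q - main q)) + ∫ q, main q := by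
    rw [integral_sub hint_D hint_main, sub_add_cancel]
  rw [hdecomp]
  refine (abs_add_le _ _).trans (add_le_add (abs_integral_le_of_box hN hpt hsuppD) ?_)
  rw [hmain_eq]
  refine (abs_integral_le_integral_abs).trans (le_of_eq ?_)
  simp only [abs_mul]

lemma sq_sum_abs_integral_cornerCount_le (hN : 0 ≤ N) (hγ : 0 ≤ γ) (hf : IsBoxWeight N f)
    (hψ : IsLacunary J L γ ψ) :
    (∑ j ∈ Finset.range J, |∫ s, cornerCount f s * ψ j s|) ^ 2
      ≤ (J * L ^ 2 + 2 * (J ^ 2 * γ + J * (L * √(2 * L ^ 2 * J + 2 * γ * J ^ 2))))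
        * (N ^ (2 * d)) ^ 2 := by
  obtain ⟨a, b, hab⟩ := hf.support
  set v := N ^ (2 * d) with hv
  have hv0 : 0 ≤ v := by positivity
  set B := √(2 * L ^ 2 * J + 2 * γ * J ^ 2) with hB
  have hB0 : 0 ≤ B := Real.sqrt_nonneg _
  simp only [integral_cornerCount_mul hN hf (hψ.isKernel _)]
  have hInt : ∀ j k, Integrable fun r => |ψ k r| * |shiftedForm f (ψ j) r| := fun j k =>
    (hψ.isKernel k).integrable.norm.mul_bdd
      (measurable_shiftedForm hf.measurable (hψ.isKernel j).measurable).norm.aestronglyMeasurable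
      (Eventually.of_forall fun r => by
        simpa using abs_shiftedForm_le hN hf (hψ.isKernel j) r)
  have hsum := sum_sum_le_of_symm (c := L ^ 2 * v) J
    (b := fun j k => γ * v + ∫ r, |ψ k r| * |shiftedForm f (ψ j) r|)
    (a := fun j k => |∫ q, cornerConv f (ψ j) q * cornerConv f (ψ k) q|)
    (fun j k => by simp only [mul_comm])
    (fun j k => add_nonneg (by positivity) (integral_nonneg fun _ => by positivity))
    (fun j _ => by
      refine abs_integral_le_of_box hN (fun q => ?_)
        (fun q hq => cornerConv_support hab q (left_ne_zero_of_mul hq))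
      rw [abs_mul, ← sq]
      exact pow_le_pow_left₀ (abs_nonneg _) (abs_cornerConv_le hf (hψ.isKernel j) q) 2)
    (fun j k hjk hk => (abs_integral_cornerConv_mul_le hN hf (hψ.isKernel j)
      (hψ.isKernel k)).trans (add_le_add_left
        (mul_le_mul_of_nonneg_right (hψ.modulus_le j k hjk hk) hv0) _))
  have hinner : ∀ k, ∑ j ∈ Finset.range J, (γ * v + ∫ r, |ψ k r| * |shiftedForm f (ψ j) r|)
      ≤ J * (γ * v) + L * (B * v) := by
    intro k
    rw [Finset.sum_add_distrib, ← integral_finsetSum _ fun j _ => hInt j k]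
    simp only [Finset.sum_const, Finset.card_range, nsmul_eq_mul]
    refine add_le_add_right ?_ _
    calc ∫ r, ∑ j ∈ Finset.range J, |ψ k r| * |shiftedForm f (ψ j) r|
        ≤ ∫ r, |ψ k r| * (B * v) := by
          refine integral_mono (integrable_finsetSum _ fun j _ => hInt j k)
            ((hψ.isKernel k).integrable.norm.mul_const _) fun r => ?_
          simp only
          rw [← Finset.mul_sum]
          exact mul_le_mul_of_nonneg_left (sum_abs_integral_antidiagConv_le hN hγ
            (hf.mul_translate_fst r) (hf.mul_translate_snd r) hψ) (abs_nonneg _)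
      _ = (∫ r, |ψ k r|) * (B * v) := integral_mul_const _ _
      _ ≤ L * (B * v) := mul_le_mul_of_nonneg_right (hψ.isKernel k).integral_abs_le
          (by positivity)
  have hsq := sq_sum_abs_integral_mul_le (Finset.range J) (hf.memLp_two hN)
    (fun j => memLp_cornerConv hN hf (hψ.isKernel j))
  refine hsq.trans ((mul_le_mul (integral_mul_self_le hN hf) (hsum.trans
    (add_le_add_right (mul_le_mul_of_nonneg_left
      (Finset.sum_le_sum fun k _ => hinner k) zero_le_two) _))
    (Finset.sum_nonneg fun _ _ => Finset.sum_nonneg fun _ _ => abs_nonneg _) hv0).trans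
    (le_of_eq ?_))
  simp only [Finset.sum_const, Finset.card_range, nsmul_eq_mul]
  ring

end

end Corners

namespace Corners

open scoped Topology

/-! ### Dilated kernels -/

variable {d : ℕ}

/-- The `L¹`-normalised dilation of `ψ` by the factor `r`. -/
noncomputable def dilate (ψ : (Fin d → ℝ) → ℝ) (r : ℝ) (s : Fin d → ℝ) : ℝ :=
  (r ^ d)⁻¹ * ψ (r⁻¹ • s)

section

variable {ψ : (Fin d → ℝ) → ℝ} {L r : ℝ}

lemma integral_comp_smul_pi (g : (Fin d → ℝ) → ℝ) (hr : 0 < r) :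
    ∫ s, g (r • s) = (r ^ d)⁻¹ * ∫ s, g s := by
  rw [Measure.integral_comp_smul, Module.finrank_fin_fun, smul_eq_mul,
    abs_of_pos (inv_pos.2 (pow_pos hr d))]

lemma integral_mul_comp_inv_smul (g : (Fin d → ℝ) → ℝ) (hr : 0 < r) :
    ∫ s, (r ^ d)⁻¹ * g (r⁻¹ • s) = ∫ s, g s := by
  rw [integral_const_mul, integral_comp_smul_pi g (inv_pos.2 hr), ← mul_assoc, inv_pow, inv_inv,
    inv_mul_cancel₀ (pow_pos hr d).ne', one_mul]

lemma abs_dilate (hr : 0 < r) (s) : |dilate ψ r s| = (r ^ d)⁻¹ * |ψ (r⁻¹ • s)| := by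
  rw [dilate, abs_mul, abs_of_pos (inv_pos.2 (pow_pos hr d))]

lemma isKernel_dilate (hψ : IsKernel L ψ) (hr : 0 < r) : IsKernel L (dilate ψ r) where
  measurable := by
    have := hψ.measurable
    unfold dilate
    fun_prop
  bounded := by
    obtain ⟨C, hC⟩ := hψ.bounded
    refine ⟨(r ^ d)⁻¹ * C, fun s => ?_⟩
    rw [abs_dilate hr]
    exact mul_le_mul_of_nonneg_left (hC _) (by positivity)
  support := by
    obtain ⟨R, hR⟩ := hψ.support
    refine ⟨r * R, fun s hs => ?_⟩
    have := hR _ (right_ne_zero_of_mul hs)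
    rwa [norm_smul, norm_inv, Real.norm_of_nonneg hr.le, inv_mul_le_iff₀ hr] at this
  integral_abs_le := by
    simp only [abs_dilate hr]
    rw [integral_mul_comp_inv_smul (fun s => |ψ s|) hr]
    exact hψ.integral_abs_le
  integral_eq_zero := by
    simp only [dilate]
    rw [integral_mul_comp_inv_smul _ hr]
    exact hψ.integral_eq_zero

lemma integral_mul_dilate (g : (Fin d → ℝ) → ℝ) (hr : 0 < r) :
    ∫ s, g s * dilate ψ r s = ∫ u, g (r • u) * ψ u := by
  rw [← integral_mul_comp_inv_smul (fun u => g (r • u) * ψ u) hr]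
  refine integral_congr_ae (Eventually.of_forall fun s => ?_)
  simp only [dilate, smul_smul, mul_inv_cancel₀ hr.ne', one_smul]
  ring

lemma integral_abs_dilate_translate_sub (hr : 0 < r) (s : Fin d → ℝ) :
    ∫ x, |dilate ψ r (x + s) - dilate ψ r x| = ∫ x, |ψ (x + r⁻¹ • s) - ψ x| := by
  rw [← integral_mul_comp_inv_smul (fun x => |ψ (x + r⁻¹ • s) - ψ x|) hr]
  refine integral_congr_ae (Eventually.of_forall fun x => ?_)
  simp only [dilate, smul_add]
  rw [← mul_sub, abs_mul, abs_of_pos (inv_pos.2 (pow_pos hr d))]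

lemma integral_abs_dilate_mul_modulus {r' : ℝ} (hr : 0 < r) (hr' : 0 < r') :
    ∫ s, |dilate ψ r s| * ∫ x, |dilate ψ r' (x + s) - dilate ψ r' x|
      = ∫ u, |ψ u| * ∫ x, |ψ (x + (r'⁻¹ * r) • u) - ψ x| := by
  rw [← integral_mul_comp_inv_smul
    (fun u => |ψ u| * ∫ x, |ψ (x + (r'⁻¹ * r) • u) - ψ x|) hr]
  refine integral_congr_ae (Eventually.of_forall fun s => ?_)
  simp only [integral_abs_dilate_translate_sub hr', abs_dilate hr, smul_smul]
  rw [mul_assoc r'⁻¹, mul_inv_cancel₀ hr.ne', mul_one, mul_assoc]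

lemma exists_isLacunary_dilate (hψ : IsKernel L ψ) {γ : ℝ} (hγ : 0 < γ) :
    ∃ R : ℝ, 0 < R ∧ ∀ (J : ℕ) (l : ℕ → ℝ), (∀ j, 0 < l j) → (∀ j k, j < k → R * l j ≤ l k) →
      IsLacunary J L γ fun j => dilate ψ (l j) := by
  obtain ⟨σ, hσ⟩ := hψ.support
  have hL := hψ.nonneg
  have ht := tendsto_integral_norm_translate_sub volume hψ.integrable
  have hpos : 0 < γ / (L + 1) := by positivity
  obtain ⟨ρ, hρ, hρ'⟩ := Metric.eventually_nhds_iff_ball.1 (ht.eventually_lt_const hpos)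
  refine ⟨(|σ| + 1) / ρ, by positivity, fun J l hl hR => ⟨fun j => isKernel_dilate hψ (hl j), ?_⟩⟩
  intro j k hjk _
  rw [integral_abs_dilate_mul_modulus (hl j) (hl k)]
  have hb : ∀ u, |ψ u| * ∫ x, |ψ (x + ((l k)⁻¹ * l j) • u) - ψ x| ≤ |ψ u| * (γ / (L + 1)) := by
    intro u
    by_cases hu : ψ u = 0
    · simp [hu]
    refine mul_le_mul_of_nonneg_left (hρ' _ ?_).le (abs_nonneg _)
    have h1 := hR j k hjk
    rw [div_mul_eq_mul_div, div_le_iff₀ hρ] at h1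
    rw [mem_ball_zero_iff, norm_smul, norm_mul, norm_inv, Real.norm_of_nonneg (hl k).le,
      Real.norm_of_nonneg (hl j).le, mul_assoc, inv_mul_lt_iff₀ (hl k)]
    nlinarith [hσ u hu, le_abs_self σ, hl j, hl k]
  calc ∫ u, |ψ u| * ∫ x, |ψ (x + ((l k)⁻¹ * l j) • u) - ψ x|
      ≤ ∫ u, |ψ u| * (γ / (L + 1)) :=
        integral_mono_of_nonneg (Eventually.of_forall fun u =>
          mul_nonneg (abs_nonneg _) (integral_nonneg fun _ => abs_nonneg _))
          (hψ.integrable.norm.mul_const _) (Eventually.of_forall hb)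
    _ = (∫ u, |ψ u|) * (γ / (L + 1)) := integral_mul_const _ _
    _ ≤ (L + 1) * (γ / (L + 1)) := mul_le_mul_of_nonneg_right
        (hψ.integral_abs_le.trans (by linarith)) hpos.le
    _ = γ := by field_simp

/-- For every kernel there is a number `J` such that, among any `J` sufficiently separated scales,
the corner counting function of any box weight has small correlation with the dilated kernel at
one of the scales. -/
lemma exists_abs_integral_cornerCount_mul_le (hψ : IsKernel L ψ) {τ : ℝ} (hτ : 0 < τ) :
    ∃ (J : ℕ) (R : ℝ), 0 < R ∧ ∀ l : ℕ → ℝ, (∀ j, 0 < l j) → (∀ j k, j < k → R * l j ≤ l k) →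
      ∀ N : ℝ, 0 < N → ∀ f : (Fin d → ℝ) × (Fin d → ℝ) → ℝ, IsBoxWeight N f →
        ∃ j < J, |∫ u, cornerCount f (l j • u) * ψ u| ≤ τ * N ^ (2 * d) := by
  have hL := hψ.nonneg
  set K := 2 * L ^ 2 + 2 with hK
  have hK0 : 0 < K := by positivity
  obtain ⟨J, hJ⟩ := exists_nat_gt (max 1 ((3 * K / τ ^ 2) ^ 2))
  have hJ1 : (1 : ℝ) < J := (le_max_left _ _).trans_lt hJ
  have hJ2 : (3 * K / τ ^ 2) ^ 2 < J := (le_max_right _ _).trans_lt hJ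
  have hγ : (0 : ℝ) < (J : ℝ)⁻¹ := by positivity
  obtain ⟨R, hR0, hR⟩ := exists_isLacunary_dilate hψ hγ
  refine ⟨J, R, hR0, fun l hl hlR N hN f hf => ?_⟩
  by_contra! hcon
  have hmain := sq_sum_abs_integral_cornerCount_le hN.le hγ.le hf (hR J l hl hlR)
  simp only [integral_mul_dilate _ (hl _)] at hmain
  set v := N ^ (2 * d) with hv
  have hv0 : 0 < v := by positivity
  have hlow : J * (τ * v)
      ≤ ∑ j ∈ Finset.range J, |∫ u, cornerCount f (l j • u) * ψ u| := by
    have := Finset.card_nsmul_le_sum (Finset.range J)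
      (fun j => |∫ u, cornerCount f (l j • u) * ψ u|) (τ * v)
      (fun j hj => (hcon j (Finset.mem_range.1 hj)).le)
    simpa using this
  have hsq := (pow_le_pow_left₀ (by positivity) hlow 2).trans hmain
  have h1 : (J * τ) ^ 2 ≤ J * L ^ 2 + 2 * (J ^ 2 * (J : ℝ)⁻¹
      + J * (L * √(2 * L ^ 2 * J + 2 * (J : ℝ)⁻¹ * J ^ 2))) := by
    refine le_of_mul_le_mul_right ?_ (pow_pos hv0 2)
    calc (J * τ) ^ 2 * v ^ 2 = (J * (τ * v)) ^ 2 := by ring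
      _ ≤ _ := hsq
  set x := √(J : ℝ) with hx
  have hxx : x ^ 2 = J := Real.sq_sqrt (by positivity)
  have hx1 : 1 ≤ x := Real.one_le_sqrt.2 hJ1.le
  have h2 : √(2 * L ^ 2 * J + 2 * (J : ℝ)⁻¹ * J ^ 2) = √K * x := by
    rw [hx, ← Real.sqrt_mul hK0.le]
    congr 1
    field_simp
    rw [hK]
    ring
  have h3 : L ≤ √K := Real.le_sqrt_of_sq_le (by nlinarith)
  have h4 : L * √K ≤ K := by
    nlinarith [Real.sq_sqrt hK0.le, Real.sqrt_nonneg K]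
  have h5 : (J : ℝ) ^ 2 * (J : ℝ)⁻¹ = J := by field_simp
  rw [h2, h5, ← hxx] at h1
  have h6 : x * τ ^ 2 ≤ 3 * K := by
    have : x ^ 3 * (x * τ ^ 2) ≤ x ^ 3 * (3 * K) := by
      have h7 : L * (√K * x) ≤ K * x := by nlinarith
      have h8 : x ^ 2 * (L ^ 2 + 2) ≤ x ^ 2 * (K * x) := by
        refine mul_le_mul_of_nonneg_left ?_ (by positivity)
        nlinarith [sq_nonneg L]
      nlinarith [mul_le_mul_of_nonneg_left h7 (by positivity : 0 ≤ 2 * x ^ 2)]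
    exact le_of_mul_le_mul_left this (by positivity)
  have h9 : x ≤ 3 * K / τ ^ 2 := by
    rw [le_div_iff₀ (by positivity)]
    exact h6
  have := pow_le_pow_left₀ (by positivity) h9 2
  linarith

end

end Corners

namespace Corners

open scoped Topology

/-! ### Averages of the corner counting function over a cube -/

/-- Nondegenerate corners `(x₁, y₁), (x₂, y₁), (x₁, y₂)` in a square grid, coded as
`((x₁, y₁), (x₂, y₂))`. -/
def gridCorners (n : ℕ) : Finset ((ℕ × ℕ) × (ℕ × ℕ)) :=
  ((Finset.range n ×ˢ Finset.range n) ×ˢ (Finset.range n ×ˢ Finset.range n)).filter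
    fun c => c.1.1 ≠ c.2.1 ∧ c.1.1 + c.2.2 = c.2.1 + c.1.2

lemma card_gridCorners_le (n : ℕ) : (gridCorners n).card ≤ n ^ 4 := by
  refine (Finset.card_filter_le _ _).trans (le_of_eq ?_)
  simp only [Finset.card_product, Finset.card_range]
  ring

lemma sum_grid_le {n : ℕ} {ε : ℝ} (hε : 0 < ε) (hn : cornersTheoremBound (ε / 9) ≤ n)
    {a : ℕ × ℕ → ℝ} (ha : ∀ z, a z = 0 ∨ a z = 1) :
    ∑ z ∈ Finset.range n ×ˢ Finset.range n, a z
      ≤ n ^ 2 * ∑ c ∈ gridCorners n, a c.1 * a (c.2.1, c.1.2) * a (c.1.1, c.2.2) + ε * n ^ 2 := by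
  have ha0 : ∀ z, 0 ≤ a z := fun z => by rcases ha z with h | h <;> simp [h]
  have hterm : ∀ c : (ℕ × ℕ) × (ℕ × ℕ), 0 ≤ a c.1 * a (c.2.1, c.1.2) * a (c.1.1, c.2.2) :=
    fun c => mul_nonneg (mul_nonneg (ha0 _) (ha0 _)) (ha0 _)
  set B := (Finset.range n ×ˢ Finset.range n).filter fun z => a z = 1 with hB
  have hsum : ∑ z ∈ Finset.range n ×ˢ Finset.range n, a z = B.card := by
    rw [hB, Finset.card_filter]
    push_cast
    refine Finset.sum_congr rfl fun z _ => ?_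
    rcases ha z with h | h <;> simp [h]
  have hcard : (B.card : ℝ) ≤ n ^ 2 := by
    have : B.card ≤ n * n := (Finset.card_filter_le _ _).trans (by simp)
    rw [sq]
    exact_mod_cast this
  rw [hsum]
  rcases lt_or_ge (B.card : ℝ) (ε * n ^ 2) with h | h
  · have : 0 ≤ n ^ 2 * ∑ c ∈ gridCorners n, a c.1 * a (c.2.1, c.1.2) * a (c.1.1, c.2.2) :=
      mul_nonneg (by positivity) (Finset.sum_nonneg fun c _ => hterm c)
    linarith
  · have hnot := corners_theorem_nat hε hn B (Finset.filter_subset _ _) h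
    simp only [IsCornerFree, not_forall] at hnot
    obtain ⟨x₁, y₁, x₂, y₂, hc, hne⟩ := hnot
    have h1 := Finset.mem_filter.1 (Finset.mem_coe.1 hc.fst_fst_mem)
    have h2 := Finset.mem_filter.1 (Finset.mem_coe.1 hc.fst_snd_mem)
    have h3 := Finset.mem_filter.1 (Finset.mem_coe.1 hc.snd_fst_mem)
    have hmem : ((x₁, y₁), (x₂, y₂)) ∈ gridCorners n := by
      have h1' := Finset.mem_product.1 h1.1
      have h2' := Finset.mem_product.1 h2.1
      have h3' := Finset.mem_product.1 h3.1
      exact Finset.mem_filter.2 ⟨Finset.mem_product.2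
        ⟨h1.1, Finset.mem_product.2 ⟨h3'.1, h2'.2⟩⟩, hne, hc.add_eq_add⟩
    have hone := Finset.single_le_sum (fun c _ => hterm c) hmem
    rw [show a ((x₁, y₁), (x₂, y₂)).1 = 1 from h1.2, h2.2, h3.2] at hone
    nlinarith [sq_nonneg (n : ℝ)]

variable {d : ℕ} {N : ℝ} {f : (Fin d → ℝ) × (Fin d → ℝ) → ℝ}

lemma integral_grid_corner (f : (Fin d → ℝ) × (Fin d → ℝ) → ℝ) {c : (ℕ × ℕ) × (ℕ × ℕ)}
    (hc : c.1.1 + c.2.2 = c.2.1 + c.1.2) (v : Fin d → ℝ) :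
    ∫ q : (Fin d → ℝ) × (Fin d → ℝ), f (q.1 + (c.1.1 : ℝ) • v, q.2 + (c.1.2 : ℝ) • v)
        * f (q.1 + (c.2.1 : ℝ) • v, q.2 + (c.1.2 : ℝ) • v)
        * f (q.1 + (c.1.1 : ℝ) • v, q.2 + (c.2.2 : ℝ) • v)
      = cornerCount f (((c.2.1 : ℝ) - c.1.1) • v) := by
  have hc' : (c.1.1 : ℝ) + c.2.2 = c.2.1 + c.1.2 := by exact_mod_cast hc
  have e := integral_add_right_eq_self (μ := (volume : Measure ((Fin d → ℝ) × (Fin d → ℝ))))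
    (fun q => f q * f (q.1 + ((c.2.1 : ℝ) - c.1.1) • v, q.2)
      * f (q.1, q.2 + ((c.2.1 : ℝ) - c.1.1) • v)) ((c.1.1 : ℝ) • v, (c.1.2 : ℝ) • v)
  rw [cornerCount, ← e]
  refine integral_congr_ae (Eventually.of_forall fun q => ?_)
  simp only [Prod.add_def, add_assoc, ← add_smul]
  rw [show (c.1.1 : ℝ) + (c.2.1 - c.1.1) = c.2.1 by ring,
    show (c.1.2 : ℝ) + (c.2.1 - c.1.1) = c.2.2 by linarith]

lemma IsBoxWeight.integrable_corner (hf : IsBoxWeight N f) (hN : 0 ≤ N)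
    (u v w : (Fin d → ℝ) × (Fin d → ℝ)) :
    Integrable fun q => f (q + u) * f (q + v) * f (q + w) := by
  have hm := hf.measurable
  have h1 : Integrable fun q => f (q + u) := (hf.integrable hN).comp_add_right u
  have h2 : Integrable fun q => f (q + u) * f (q + v) :=
    h1.mul_bdd (c := 1) (Measurable.aestronglyMeasurable (by fun_prop))
      (Eventually.of_forall fun q => hf.abs_le_one _)
  exact h2.mul_bdd (c := 1) (Measurable.aestronglyMeasurable (by fun_prop))
      (Eventually.of_forall fun q => hf.abs_le_one _)

lemma sum_gridCorners_cornerCount_ge {n : ℕ} {δ : ℝ} (hδ : 0 < δ)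
    (hn : cornersTheoremBound (δ / (2 * 9 ^ d) / 9) ≤ n) (hn0 : 0 < n) (hN : 0 ≤ N)
    (hf : IsBoxWeight N f) (hf01 : ∀ q, f q = 0 ∨ f q = 1) (hδf : δ * N ^ (2 * d) ≤ ∫ q, f q)
    {v : Fin d → ℝ} (hv : n * ‖v‖ ≤ N) :
    δ / 2 * N ^ (2 * d) ≤ ∑ c ∈ gridCorners n, cornerCount f (((c.2.1 : ℝ) - c.1.1) • v) := by
  obtain ⟨a, b, hab⟩ := hf.support
  set ε := δ / (2 * 9 ^ d) with hε
  have hε0 : 0 < ε := by positivity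
  set F : ℕ × ℕ → (Fin d → ℝ) × (Fin d → ℝ) → ℝ := fun z q =>
    f (q.1 + (z.1 : ℝ) • v, q.2 + (z.2 : ℝ) • v) with hF
  set a' : Fin d → ℝ := a - fun _ => N with ha'
  set b' : Fin d → ℝ := b - fun _ => N with hb'
  set D := Set.Icc a' (a' + fun _ => 3 * N) ×ˢ Set.Icc b' (b' + fun _ => 3 * N) with hD
  have hvi : ∀ (k : ℕ) (i : Fin d), k < n → |(k : ℝ) * v i| ≤ N := by
    intro k i hk
    have h1 : |v i| ≤ ‖v‖ := norm_le_pi_norm v i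
    have h2 : (k : ℝ) ≤ n := by exact_mod_cast hk.le
    rw [abs_mul, Nat.abs_cast]
    exact (mul_le_mul h2 h1 (abs_nonneg _) (by positivity)).trans hv
  have hcube : ∀ (a x : Fin d → ℝ) (k : ℕ), k < n → x + (k : ℝ) • v ∈ Set.Icc a (a + fun _ => N) →
      x ∈ Set.Icc (a - fun _ => N) ((a - fun _ => N) + fun _ => 3 * N) := by
    intro a x k hk hx
    refine ⟨fun i => ?_, fun i => ?_⟩
    · have h1 := hx.1 i
      have h2 := abs_le.1 (hvi k i hk)
      simp only [Pi.add_apply, Pi.smul_apply, smul_eq_mul, Pi.sub_apply] at h1 ⊢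
      linarith
    · have h1 := hx.2 i
      have h2 := abs_le.1 (hvi k i hk)
      simp only [Pi.add_apply, Pi.smul_apply, smul_eq_mul, Pi.sub_apply] at h1 ⊢
      linarith
  have hsupp : ∀ z ∈ Finset.range n ×ˢ Finset.range n, ∀ q, q ∉ D → F z q = 0 := by
    intro z hz q hq
    by_contra hne
    rw [Finset.mem_product, Finset.mem_range, Finset.mem_range] at hz
    have h := hab _ hne
    exact hq ⟨hcube a q.1 z.1 hz.1 h.1, hcube b q.2 z.2 hz.2 h.2⟩
  have hterm : ∀ c : (ℕ × ℕ) × (ℕ × ℕ), ∀ q, 0 ≤ F c.1 q * F (c.2.1, c.1.2) q * F (c.1.1, c.2.2) q :=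
    fun c q => mul_nonneg (mul_nonneg (hf.nonneg _) (hf.nonneg _)) (hf.nonneg _)
  have hpt : ∀ q, ∑ z ∈ Finset.range n ×ˢ Finset.range n, F z q
      ≤ n ^ 2 * ∑ c ∈ gridCorners n, F c.1 q * F (c.2.1, c.1.2) q * F (c.1.1, c.2.2) q
        + D.indicator (fun _ => ε * n ^ 2) q := by
    intro q
    by_cases hq : q ∈ D
    · rw [Set.indicator_of_mem hq]
      exact sum_grid_le hε0 hn fun z => hf01 _
    · rw [Set.indicator_of_notMem hq, Finset.sum_eq_zero fun z hz => hsupp z hz q hq, add_zero]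
      exact mul_nonneg (by positivity) (Finset.sum_nonneg fun c _ => hterm c q)
  have hDvol : volume D = ENNReal.ofReal ((3 * N) ^ (2 * d)) := volume_box a' b' (by positivity)
  have hDm : MeasurableSet D := measurableSet_Icc.prod measurableSet_Icc
  have hFint : ∀ z, Integrable (F z) := fun z =>
    (hf.integrable hN).comp_add_right ((z.1 : ℝ) • v, (z.2 : ℝ) • v)
  have hcint : ∀ c : (ℕ × ℕ) × (ℕ × ℕ),
      Integrable fun q => F c.1 q * F (c.2.1, c.1.2) q * F (c.1.1, c.2.2) q :=
    fun c => hf.integrable_corner hN ((c.1.1 : ℝ) • v, (c.1.2 : ℝ) • v)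
      ((c.2.1 : ℝ) • v, (c.1.2 : ℝ) • v) ((c.1.1 : ℝ) • v, (c.2.2 : ℝ) • v)
  have hDint : Integrable (D.indicator fun _ => ε * (n : ℝ) ^ 2) := by
    refine (integrable_indicator_iff hDm).2 (integrableOn_const ?_)
    rw [hDvol]
    exact ENNReal.ofReal_ne_top
  have hInt := integral_mono (integrable_finsetSum _ fun z _ => hFint z)
    (((integrable_finsetSum _ fun c _ => hcint c).const_mul _).add hDint) hpt
  simp only [Pi.add_apply] at hInt
  rw [integral_add ((integrable_finsetSum _ fun c _ => hcint c).const_mul _) hDint,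
    integral_const_mul, integral_finsetSum _ (fun z _ => hFint z),
    integral_finsetSum _ (fun c _ => hcint c), integral_indicator_const _ hDm,
    Measure.real, hDvol, ENNReal.toReal_ofReal (by positivity)] at hInt
  have hFz : ∀ z, ∫ q, F z q = ∫ q, f q := fun z =>
    integral_add_right_eq_self f ((z.1 : ℝ) • v, (z.2 : ℝ) • v)
  simp only [hFz] at hInt
  rw [Finset.sum_congr rfl fun c hc =>
    integral_grid_corner f (Finset.mem_filter.1 hc).2.2 v] at hInt
  simp only [Finset.sum_const, Finset.card_product, Finset.card_range, nsmul_eq_mul,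
    smul_eq_mul] at hInt
  have hpow : (3 * N) ^ (2 * d) * (ε * n ^ 2) = n ^ 2 * (δ / 2 * N ^ (2 * d)) := by
    rw [hε, mul_pow, pow_mul 3]
    norm_num
    field_simp
  rw [hpow] at hInt
  have hn2 : (0 : ℝ) < (n : ℝ) ^ 2 := by positivity
  refine le_of_mul_le_mul_left ?_ hn2
  push_cast at hInt
  nlinarith [mul_le_mul_of_nonneg_left hδf hn2.le]

lemma setIntegral_comp_smul_le {g : (Fin d → ℝ) → ℝ} (hg : Continuous g) (hg0 : ∀ u, 0 ≤ g u)
    {r : ℝ} (hr0 : r ≠ 0) (hr1 : |r| ≤ 1) :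
    ∫ u in Metric.closedBall 0 1, g (r • u)
      ≤ (|r| ^ d)⁻¹ * ∫ u in Metric.closedBall 0 1, g u := by
  have hm : MeasurableSet (Metric.closedBall (0 : Fin d → ℝ) 1) := measurableSet_closedBall
  have hi : Integrable ((Metric.closedBall (0 : Fin d → ℝ) 1).indicator g) :=
    (integrable_indicator_iff hm).2
      (hg.continuousOn.integrableOn_compact (isCompact_closedBall _ _))
  rw [← integral_indicator hm, ← integral_indicator hm]
  have e := Measure.integral_comp_smul volume ((Metric.closedBall (0 : Fin d → ℝ) 1).indicator g) r
  rw [Module.finrank_fin_fun, smul_eq_mul, abs_inv, abs_pow] at e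
  rw [← e]
  refine integral_mono_of_nonneg (Eventually.of_forall fun u =>
    Set.indicator_nonneg (fun _ _ => hg0 _) _) (hi.comp_smul hr0)
    (Eventually.of_forall fun u => ?_)
  simp only
  by_cases hu : u ∈ Metric.closedBall (0 : Fin d → ℝ) 1
  · have hu' : r • u ∈ Metric.closedBall (0 : Fin d → ℝ) 1 := by
      rw [mem_closedBall_zero_iff] at hu ⊢
      rw [norm_smul]
      exact mul_le_one₀ hr1 (norm_nonneg _) hu
    rw [Set.indicator_of_mem hu, Set.indicator_of_mem hu']
  · rw [Set.indicator_of_notMem hu]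
    exact Set.indicator_nonneg (fun _ _ => hg0 _) _

/-- A set of positive density in a box contains many corners at every scale not exceeding the side
length of the box. -/
lemma exists_setIntegral_cornerCount_ge (d : ℕ) {δ : ℝ} (hδ : 0 < δ) :
    ∃ c : ℝ, 0 < c ∧ ∀ (N l : ℝ) (f : (Fin d → ℝ) × (Fin d → ℝ) → ℝ), 0 < l → l ≤ N →
      IsBoxWeight N f → (∀ q, f q = 0 ∨ f q = 1) → δ * N ^ (2 * d) ≤ ∫ q, f q →
        c * N ^ (2 * d) ≤ ∫ u in Metric.closedBall 0 1, cornerCount f (l • u) := by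
  set n := cornersTheoremBound (δ / (2 * 9 ^ d) / 9) + 1 with hn
  have hn0 : (0 : ℝ) < n := by rw [hn]; positivity
  refine ⟨δ / 2 / (n ^ 4 * n ^ d), by positivity, fun N l f hl hlN hf hf01 hδf => ?_⟩
  have hN : 0 ≤ N := hl.le.trans hlN
  set g : (Fin d → ℝ) → ℝ := fun u => cornerCount f (l • u) with hg
  have hgc : Continuous g := (hf.continuous_cornerCount hN).comp (continuous_const_smul l)
  have hg0 : ∀ u, 0 ≤ g u := fun u => hf.cornerCount_nonneg _
  set I := ∫ u in Metric.closedBall (0 : Fin d → ℝ) 1, g u with hI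
  have hI0 : 0 ≤ I := integral_nonneg fun u => hg0 u
  have hgint : ∀ r : ℝ, IntegrableOn (fun u => g (r • u)) (Metric.closedBall (0 : Fin d → ℝ) 1) :=
    fun r => (hgc.comp (continuous_const_smul r)).continuousOn.integrableOn_compact
      (isCompact_closedBall _ _)
  set ρ : (ℕ × ℕ) × (ℕ × ℕ) → ℝ := fun c => ((c.2.1 : ℝ) - c.1.1) / n with hρ
  have hpt : ∀ u ∈ Metric.closedBall (0 : Fin d → ℝ) 1,
      δ / 2 * N ^ (2 * d) ≤ ∑ c ∈ gridCorners n, g (ρ c • u) := by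
    intro u hu
    have h := sum_gridCorners_cornerCount_ge (n := n) hδ (Nat.le_succ _) (Nat.succ_pos _) hN hf
      hf01 hδf (v := (l / n) • u) ?_
    · refine h.trans (le_of_eq (Finset.sum_congr rfl fun c _ => ?_))
      simp only [hg, hρ, smul_smul]
      congr 2
      ring
    · rw [mem_closedBall_zero_iff] at hu
      rw [norm_smul, Real.norm_of_nonneg (by positivity), ← mul_assoc, mul_div_cancel₀ _ hn0.ne']
      nlinarith
  have hvol : (1 : ℝ) ≤ (volume : Measure (Fin d → ℝ)).real (Metric.closedBall 0 1) := by
    rw [Measure.real, Real.volume_pi_closedBall _ zero_le_one, ENNReal.toReal_ofReal (by positivity)]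
    exact one_le_pow₀ (by norm_num)
  have hterm : ∀ c ∈ gridCorners n,
      ∫ u in Metric.closedBall (0 : Fin d → ℝ) 1, g (ρ c • u) ≤ n ^ d * I := by
    intro c hc
    obtain ⟨hmem, hne, -⟩ := Finset.mem_filter.1 hc
    simp only [Finset.mem_product, Finset.mem_range] at hmem
    have hz : (1 : ℝ) ≤ |(c.2.1 : ℝ) - c.1.1| := by
      have : (1 : ℤ) ≤ |(c.2.1 : ℤ) - c.1.1| := Int.one_le_abs (by omega)
      exact_mod_cast this
    have hz' : |(c.2.1 : ℝ) - c.1.1| ≤ n := by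
      have h1 : (c.2.1 : ℝ) ≤ n := by exact_mod_cast hmem.2.1.le
      have h2 : (c.1.1 : ℝ) ≤ n := by exact_mod_cast hmem.1.1.le
      rw [abs_le]
      constructor <;> linarith [Nat.cast_nonneg (α := ℝ) c.2.1, Nat.cast_nonneg (α := ℝ) c.1.1]
    have habs : |ρ c| = |(c.2.1 : ℝ) - c.1.1| / n := by
      rw [hρ, abs_div, abs_of_pos hn0]
    have hlow : 1 / (n : ℝ) ≤ |ρ c| := by
      rw [habs]
      gcongr
    have hpos : 0 < |ρ c| := (by positivity : (0 : ℝ) < 1 / n).trans_le hlow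
    refine (setIntegral_comp_smul_le hgc hg0 (abs_pos.1 hpos) ?_).trans ?_
    · rw [habs]
      exact (div_le_one hn0).2 hz'
    · refine mul_le_mul_of_nonneg_right ?_ hI0
      rw [inv_le_comm₀ (by positivity) (by positivity), ← inv_pow, ← one_div]
      exact pow_le_pow_left₀ (by positivity) hlow d
  have hlower : δ / 2 * N ^ (2 * d)
      ≤ ∫ u in Metric.closedBall (0 : Fin d → ℝ) 1, ∑ c ∈ gridCorners n, g (ρ c • u) := by
    have h := setIntegral_ge_of_const_le_real (μ := (volume : Measure (Fin d → ℝ)))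
      measurableSet_closedBall (measure_closedBall_lt_top.ne) hpt
      (integrable_finsetSum _ fun c _ => hgint (ρ c))
    exact (le_mul_of_one_le_right (by positivity) hvol).trans h
  rw [integral_finsetSum _ fun c _ => hgint (ρ c)] at hlower
  have hupper : ∑ c ∈ gridCorners n, ∫ u in Metric.closedBall (0 : Fin d → ℝ) 1, g (ρ c • u)
      ≤ n ^ 4 * (n ^ d * I) := by
    refine (Finset.sum_le_card_nsmul _ _ _ hterm).trans ?_
    rw [nsmul_eq_mul]
    refine mul_le_mul_of_nonneg_right ?_ (by positivity)
    exact_mod_cast card_gridCorners_le n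
  rw [div_mul_eq_mul_div, div_le_iff₀ (by positivity)]
  calc δ / 2 * N ^ (2 * d) ≤ n ^ 4 * (n ^ d * I) := hlower.trans hupper
    _ = _ := by ring

end Corners

namespace Corners

open scoped Topology

/-! ### An oscillatory integral in one variable -/

lemma exists_sub_eq_mul_of_hasDerivAt {F F' : ℝ → ℝ} {a b : ℝ}
    (h : ∀ x ∈ Set.uIcc a b, HasDerivAt F (F' x) x) :
    ∃ ξ ∈ Set.uIcc a b, F b - F a = (b - a) * F' ξ := by
  rcases lt_trichotomy a b with hab | hab | hab
  · rw [Set.uIcc_of_le hab.le] at h ⊢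
    obtain ⟨ξ, hξ, e⟩ := exists_hasDerivAt_eq_slope F F' hab
      (fun x hx => (h x hx).continuousAt.continuousWithinAt) (fun x hx => h x ⟨hx.1.le, hx.2.le⟩)
    refine ⟨ξ, ⟨hξ.1.le, hξ.2.le⟩, ?_⟩
    rw [e, mul_div_cancel₀ _ (sub_pos.2 hab).ne']
  · subst hab
    exact ⟨a, Set.left_mem_uIcc, by simp⟩
  · rw [Set.uIcc_of_ge hab.le] at h ⊢
    obtain ⟨ξ, hξ, e⟩ := exists_hasDerivAt_eq_slope F F' hab
      (fun x hx => (h x hx).continuousAt.continuousWithinAt) (fun x hx => h x ⟨hx.1.le, hx.2.le⟩)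
    refine ⟨ξ, ⟨hξ.1.le, hξ.2.le⟩, ?_⟩
    have : a - b ≠ 0 := (sub_pos.2 hab).ne'
    rw [e]
    field_simp
    ring

/-- The mixed second difference of `F` with vertices `z - x - y` and so on. -/
def mixedDiff (F : ℝ → ℝ) (x x' y y' z : ℝ) : ℝ :=
  F (z - x - y) - F (z - x - y') - F (z - x' - y) + F (z - x' - y')

/-- The four vertices of the mixed second difference lie in `[1, 2]`. -/
def MixedMem (x x' y y' z : ℝ) : Prop :=
  z - x - y ∈ Set.Icc (1 : ℝ) 2 ∧ z - x - y' ∈ Set.Icc (1 : ℝ) 2 ∧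
    z - x' - y ∈ Set.Icc (1 : ℝ) 2 ∧ z - x' - y' ∈ Set.Icc (1 : ℝ) 2

variable {x x' y y' z : ℝ}

lemma exists_mixedDiff_eq {F F' F'' : ℝ → ℝ} (hF : ∀ s ∈ Set.Icc (1 : ℝ) 2, HasDerivAt F (F' s) s)
    (hF' : ∀ s ∈ Set.Icc (1 : ℝ) 2, HasDerivAt F' (F'' s) s) (hz : MixedMem x x' y y' z) :
    ∃ ξ ∈ Set.Icc (1 : ℝ) 2, mixedDiff F x x' y y' z = (x' - x) * ((y' - y) * F'' ξ) := by
  obtain ⟨h1, h2, h3, h4⟩ := hz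
  have hmem : ∀ w, z - x - w ∈ Set.Icc (1 : ℝ) 2 → z - x' - w ∈ Set.Icc (1 : ℝ) 2 →
      ∀ s ∈ Set.uIcc (z - x') (z - x), s - w ∈ Set.Icc (1 : ℝ) 2 := by
    intro w hw hw' s hs
    rcases Set.mem_uIcc.1 hs with hs | hs <;> constructor <;>
      linarith [hw.1, hw.2, hw'.1, hw'.2, hs.1, hs.2]
  obtain ⟨η, hη, e⟩ := exists_sub_eq_mul_of_hasDerivAt (a := z - x') (b := z - x)
    (F := fun s => F (s - y) - F (s - y')) (F' := fun s => F' (s - y) - F' (s - y'))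
    (fun s hs => (((hF _ (hmem y h1 h3 s hs)).comp_sub_const s y).sub
      ((hF _ (hmem y' h2 h4 s hs)).comp_sub_const s y')))
  have g1 := hmem y h1 h3 η hη
  have g2 := hmem y' h2 h4 η hη
  obtain ⟨ξ, hξ, e'⟩ := exists_sub_eq_mul_of_hasDerivAt (a := η - y') (b := η - y)
    (F := F') (F' := F'') (fun s hs => hF' s (Set.uIcc_subset_Icc g2 g1 hs))
  refine ⟨ξ, Set.uIcc_subset_Icc g2 g1 hξ, ?_⟩
  rw [e'] at e
  rw [mixedDiff]
  linear_combination e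

/-- The first derivative test for oscillatory integrals. -/
lemma norm_integral_exp_le {φ φ' φ'' : ℝ → ℝ} {a b A B : ℝ} (hab : a ≤ b) (hA : 0 < A)
    (hφ : ∀ s ∈ Set.Icc a b, HasDerivAt φ (φ' s) s)
    (hφ' : ∀ s ∈ Set.Icc a b, HasDerivAt φ' (φ'' s) s) (hc : ContinuousOn φ'' (Set.Icc a b))
    (hlow : ∀ s ∈ Set.Icc a b, A ≤ |φ' s|) (hup : ∀ s ∈ Set.Icc a b, |φ'' s| ≤ B) :
    ‖∫ s in a..b, Complex.exp (φ s * Complex.I)‖ ≤ 2 / A + B / A ^ 2 * (b - a) := by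
  have hne : ∀ s ∈ Set.Icc a b, (φ' s : ℂ) ≠ 0 := fun s hs => by
    have := hA.trans_le (hlow s hs)
    exact_mod_cast abs_pos.1 this
  have hnorm : ∀ s, ‖Complex.exp (φ s * Complex.I)‖ = 1 := fun s =>
    Complex.norm_exp_ofReal_mul_I _
  have hφc : ContinuousOn φ (Set.Icc a b) := fun s hs => (hφ s hs).continuousAt.continuousWithinAt
  have hφc' : ContinuousOn φ' (Set.Icc a b) := fun s hs =>
    (hφ' s hs).continuousAt.continuousWithinAt
  set E : ℝ → ℂ := fun s => Complex.exp (φ s * Complex.I) with hE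
  have hEc : ContinuousOn E (Set.Icc a b) :=
    Complex.continuous_exp.comp_continuousOn
      ((Complex.continuous_ofReal.comp_continuousOn hφc).mul continuousOn_const)
  set R : ℝ → ℂ := fun s => E s * (φ'' s / (φ' s ^ 2 * Complex.I)) with hR
  have hRc : ContinuousOn R (Set.Icc a b) :=
    hEc.mul ((Complex.continuous_ofReal.comp_continuousOn hc).div
      (((Complex.continuous_ofReal.comp_continuousOn hφc').pow 2).mul continuousOn_const)
      fun s hs => mul_ne_zero (pow_ne_zero _ (hne s hs)) Complex.I_ne_zero)
  have hderiv : ∀ s ∈ Set.uIcc a b,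
      HasDerivAt (fun s => E s / (φ' s * Complex.I)) (E s - R s) s := by
    intro s hs
    rw [Set.uIcc_of_le hab] at hs
    have h1 : HasDerivAt E (E s * (φ' s * Complex.I)) s :=
      ((hφ s hs).ofReal_comp.mul_const Complex.I).cexp
    have h2 := (hφ' s hs).ofReal_comp.mul_const Complex.I
    have h3 := h1.div h2 (mul_ne_zero (hne s hs) Complex.I_ne_zero)
    refine h3.congr_deriv ?_
    have := hne s hs
    have hI := Complex.I_ne_zero
    simp only [hR]
    field_simp
  have hInt := intervalIntegral.integral_eq_sub_of_hasDerivAt hderiv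
    (ContinuousOn.intervalIntegrable (by rw [Set.uIcc_of_le hab]; exact hEc.sub hRc))
  rw [intervalIntegral.integral_sub
    (ContinuousOn.intervalIntegrable (by rw [Set.uIcc_of_le hab]; exact hEc))
    (ContinuousOn.intervalIntegrable (by rw [Set.uIcc_of_le hab]; exact hRc)), sub_eq_iff_eq_add]
    at hInt
  rw [hInt]
  have hend : ∀ s ∈ Set.Icc a b, ‖E s / (φ' s * Complex.I)‖ ≤ 1 / A := by
    intro s hs
    rw [norm_div, hnorm, norm_mul, Complex.norm_I, mul_one, Complex.norm_real]
    exact one_div_le_one_div_of_le hA (hlow s hs)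
  have hRb : ∀ s ∈ Set.uIoc a b, ‖R s‖ ≤ B / A ^ 2 := by
    intro s hs
    rw [Set.uIoc_of_le hab] at hs
    have hs' : s ∈ Set.Icc a b := ⟨hs.1.le, hs.2⟩
    have hB : 0 ≤ B := (abs_nonneg _).trans (hup s hs')
    simp only [hR]
    rw [norm_mul, hnorm, one_mul, norm_div, norm_mul, norm_pow, Complex.norm_I, mul_one,
      Complex.norm_real, Complex.norm_real]
    exact div_le_div₀ hB (hup s hs') (by positivity) (pow_le_pow_left₀ hA.le (hlow s hs') 2)
  calc _ ≤ ‖E b / (φ' b * Complex.I)‖ + ‖E a / (φ' a * Complex.I)‖ + ‖∫ s in a..b, R s‖ :=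
        (norm_add_le _ _).trans (add_le_add_left (norm_sub_le _ _) _)
    _ ≤ 1 / A + 1 / A + B / A ^ 2 * |b - a| := by
        refine add_le_add (add_le_add (hend b ⟨hab, le_rfl⟩) (hend a ⟨le_rfl, hab⟩)) ?_
        exact intervalIntegral.norm_integral_le_of_norm_le_const hRb
    _ = _ := by rw [abs_of_nonneg (sub_nonneg.2 hab)]; ring

end Corners

namespace Corners

open scoped Topology

/-! ### Derivative bounds for sums of powers -/

lemma rpow_le_two_rpow_abs {s : ℝ} (hs : s ∈ Set.Icc (1 : ℝ) 2) (a : ℝ) :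
    s ^ a ≤ 2 ^ |a| :=
  (Real.rpow_le_rpow_of_exponent_le hs.1 (le_abs_self a)).trans
    (Real.rpow_le_rpow (by linarith [hs.1]) hs.2 (abs_nonneg a))

lemma two_rpow_neg_abs_le_rpow {s : ℝ} (hs : s ∈ Set.Icc (1 : ℝ) 2) (a : ℝ) :
    2 ^ (-|a|) ≤ s ^ a :=
  (Real.rpow_le_rpow_of_nonpos (by linarith [hs.1]) hs.2 (neg_nonpos.2 (abs_nonneg a))).trans
    (Real.rpow_le_rpow_of_exponent_le hs.1 (neg_abs_le a))

lemma hasDerivAt_const_mul_rpow (c a : ℝ) {s : ℝ} (hs : s ∈ Set.Icc (1 : ℝ) 2) :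
    HasDerivAt (fun s => c * s ^ a) (c * a * s ^ (a - 1)) s := by
  have hs0 : s ≠ 0 := by linarith [hs.1]
  simpa [mul_assoc] using (Real.hasDerivAt_rpow_const (p := a) (Or.inl hs0)).const_mul c

/-- The function `exp (i t s ^ p)` cut off to the interval `[1, 2]`. -/
noncomputable def oscOne (p t s : ℝ) : ℂ :=
  (Set.Icc (1 : ℝ) 2).indicator (fun s => Complex.exp ((t * s ^ p : ℝ) * Complex.I)) s

lemma measurable_oscOne (p t : ℝ) : Measurable (oscOne p t) :=
  Measurable.indicator (by fun_prop) measurableSet_Icc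

lemma norm_oscOne_le (p t s : ℝ) : ‖oscOne p t s‖ ≤ 1 := by
  rw [oscOne]
  refine (norm_indicator_le_norm_self _ _).trans ?_
  rw [Complex.norm_exp_ofReal_mul_I]

/-- The product of four translates of `oscOne` arising from two Cauchy–Schwarz steps. -/
noncomputable def mixedOsc (p t x x' y y' z : ℝ) : ℂ :=
  oscOne p t (z - x - y) * (starRingEnd ℂ) (oscOne p t (z - x - y'))
    * (starRingEnd ℂ) (oscOne p t (z - x' - y) * (starRingEnd ℂ) (oscOne p t (z - x' - y')))

variable {p t x x' y y' z : ℝ}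

lemma mixedOsc_of_mixedMem (hz : MixedMem x x' y y' z) :
    mixedOsc p t x x' y y' z
      = Complex.exp ((t * mixedDiff (fun s => s ^ p) x x' y y' z : ℝ) * Complex.I) := by
  obtain ⟨h1, h2, h3, h4⟩ := hz
  rw [mixedOsc, oscOne, oscOne, oscOne, oscOne, Set.indicator_of_mem h1, Set.indicator_of_mem h2,
    Set.indicator_of_mem h3, Set.indicator_of_mem h4, map_mul, ← Complex.exp_conj,
    ← Complex.exp_conj, ← Complex.exp_conj, ← Complex.exp_conj, ← Complex.exp_add,
    ← Complex.exp_add, ← Complex.exp_add]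
  simp only [map_mul, Complex.conj_ofReal, Complex.conj_I, map_neg, neg_neg, mixedDiff]
  congr 1
  push_cast
  ring

lemma mixedOsc_of_not_mixedMem (hz : ¬ MixedMem x x' y y' z) : mixedOsc p t x x' y y' z = 0 := by
  rw [mixedOsc, oscOne, oscOne, oscOne, oscOne]
  simp only [MixedMem, not_and_or] at hz
  rcases hz with h | h | h | h <;> simp [Set.indicator_of_notMem h]

lemma norm_mixedOsc_le : ‖mixedOsc p t x x' y y' z‖ ≤ 1 := by
  rw [mixedOsc]
  simp only [norm_mul, RCLike.norm_conj]
  exact mul_le_one₀ (mul_le_one₀ (norm_oscOne_le _ _ _) (norm_nonneg _) (norm_oscOne_le _ _ _))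
    (by positivity) (mul_le_one₀ (norm_oscOne_le _ _ _) (norm_nonneg _) (norm_oscOne_le _ _ _))

lemma hasDerivAt_mixedDiff {F F' : ℝ → ℝ} (hF : ∀ s ∈ Set.Icc (1 : ℝ) 2, HasDerivAt F (F' s) s)
    (hz : MixedMem x x' y y' z) :
    HasDerivAt (mixedDiff F x x' y y') (mixedDiff F' x x' y y' z) z := by
  obtain ⟨h1, h2, h3, h4⟩ := hz
  have key : ∀ u v, z - u - v ∈ Set.Icc (1 : ℝ) 2 →
      HasDerivAt (fun z => F (z - u - v)) (F' (z - u - v)) z := by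
    intro u v h
    have := (hF _ h).comp z (((hasDerivAt_id z).sub_const u).sub_const v)
    simpa [Function.comp_def] using this
  exact (((key _ _ h1).sub (key _ _ h2)).sub (key _ _ h3)).add (key _ _ h4)

lemma exists_mixedMem_iff (x x' y y' : ℝ) :
    ∃ a b : ℝ, b - a ≤ 1 ∧ ∀ z, MixedMem x x' y y' z ↔ z ∈ Set.Icc a b := by
  refine ⟨max (max (x + y) (x + y')) (max (x' + y) (x' + y')) + 1,
    min (min (x + y) (x + y')) (min (x' + y) (x' + y')) + 2, ?_, fun z => ?_⟩
  · have h1 := (min_le_left (min (x + y) (x + y')) (min (x' + y) (x' + y'))).trans (min_le_left _ _)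
    have h2 := (le_max_left (x + y) (x + y')).trans
      (le_max_left _ (max (x' + y) (x' + y')))
    linarith
  · rw [Set.mem_Icc, ← le_sub_iff_add_le, ← sub_le_iff_le_add]
    simp only [MixedMem, Set.mem_Icc, max_le_iff, le_min_iff]
    constructor
    · rintro ⟨h1, h2, h3, h4⟩
      refine ⟨⟨⟨?_, ?_⟩, ?_, ?_⟩, ⟨?_, ?_⟩, ?_, ?_⟩ <;> linarith
    · rintro ⟨⟨⟨h1, h2⟩, h3, h4⟩, ⟨h5, h6⟩, h7, h8⟩
      refine ⟨⟨?_, ?_⟩, ⟨?_, ?_⟩, ⟨?_, ?_⟩, ?_, ?_⟩ <;> linarith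

lemma exists_norm_integral_mixedOsc_le (hp0 : p ≠ 0) (hp1 : p ≠ 1) (hp2 : p ≠ 2) :
    ∃ C : ℝ, 0 < C ∧ ∀ t x x' y y' : ℝ, 0 < t → x ≠ x' → y ≠ y' →
      x ∈ Set.Icc (0 : ℝ) 1 → y ∈ Set.Icc (0 : ℝ) 1 →
      ‖∫ z in Set.Icc (0 : ℝ) 4, mixedOsc p t x x' y y' z‖ ≤ C / (t * |x' - x| * |y' - y|) := by
  set k := |p * (p - 1) * (p - 2)| with hk
  have hk0 : 0 < k := abs_pos.2 (mul_ne_zero (mul_ne_zero hp0 (sub_ne_zero.2 hp1))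
    (sub_ne_zero.2 hp2))
  set c₁ := k * 2 ^ (-|p - 3|) with hc₁
  have hc₁0 : 0 < c₁ := by positivity
  set c₂ := k * |p - 3| * 2 ^ |p - 4| with hc₂
  have hc₂0 : 0 ≤ c₂ := by positivity
  refine ⟨2 / c₁ + c₂ / c₁ ^ 2, by positivity, fun t x x' y y' ht hx hy hx1 hy1 => ?_⟩
  set m := t * |x' - x| * |y' - y| with hm
  have hm0 : 0 < m := mul_pos (mul_pos ht (abs_pos.2 (sub_ne_zero.2 hx.symm)))
    (abs_pos.2 (sub_ne_zero.2 hy.symm))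
  obtain ⟨a, b, hba, hab⟩ := exists_mixedMem_iff x x' y y'
  have hsub : Set.Icc a b ⊆ Set.Icc 0 4 := by
    intro z hz
    obtain ⟨h, -⟩ := (hab z).2 hz
    constructor <;> linarith [h.1, h.2, hx1.1, hx1.2, hy1.1, hy1.2]
  have hind : ∀ z, mixedOsc p t x x' y y' z = (Set.Icc a b).indicator (fun z =>
      Complex.exp ((t * mixedDiff (fun s => s ^ p) x x' y y' z : ℝ) * Complex.I)) z := by
    intro z
    by_cases hz : z ∈ Set.Icc a b
    · rw [Set.indicator_of_mem hz, mixedOsc_of_mixedMem ((hab z).2 hz)]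
    · rw [Set.indicator_of_notMem hz, mixedOsc_of_not_mixedMem (mt (hab z).1 hz)]
  simp only [hind]
  rw [setIntegral_indicator measurableSet_Icc, Set.inter_eq_right.2 hsub]
  rcases lt_or_ge b a with hlt | hle
  · rw [Set.Icc_eq_empty (not_le.2 hlt)]
    simp only [Measure.restrict_empty, integral_zero_measure, norm_zero]
    positivity
  rw [integral_Icc_eq_integral_Ioc, ← intervalIntegral.integral_of_le hle]
  have d0 : ∀ s ∈ Set.Icc (1 : ℝ) 2, HasDerivAt (fun s : ℝ => s ^ p) (p * s ^ (p - 1)) s :=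
    fun s hs => by simpa using hasDerivAt_const_mul_rpow 1 p hs
  have d1 : ∀ s ∈ Set.Icc (1 : ℝ) 2,
      HasDerivAt (fun s : ℝ => p * s ^ (p - 1)) (p * (p - 1) * s ^ (p - 2)) s := fun s hs => by
    have := hasDerivAt_const_mul_rpow p (p - 1) hs
    rwa [show p - 1 - 1 = p - 2 by ring] at this
  have d2 : ∀ s ∈ Set.Icc (1 : ℝ) 2, HasDerivAt (fun s : ℝ => p * (p - 1) * s ^ (p - 2))
      (p * (p - 1) * (p - 2) * s ^ (p - 3)) s := fun s hs => by
    have := hasDerivAt_const_mul_rpow (p * (p - 1)) (p - 2) hs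
    rwa [show p - 2 - 1 = p - 3 by ring] at this
  have d3 : ∀ s ∈ Set.Icc (1 : ℝ) 2,
      HasDerivAt (fun s : ℝ => p * (p - 1) * (p - 2) * s ^ (p - 3))
        (p * (p - 1) * (p - 2) * (p - 3) * s ^ (p - 4)) s := fun s hs => by
    have := hasDerivAt_const_mul_rpow (p * (p - 1) * (p - 2)) (p - 3) hs
    rwa [show p - 3 - 1 = p - 4 by ring] at this
  have hosc := norm_integral_exp_le (A := m * c₁) (B := m * c₂) hle (by positivity)
    (φ := fun z => t * mixedDiff (fun s => s ^ p) x x' y y' z)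
    (φ' := fun z => t * mixedDiff (fun s => p * s ^ (p - 1)) x x' y y' z)
    (φ'' := fun z => t * mixedDiff (fun s => p * (p - 1) * s ^ (p - 2)) x x' y y' z)
    (fun z hz => (hasDerivAt_mixedDiff d0 ((hab z).2 hz)).const_mul t)
    (fun z hz => (hasDerivAt_mixedDiff d1 ((hab z).2 hz)).const_mul t)
    (fun z hz => ((hasDerivAt_mixedDiff d2 ((hab z).2 hz)).const_mul
      t).continuousAt.continuousWithinAt)
    (fun z hz => by
      obtain ⟨ξ, hξ, e⟩ := exists_mixedDiff_eq d1 d2 ((hab z).2 hz)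
      have h := two_rpow_neg_abs_le_rpow hξ (p - 3)
      have hpos : 0 < ξ ^ (p - 3) := Real.rpow_pos_of_pos (by linarith [hξ.1]) _
      simp only [e, abs_mul, abs_of_pos ht, abs_of_pos hpos]
      rw [hm, hc₁, hk]
      simp only [abs_mul]
      calc _ = t * |x' - x| * |y' - y| * (|p| * |p - 1| * |p - 2|) * 2 ^ (-|p - 3|) := by ring
        _ ≤ t * |x' - x| * |y' - y| * (|p| * |p - 1| * |p - 2|) * ξ ^ (p - 3) := by gcongr
        _ = _ := by ring)
    (fun z hz => by
      obtain ⟨ξ, hξ, e⟩ := exists_mixedDiff_eq d2 d3 ((hab z).2 hz)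
      have h := rpow_le_two_rpow_abs hξ (p - 4)
      have hpos : 0 < ξ ^ (p - 4) := Real.rpow_pos_of_pos (by linarith [hξ.1]) _
      simp only [e, abs_mul, abs_of_pos ht, abs_of_pos hpos]
      rw [hm, hc₂, hk]
      simp only [abs_mul]
      calc _ = t * |x' - x| * |y' - y| * (|p| * |p - 1| * |p - 2|) * |p - 3| * ξ ^ (p - 4) := by
            ring
        _ ≤ t * |x' - x| * |y' - y| * (|p| * |p - 1| * |p - 2|) * |p - 3| * 2 ^ |p - 4| := by
            gcongr
        _ = _ := by ring)
  refine hosc.trans ?_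
  calc 2 / (m * c₁) + m * c₂ / (m * c₁) ^ 2 * (b - a)
      ≤ 2 / (m * c₁) + m * c₂ / (m * c₁) ^ 2 * 1 := by gcongr
    _ = (2 / c₁ + c₂ / c₁ ^ 2) / m := by field_simp

lemma norm_integral_mixedOsc_le_four :
    ‖∫ z in Set.Icc (0 : ℝ) 4, mixedOsc p t x x' y y' z‖ ≤ 4 := by
  have h := norm_setIntegral_le_of_norm_le_const (μ := volume) (s := Set.Icc (0 : ℝ) 4) (C := 1)
    (by simp) (fun z _ => norm_mixedOsc_le (p := p) (t := t) (x := x) (x' := x') (y := y)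
      (y' := y') (z := z))
  simpa using h

lemma exists_norm_integral_mixedOsc_le_sqrt (hp0 : p ≠ 0) (hp1 : p ≠ 1) (hp2 : p ≠ 2) :
    ∃ C : ℝ, 0 < C ∧ ∀ t x x' y y' : ℝ, 0 < t → x ≠ x' → y ≠ y' →
      x ∈ Set.Icc (0 : ℝ) 1 → y ∈ Set.Icc (0 : ℝ) 1 →
      ‖∫ z in Set.Icc (0 : ℝ) 4, mixedOsc p t x x' y y' z‖
        ≤ C * (√t)⁻¹ * (√|x' - x|)⁻¹ * (√|y' - y|)⁻¹ := by
  obtain ⟨C, hC, h⟩ := exists_norm_integral_mixedOsc_le hp0 hp1 hp2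
  refine ⟨√(4 * C), by positivity, fun t x x' y y' ht hx hy hx1 hy1 => ?_⟩
  have h1 := h t x x' y y' ht hx hy hx1 hy1
  have h4 := norm_integral_mixedOsc_le_four (p := p) (t := t) (x := x) (x' := x') (y := y)
    (y' := y')
  set I := ‖∫ z in Set.Icc (0 : ℝ) 4, mixedOsc p t x x' y y' z‖ with hI
  have hI0 : 0 ≤ I := norm_nonneg _
  rw [← Real.sqrt_inv, ← Real.sqrt_inv, ← Real.sqrt_inv, ← Real.sqrt_mul (by positivity),
    ← Real.sqrt_mul (by positivity), ← Real.sqrt_mul (by positivity)]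
  refine Real.le_sqrt_of_sq_le ?_
  calc I ^ 2 = I * I := sq I
    _ ≤ 4 * (C / (t * |x' - x| * |y' - y|)) := mul_le_mul h4 h1 hI0 (by norm_num)
    _ = _ := by field_simp

end Corners

namespace Corners

open scoped Topology

/-! ### A Cauchy–Schwarz inequality -/

section CauchySchwarz

variable {X Y : Type*} [MeasurableSpace X] [MeasurableSpace Y] {μ : Measure X} {ν : Measure Y}
  [IsFiniteMeasure μ] [IsFiniteMeasure ν]

lemma integrable_of_norm_le {g : X → ℂ} (hg : Measurable g) (C : ℝ) (h : ∀ x, ‖g x‖ ≤ C) :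
    Integrable g μ :=
  Integrable.of_bound hg.aestronglyMeasurable C (Eventually.of_forall h)

lemma norm_mul_le_one {z w : ℂ} (hz : ‖z‖ ≤ 1) (hw : ‖w‖ ≤ 1) : ‖z * w‖ ≤ 1 := by
  rw [norm_mul]
  exact mul_le_one₀ hz (norm_nonneg _) hw

lemma norm_conj_le_one {z : ℂ} (hz : ‖z‖ ≤ 1) : ‖(starRingEnd ℂ) z‖ ≤ 1 := by
  rwa [RCLike.norm_conj]

lemma sq_integral_le_measureReal_mul {g : X → ℝ} (hg : Integrable g μ)
    (hg2 : Integrable (fun x => g x ^ 2) μ) :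
    (∫ x, g x ∂μ) ^ 2 ≤ μ.real Set.univ * ∫ x, g x ^ 2 ∂μ := by
  rcases eq_or_ne (μ.real Set.univ) 0 with h0 | h0
  · have : μ = 0 := by
      rwa [measureReal_def, ENNReal.toReal_eq_zero_iff, or_iff_left (measure_ne_top _ _),
        Measure.measure_univ_eq_zero] at h0
    simp [this]
  · have hpos : 0 < μ.real Set.univ := lt_of_le_of_ne measureReal_nonneg (Ne.symm h0)
    set M := μ.real Set.univ with hM
    set I := ∫ x, g x ∂μ with hI
    have key : 0 ≤ ∫ x, (M * g x - I) ^ 2 ∂μ := integral_nonneg fun x => sq_nonneg _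
    have : ∫ x, (M * g x - I) ^ 2 ∂μ = M * (M * (∫ x, g x ^ 2 ∂μ) - I ^ 2) := by
      have e : ∀ x, (M * g x - I) ^ 2 = M ^ 2 * g x ^ 2 - 2 * M * I * g x + I ^ 2 := fun x => by ring
      simp only [e]
      have hi : Integrable (fun x => M ^ 2 * g x ^ 2 - 2 * M * I * g x) μ :=
        (hg2.const_mul _).sub (hg.const_mul _)
      rw [integral_add hi (integrable_const _),
        integral_sub (hg2.const_mul _) (hg.const_mul _), integral_const_mul, integral_const_mul,
        integral_const, ← hM, ← hI, smul_eq_mul]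
      ring
    rw [this] at key
    have := nonneg_of_mul_nonneg_right key hpos
    linarith

lemma sq_norm_integral_mul_integral_le {u : X → ℂ} {k : X → Y → ℂ}
    (hu1 : ∀ x, ‖u x‖ ≤ 1) (hk : Measurable (Function.uncurry k)) (hk1 : ∀ x y, ‖k x y‖ ≤ 1) :
    ‖∫ x, u x * ∫ y, k x y ∂ν ∂μ‖ ^ 2
      ≤ μ.real Set.univ * ‖∫ w, ∫ x, k x w.1 * (starRingEnd ℂ) (k x w.2) ∂μ ∂(ν.prod ν)‖ := by
  set g : X → ℂ := fun x => ∫ y, k x y ∂ν with hgdef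
  have hgm : Measurable g := (StronglyMeasurable.integral_prod_right' (ν := ν)
    hk.stronglyMeasurable).measurable
  have hg1 : ∀ x, ‖g x‖ ≤ ν.real Set.univ := fun x => by
    simpa using norm_integral_le_of_norm_le_const (μ := ν) (Eventually.of_forall (hk1 x))
  have hgi : Integrable g μ := integrable_of_norm_le hgm _ hg1
  have hg2 : Integrable (fun x => ‖g x‖ ^ 2) μ := by
    refine Integrable.of_bound (by fun_prop) (ν.real Set.univ ^ 2) (Eventually.of_forall fun x => ?_)
    rw [Real.norm_eq_abs, abs_of_nonneg (by positivity)]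
    gcongr
    exact hg1 x
  have h1 : ‖∫ x, u x * g x ∂μ‖ ≤ ∫ x, ‖g x‖ ∂μ := by
    refine norm_integral_le_of_norm_le hgi.norm (Eventually.of_forall fun x => ?_)
    rw [norm_mul]
    exact mul_le_of_le_one_left (norm_nonneg _) (hu1 x)
  have h2 : ∫ x, ‖g x‖ ^ 2 ∂μ
      = ‖∫ w, ∫ x, k x w.1 * (starRingEnd ℂ) (k x w.2) ∂μ ∂(ν.prod ν)‖ := by
    have hmk : Measurable (Function.uncurry fun (x : X) (w : Y × Y) =>
        k x w.1 * (starRingEnd ℂ) (k x w.2)) := by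
      have m1 : Measurable fun q : X × (Y × Y) => k q.1 q.2.1 :=
        hk.comp (measurable_fst.prodMk measurable_snd.fst)
      have m2 : Measurable fun q : X × (Y × Y) => k q.1 q.2.2 :=
        hk.comp (measurable_fst.prodMk measurable_snd.snd)
      exact m1.mul (Complex.continuous_conj.measurable.comp m2)
    rw [← integral_integral_swap (integrable_of_norm_le hmk 1 fun q =>
      norm_mul_le_one (hk1 _ _) (norm_conj_le_one (hk1 _ _)))]
    have : ∀ x, ∫ w, k x w.1 * (starRingEnd ℂ) (k x w.2) ∂(ν.prod ν) = ((‖g x‖ ^ 2 : ℝ) : ℂ) := by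
      intro x
      rw [integral_prod_mul (fun y => k x y) (fun y => (starRingEnd ℂ) (k x y)), integral_conj,
        Complex.mul_conj, Complex.normSq_eq_norm_sq]
    simp only [this]
    rw [integral_complex_ofReal, Complex.norm_real, Real.norm_eq_abs,
      abs_of_nonneg (integral_nonneg fun x => by positivity)]
  calc ‖∫ x, u x * g x ∂μ‖ ^ 2 ≤ (∫ x, ‖g x‖ ∂μ) ^ 2 := by gcongr
    _ ≤ _ := sq_integral_le_measureReal_mul hgi.norm hg2
    _ = _ := by rw [h2]

end CauchySchwarz

end Corners

namespace Corners

open scoped Topology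

/-! ### Mixed oscillation -/

variable {d : ℕ} {p t : ℝ}

/-- The function `|s| ^ (-1/2)` cut off to the interval `[-1, 1]`. -/
noncomputable def invSqrt (s : ℝ) : ℝ := (Set.Icc (-1 : ℝ) 1).indicator (fun s => (√|s|)⁻¹) s

lemma invSqrt_nonneg (s : ℝ) : 0 ≤ invSqrt s :=
  Set.indicator_nonneg (fun _ _ => by positivity) s

lemma invSqrt_of_mem {x x' : ℝ} (hx : x ∈ Set.Icc (0 : ℝ) 1) (hx' : x' ∈ Set.Icc (0 : ℝ) 1) :
    invSqrt (x' - x) = (√|x' - x|)⁻¹ :=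
  Set.indicator_of_mem (Set.mem_Icc.2 ⟨by linarith [hx.2, hx'.1], by linarith [hx.1, hx'.2]⟩) _

lemma integrable_invSqrt : Integrable invSqrt := by
  have h : IntervalIntegrable (fun s : ℝ => (√|s|)⁻¹) volume (-1) 1 := by
    refine intervalIntegrable_of_even (fun x => by rw [abs_neg]) (fun x hx => ?_)
    refine (intervalIntegral.intervalIntegrable_rpow' (r := -(1 / 2)) (by norm_num)).congr ?_
    intro s hs
    rw [Set.uIoc_of_le hx.le] at hs
    simp only
    rw [abs_of_pos hs.1, Real.rpow_neg hs.1.le, Real.sqrt_eq_rpow]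
  rw [intervalIntegrable_iff_integrableOn_Icc_of_le (by norm_num)] at h
  exact (integrable_indicator_iff measurableSet_Icc).2 h

/-- The product of the functions `invSqrt` in the coordinates. -/
noncomputable def invSqrtProd (v : Fin d → ℝ) : ℝ := ∏ i, invSqrt (v i)

lemma invSqrtProd_nonneg (v : Fin d → ℝ) : 0 ≤ invSqrtProd v :=
  Finset.prod_nonneg fun i _ => invSqrt_nonneg (v i)

lemma integrable_invSqrtProd : Integrable (invSqrtProd (d := d)) :=
  Integrable.fintype_prod (f := fun _ => invSqrt) (fun _ => integrable_invSqrt)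

/-- Lebesgue measure on the cube `[0, r] ^ d`. -/
noncomputable def cubeMeasure (d : ℕ) (r : ℝ) : Measure (Fin d → ℝ) :=
  volume.restrict (Set.Icc 0 (fun _ => r))

lemma cubeMeasure_eq_pi (d : ℕ) (r : ℝ) :
    cubeMeasure d r = Measure.pi fun _ => volume.restrict (Set.Icc 0 r) := by
  rw [cubeMeasure, ← Measure.restrict_pi_pi, Set.pi_univ_Icc]
  rfl

instance (r : ℝ) : IsFiniteMeasure (cubeMeasure d r) := by
  rw [cubeMeasure_eq_pi]
  infer_instance

lemma cubeMeasure_real_univ {r : ℝ} (hr : 0 ≤ r) : (cubeMeasure d r).real Set.univ = r ^ d := by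
  have := volume_Icc_cube (0 : Fin d → ℝ) hr
  rw [zero_add] at this
  rw [cubeMeasure, measureReal_restrict_apply_univ, measureReal_def, this,
    ENNReal.toReal_ofReal (by positivity)]

lemma ae_cubeMeasure_mem (r : ℝ) : ∀ᵐ x ∂(cubeMeasure d r), x ∈ Set.Icc 0 (fun _ => r) :=
  ae_restrict_mem measurableSet_Icc

/-- Almost every pair of points of the unit cube has distinct coordinates. -/
lemma ae_cubeMeasure_prod :
    ∀ᵐ w ∂((cubeMeasure d 1).prod (cubeMeasure d 1)),
      ∀ i, w.1 i ≠ w.2 i ∧ w.1 i ∈ Set.Icc (0 : ℝ) 1 ∧ w.2 i ∈ Set.Icc (0 : ℝ) 1 := by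
  have h1 : MeasurableSet {w : (Fin d → ℝ) × (Fin d → ℝ) |
      ∀ i, w.1 i ≠ w.2 i ∧ w.1 i ∈ Set.Icc (0 : ℝ) 1 ∧ w.2 i ∈ Set.Icc (0 : ℝ) 1} := by
    rw [Set.ofPred_forall]
    refine MeasurableSet.iInter fun i => ?_
    have m1 : Measurable fun w : (Fin d → ℝ) × (Fin d → ℝ) => w.1 i := by fun_prop
    have m2 : Measurable fun w : (Fin d → ℝ) × (Fin d → ℝ) => w.2 i := by fun_prop
    exact ((measurableSet_eq_fun m1 m2).compl.inter
      ((m1 measurableSet_Icc).inter (m2 measurableSet_Icc)))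
  rw [Measure.ae_prod_iff_ae_ae h1]
  filter_upwards [ae_cubeMeasure_mem (d := d) 1] with x hx
  have h2 : ∀ᵐ y ∂(cubeMeasure d 1), ∀ i, y i ≠ x i := by
    rw [cubeMeasure_eq_pi, ae_all_iff]
    exact fun i => Measure.ae_eval_ne (α := fun _ => ℝ) (fun _ => volume.restrict (Set.Icc 0 1)) i
      (x i)
  filter_upwards [ae_cubeMeasure_mem (d := d) 1, h2] with y hy hxy i
  exact ⟨(hxy i).symm, ⟨hx.1 i, hx.2 i⟩, ⟨hy.1 i, hy.2 i⟩⟩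

lemma lintegral_invSqrtProd_sub_lt_top :
    ∫⁻ w, ENNReal.ofReal (invSqrtProd (w.2 - w.1)) ∂((cubeMeasure d 1).prod (cubeMeasure d 1))
      < ∞ := by
  have hfin : ∫⁻ v : Fin d → ℝ, ENNReal.ofReal (invSqrtProd v) < ∞ :=
    (integrable_invSqrtProd (d := d)).lintegral_lt_top
  refine (lintegral_prod_le _).trans_lt ?_
  calc ∫⁻ x, ∫⁻ y, ENNReal.ofReal (invSqrtProd (y - x)) ∂(cubeMeasure d 1) ∂(cubeMeasure d 1)
      ≤ ∫⁻ _x, (∫⁻ v : Fin d → ℝ, ENNReal.ofReal (invSqrtProd v)) ∂(cubeMeasure d 1) := by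
        refine lintegral_mono fun x => ?_
        calc ∫⁻ y, ENNReal.ofReal (invSqrtProd (y - x)) ∂(cubeMeasure d 1)
            ≤ ∫⁻ y, ENNReal.ofReal (invSqrtProd (y - x)) :=
              lintegral_mono' Measure.restrict_le_self le_rfl
          _ = _ := lintegral_sub_right_eq_self
              (fun v : Fin d → ℝ => ENNReal.ofReal (invSqrtProd v)) x
    _ < ∞ := by
        rw [lintegral_const]
        exact ENNReal.mul_lt_top hfin (measure_lt_top _ _)

/-- The product of the functions `oscOne` in the coordinates. -/
noncomputable def osc (p t : ℝ) (u : Fin d → ℝ) : ℂ := ∏ i, oscOne p t (u i)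

lemma measurable_osc (p t : ℝ) : Measurable (osc (d := d) p t) :=
  Finset.measurable_prod _ fun i _ => (measurable_oscOne p t).comp (measurable_pi_apply i)

lemma norm_osc_le (p t : ℝ) (u : Fin d → ℝ) : ‖osc p t u‖ ≤ 1 := by
  rw [osc, norm_prod]
  exact Finset.prod_le_one (fun _ _ => norm_nonneg _) fun i _ => norm_oscOne_le p t (u i)

/-- The product of four translates of `osc`. -/
noncomputable def mixedOscProd (p t : ℝ) (x x' y y' z : Fin d → ℝ) : ℂ :=
  osc p t (z - x - y) * (starRingEnd ℂ) (osc p t (z - x - y'))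
    * (starRingEnd ℂ) (osc p t (z - x' - y) * (starRingEnd ℂ) (osc p t (z - x' - y')))

lemma norm_integral_mixedOscProd_le {C : ℝ}
    (hC : ∀ t x x' y y' : ℝ, 0 < t → x ≠ x' → y ≠ y' →
      x ∈ Set.Icc (0 : ℝ) 1 → y ∈ Set.Icc (0 : ℝ) 1 →
      ‖∫ z in Set.Icc (0 : ℝ) 4, mixedOsc p t x x' y y' z‖
        ≤ C * (√t)⁻¹ * (√|x' - x|)⁻¹ * (√|y' - y|)⁻¹) (ht : 0 < t) {x x' y y' : Fin d → ℝ}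
    (hx : ∀ i, x i ≠ x' i ∧ x i ∈ Set.Icc (0 : ℝ) 1 ∧ x' i ∈ Set.Icc (0 : ℝ) 1)
    (hy : ∀ i, y i ≠ y' i ∧ y i ∈ Set.Icc (0 : ℝ) 1 ∧ y' i ∈ Set.Icc (0 : ℝ) 1) :
    ‖∫ z, mixedOscProd p t x x' y y' z ∂(cubeMeasure d 4)‖
      ≤ (C * (√t)⁻¹) ^ d * invSqrtProd (x' - x) * invSqrtProd (y' - y) := by
  have h1 : ∀ z : Fin d → ℝ, mixedOscProd p t x x' y y' z
      = ∏ i, mixedOsc p t (x i) (x' i) (y i) (y' i) (z i) := fun z => by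
    simp only [mixedOscProd, osc, mixedOsc, map_prod, map_mul, Finset.prod_mul_distrib,
      Pi.sub_apply]
  simp only [h1]
  rw [cubeMeasure_eq_pi, integral_fintype_prod_eq_prod
    (fun i s => mixedOsc p t (x i) (x' i) (y i) (y' i) s), norm_prod]
  calc ∏ i, ‖∫ z in Set.Icc (0 : ℝ) 4, mixedOsc p t (x i) (x' i) (y i) (y' i) z‖
      ≤ ∏ i, (C * (√t)⁻¹ * invSqrt ((x' - x) i) * invSqrt ((y' - y) i)) := by
        refine Finset.prod_le_prod (fun _ _ => norm_nonneg _) fun i _ => ?_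
        rw [Pi.sub_apply, Pi.sub_apply, invSqrt_of_mem (hx i).2.1 (hx i).2.2,
          invSqrt_of_mem (hy i).2.1 (hy i).2.2]
        exact hC t _ _ _ _ ht (hx i).1 (hy i).1 (hx i).2.1 (hy i).2.1
    _ = _ := by
        simp only [Finset.prod_mul_distrib, Finset.prod_const, Finset.card_univ, Fintype.card_fin,
          invSqrtProd, Pi.sub_apply, mul_pow]

end Corners

namespace Corners

open scoped Topology

/-! ### Bounds for the oscillatory trilinear form -/

variable {d : ℕ} {p t : ℝ}

section Regroup

variable {X Z W : Type*} [MeasurableSpace X] [MeasurableSpace Z] [MeasurableSpace W]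
  {μ : Measure X} {ν : Measure Z} {ρ : Measure W} [IsFiniteMeasure μ] [IsFiniteMeasure ν]
  [IsFiniteMeasure ρ]

lemma integral_prod_regroup {F : Z → X → W → ℂ}
    (hF : Measurable fun q : (Z × X) × W => F q.1.1 q.1.2 q.2) (hF1 : ∀ z x v, ‖F z x v‖ ≤ 1) :
    ∫ v, ∫ w, F w.1 w.2 v ∂(ν.prod μ) ∂ρ = ∫ w, ∫ x, F w.1 x w.2 ∂μ ∂(ν.prod ρ) := by
  calc ∫ v, ∫ w, F w.1 w.2 v ∂(ν.prod μ) ∂ρ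
      = ∫ v, ∫ z, ∫ x, F z x v ∂μ ∂ν ∂ρ := by
        refine integral_congr_ae (Eventually.of_forall fun v => ?_)
        exact integral_prod (fun w : Z × X => F w.1 w.2 v)
          (integrable_of_norm_le (hF.comp (measurable_id.prodMk measurable_const)) 1
            fun w => hF1 _ _ _)
    _ = ∫ z, ∫ v, ∫ x, F z x v ∂μ ∂ρ ∂ν := by
        refine integral_integral_swap (integrable_of_norm_le ?_ (μ.real Set.univ) fun q => ?_)
        · refine (StronglyMeasurable.integral_prod_right' (ν := μ) (f := fun q :
            (W × Z) × X => F q.1.2 q.2 q.1.1) (Measurable.stronglyMeasurable ?_)).measurable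
          exact hF.comp ((measurable_fst.snd.prodMk measurable_snd).prodMk measurable_fst.fst)
        · simpa [Function.uncurry] using norm_integral_le_of_norm_le_const (μ := μ)
            (Eventually.of_forall fun x => hF1 q.2 x q.1)
    _ = ∫ w, ∫ x, F w.1 x w.2 ∂μ ∂(ν.prod ρ) := by
        refine (integral_prod (fun w : Z × W =>
          ∫ x, F w.1 x w.2 ∂μ) (integrable_of_norm_le ?_ (μ.real Set.univ) fun q => ?_)).symm
        · refine (StronglyMeasurable.integral_prod_right' (ν := μ) (f := fun q :
            (Z × W) × X => F q.1.1 q.2 q.1.2) (Measurable.stronglyMeasurable ?_)).measurable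
          exact hF.comp ((measurable_fst.fst.prodMk measurable_snd).prodMk measurable_fst.snd)
        · simpa using norm_integral_le_of_norm_le_const (μ := μ)
            (Eventually.of_forall fun x => hF1 q.1 x q.2)

end Regroup

/-- A trilinear form with an oscillating kernel, localized to cubes. -/
noncomputable def oscForm (p t : ℝ) (a b c : (Fin d → ℝ) → (Fin d → ℝ) → ℂ) : ℂ :=
  ∫ w, c w.1 w.2 * ∫ y, a w.2 y * b w.1 y * osc p t (w.1 - w.2 - y) ∂(cubeMeasure d 1)
    ∂((cubeMeasure d 4).prod (cubeMeasure d 1))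

lemma cubeMeasure_prod_real_univ {r r' : ℝ} (hr : 0 ≤ r) (hr' : 0 ≤ r') :
    ((cubeMeasure d r).prod (cubeMeasure d r')).real Set.univ = r ^ d * r' ^ d := by
  rw [← Set.univ_prod_univ, measureReal_prod_prod, cubeMeasure_real_univ hr,
    cubeMeasure_real_univ hr']

variable {a b c : (Fin d → ℝ) → (Fin d → ℝ) → ℂ}

lemma sq_norm_oscForm_le (ha : Measurable (Function.uncurry a)) (ha1 : ∀ x y, ‖a x y‖ ≤ 1)
    (hb : Measurable (Function.uncurry b)) (hb1 : ∀ x y, ‖b x y‖ ≤ 1)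
    (hc1 : ∀ x y, ‖c x y‖ ≤ 1) :
    ‖oscForm p t a b c‖ ^ 2
      ≤ 4 ^ d * ‖∫ w, (b w.1 w.2.1 * (starRingEnd ℂ) (b w.1 w.2.2)) *
          ∫ x, (a x w.2.1 * (starRingEnd ℂ) (a x w.2.2)) *
            (osc p t (w.1 - x - w.2.1) * (starRingEnd ℂ) (osc p t (w.1 - x - w.2.2)))
              ∂(cubeMeasure d 1)
          ∂((cubeMeasure d 4).prod ((cubeMeasure d 1).prod (cubeMeasure d 1)))‖ := by
  set κ := cubeMeasure d 1
  set κ' := cubeMeasure d 4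
  let k : (Fin d → ℝ) × (Fin d → ℝ) → (Fin d → ℝ) → ℂ := fun w y =>
    a w.2 y * b w.1 y * osc p t (w.1 - w.2 - y)
  have hkm : Measurable (Function.uncurry k) := by
    have m1 : Measurable fun q : ((Fin d → ℝ) × (Fin d → ℝ)) × (Fin d → ℝ) => a q.1.2 q.2 :=
      ha.comp (measurable_fst.snd.prodMk measurable_snd)
    have m2 : Measurable fun q : ((Fin d → ℝ) × (Fin d → ℝ)) × (Fin d → ℝ) => b q.1.1 q.2 :=
      hb.comp (measurable_fst.fst.prodMk measurable_snd)
    have m3 : Measurable fun q : ((Fin d → ℝ) × (Fin d → ℝ)) × (Fin d → ℝ) =>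
        osc p t (q.1.1 - q.1.2 - q.2) := (measurable_osc p t).comp (by fun_prop)
    exact (m1.mul m2).mul m3
  have hk1 : ∀ w y, ‖k w y‖ ≤ 1 := fun w y =>
    norm_mul_le_one (norm_mul_le_one (ha1 _ _) (hb1 _ _)) (norm_osc_le p t _)
  have key := sq_norm_integral_mul_integral_le (μ := κ'.prod κ) (ν := κ)
    (u := fun w => c w.1 w.2) (k := k) (fun w => hc1 _ _) hkm hk1
  rw [cubeMeasure_prod_real_univ (by norm_num) (by norm_num), one_pow, mul_one] at key
  refine key.trans (le_of_eq ?_)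
  congr 2
  let F : (Fin d → ℝ) → (Fin d → ℝ) → (Fin d → ℝ) × (Fin d → ℝ) → ℂ := fun z x v =>
    k (z, x) v.1 * (starRingEnd ℂ) (k (z, x) v.2)
  have hF1 : ∀ z x v, ‖F z x v‖ ≤ 1 := fun z x v =>
    norm_mul_le_one (hk1 _ _) (norm_conj_le_one (hk1 _ _))
  have hFm : Measurable fun q : ((Fin d → ℝ) × (Fin d → ℝ)) × ((Fin d → ℝ) × (Fin d → ℝ)) =>
      F q.1.1 q.1.2 q.2 := by
    have m1 : Measurable fun q : ((Fin d → ℝ) × (Fin d → ℝ)) × ((Fin d → ℝ) × (Fin d → ℝ)) =>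
      k q.1 q.2.1 := hkm.comp (measurable_fst.prodMk measurable_snd.fst)
    have m2 : Measurable fun q : ((Fin d → ℝ) × (Fin d → ℝ)) × ((Fin d → ℝ) × (Fin d → ℝ)) =>
      k q.1 q.2.2 := hkm.comp (measurable_fst.prodMk measurable_snd.snd)
    exact m1.mul (Complex.continuous_conj.measurable.comp m2)
  calc ∫ v, ∫ w, F w.1 w.2 v ∂(κ'.prod κ) ∂(κ.prod κ)
      = ∫ w, ∫ x, F w.1 x w.2 ∂κ ∂(κ'.prod (κ.prod κ)) := integral_prod_regroup hFm hF1
    _ = _ := by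
        refine integral_congr_ae (Eventually.of_forall fun w => ?_)
        simp only
        rw [← integral_const_mul]
        refine integral_congr_ae (Eventually.of_forall fun x => ?_)
        simp only [F, k, map_mul]
        ring

/-- The bound for `oscForm` obtained from two applications of the Cauchy–Schwarz inequality. -/
lemma pow_four_norm_oscForm_le (ha : Measurable (Function.uncurry a)) (ha1 : ∀ x y, ‖a x y‖ ≤ 1)
    (hb : Measurable (Function.uncurry b)) (hb1 : ∀ x y, ‖b x y‖ ≤ 1)
    (hc1 : ∀ x y, ‖c x y‖ ≤ 1) :
    ENNReal.ofReal (‖oscForm p t a b c‖ ^ 4)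
      ≤ ENNReal.ofReal (4 ^ (3 * d)) * ∫⁻ w, ∫⁻ v,
          ‖∫ z, mixedOscProd p t w.1 w.2 v.1 v.2 z ∂(cubeMeasure d 4)‖ₑ
          ∂((cubeMeasure d 1).prod (cubeMeasure d 1))
          ∂((cubeMeasure d 1).prod (cubeMeasure d 1)) := by
  set κ := cubeMeasure d 1
  set κ' := cubeMeasure d 4
  have h1 := sq_norm_oscForm_le (p := p) (t := t) ha ha1 hb hb1 hc1
  let k : (Fin d → ℝ) × ((Fin d → ℝ) × (Fin d → ℝ)) → (Fin d → ℝ) → ℂ := fun w x =>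
    (a x w.2.1 * (starRingEnd ℂ) (a x w.2.2)) *
      (osc p t (w.1 - x - w.2.1) * (starRingEnd ℂ) (osc p t (w.1 - x - w.2.2)))
  have hkm : Measurable (Function.uncurry k) := by
    have m1 : Measurable fun q : ((Fin d → ℝ) × ((Fin d → ℝ) × (Fin d → ℝ))) × (Fin d → ℝ) =>
      a q.2 q.1.2.1 := ha.comp (measurable_snd.prodMk measurable_fst.snd.fst)
    have m2 : Measurable fun q : ((Fin d → ℝ) × ((Fin d → ℝ) × (Fin d → ℝ))) × (Fin d → ℝ) =>
      a q.2 q.1.2.2 := ha.comp (measurable_snd.prodMk measurable_fst.snd.snd)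
    have m3 : Measurable fun q : ((Fin d → ℝ) × ((Fin d → ℝ) × (Fin d → ℝ))) × (Fin d → ℝ) =>
        osc p t (q.1.1 - q.2 - q.1.2.1) := (measurable_osc p t).comp (by fun_prop)
    have m4 : Measurable fun q : ((Fin d → ℝ) × ((Fin d → ℝ) × (Fin d → ℝ))) × (Fin d → ℝ) =>
        osc p t (q.1.1 - q.2 - q.1.2.2) := (measurable_osc p t).comp (by fun_prop)
    exact (m1.mul (Complex.continuous_conj.measurable.comp m2)).mul
      (m3.mul (Complex.continuous_conj.measurable.comp m4))
  have hk1 : ∀ w y, ‖k w y‖ ≤ 1 := fun w y =>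
    norm_mul_le_one (norm_mul_le_one (ha1 _ _) (norm_conj_le_one (ha1 _ _)))
      (norm_mul_le_one (norm_osc_le p t _) (norm_conj_le_one (norm_osc_le p t _)))
  have key := sq_norm_integral_mul_integral_le (μ := κ'.prod (κ.prod κ)) (ν := κ)
    (u := fun w => b w.1 w.2.1 * (starRingEnd ℂ) (b w.1 w.2.2)) (k := k)
    (fun w => norm_mul_le_one (hb1 _ _) (norm_conj_le_one (hb1 _ _))) hkm hk1
  have hmass : (κ'.prod (κ.prod κ)).real Set.univ = 4 ^ d := by
    rw [← Set.univ_prod_univ, measureReal_prod_prod, cubeMeasure_real_univ (by norm_num),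
      cubeMeasure_prod_real_univ (by norm_num) (by norm_num)]
    simp
  rw [hmass] at key
  set T := ∫ w, ∫ q, k q w.1 * (starRingEnd ℂ) (k q w.2) ∂(κ'.prod (κ.prod κ)) ∂(κ.prod κ)
  have h2 : ‖oscForm p t a b c‖ ^ 4 ≤ 4 ^ (3 * d) * ‖T‖ := by
    calc ‖oscForm p t a b c‖ ^ 4 = (‖oscForm p t a b c‖ ^ 2) ^ 2 := by ring
      _ ≤ (4 ^ d * _) ^ 2 := by gcongr
      _ ≤ 4 ^ (2 * d) * (4 ^ d * ‖T‖) := by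
          rw [mul_pow, ← pow_mul, mul_comm d 2]
          gcongr
      _ = _ := by ring
  refine (ENNReal.ofReal_le_ofReal h2).trans ?_
  rw [ENNReal.ofReal_mul (by positivity), ofReal_norm]
  gcongr
  refine (enorm_integral_le_lintegral_enorm _).trans (lintegral_mono fun w => ?_)
  let G : (Fin d → ℝ) × ((Fin d → ℝ) × (Fin d → ℝ)) → ℂ := fun q =>
    k q w.1 * (starRingEnd ℂ) (k q w.2)
  have hGm : Measurable G := by
    have m1 : Measurable fun q => k q w.1 := hkm.comp (measurable_id.prodMk measurable_const)
    have m2 : Measurable fun q => k q w.2 := hkm.comp (measurable_id.prodMk measurable_const)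
    exact m1.mul (Complex.continuous_conj.measurable.comp m2)
  have hGi : Integrable G (κ'.prod (κ.prod κ)) := integrable_of_norm_le hGm 1 fun q =>
    norm_mul_le_one (hk1 _ _) (norm_conj_le_one (hk1 _ _))
  calc ‖∫ q, G q ∂(κ'.prod (κ.prod κ))‖ₑ = ‖∫ v, ∫ z, G (z, v) ∂κ' ∂(κ.prod κ)‖ₑ := by
        rw [integral_prod_symm _ hGi]
    _ ≤ ∫⁻ v, ‖∫ z, G (z, v) ∂κ'‖ₑ ∂(κ.prod κ) := enorm_integral_le_lintegral_enorm _
    _ ≤ _ := by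
        refine lintegral_mono fun v => ?_
        have e : ∀ z, G (z, v) = ((a w.1 v.1 * (starRingEnd ℂ) (a w.1 v.2)) *
            (starRingEnd ℂ) (a w.2 v.1 * (starRingEnd ℂ) (a w.2 v.2))) *
            mixedOscProd p t w.1 w.2 v.1 v.2 z := fun z => by
          simp only [G, k, mixedOscProd, map_mul]
          ring
        simp only [e]
        rw [integral_const_mul, enorm_mul]
        refine mul_le_of_le_one_left zero_le ?_
        rw [← ofReal_norm, ← ENNReal.ofReal_one]
        exact ENNReal.ofReal_le_ofReal (norm_mul_le_one (norm_mul_le_one (ha1 _ _)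
          (norm_conj_le_one (ha1 _ _))) (norm_conj_le_one (norm_mul_le_one (ha1 _ _)
          (norm_conj_le_one (ha1 _ _)))))

lemma exists_pow_four_norm_oscForm_le (d : ℕ) (hp0 : p ≠ 0) (hp1 : p ≠ 1) (hp2 : p ≠ 2) :
    ∃ B : ℝ, 0 ≤ B ∧ ∀ (t : ℝ) (a b c : (Fin d → ℝ) → (Fin d → ℝ) → ℂ), 0 < t →
      Measurable (Function.uncurry a) → (∀ x y, ‖a x y‖ ≤ 1) →
      Measurable (Function.uncurry b) → (∀ x y, ‖b x y‖ ≤ 1) → (∀ x y, ‖c x y‖ ≤ 1) →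
      ‖oscForm p t a b c‖ ^ 4 ≤ B * (√t)⁻¹ ^ d := by
  obtain ⟨C, hC0, hC⟩ := exists_norm_integral_mixedOsc_le_sqrt hp0 hp1 hp2
  have hK := lintegral_invSqrtProd_sub_lt_top (d := d)
  set K := ∫⁻ w, ENNReal.ofReal (invSqrtProd (w.2 - w.1))
    ∂((cubeMeasure d 1).prod (cubeMeasure d 1)) with hKdef
  refine ⟨4 ^ (3 * d) * (C ^ d * K.toReal ^ 2), by positivity,
    fun t a b c ht ha ha1 hb hb1 hc1 => ?_⟩
  have h1 := pow_four_norm_oscForm_le (p := p) (t := t) ha ha1 hb hb1 hc1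
  have h2 : ∫⁻ w, ∫⁻ v, ‖∫ z, mixedOscProd p t w.1 w.2 v.1 v.2 z ∂(cubeMeasure d 4)‖ₑ
          ∂((cubeMeasure d 1).prod (cubeMeasure d 1))
          ∂((cubeMeasure d 1).prod (cubeMeasure d 1))
      ≤ ENNReal.ofReal ((C * (√t)⁻¹) ^ d) * K * K := by
    calc _ ≤ ∫⁻ w, ∫⁻ v, ENNReal.ofReal ((C * (√t)⁻¹) ^ d) *
          ENNReal.ofReal (invSqrtProd (w.2 - w.1)) * ENNReal.ofReal (invSqrtProd (v.2 - v.1))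
            ∂((cubeMeasure d 1).prod (cubeMeasure d 1))
            ∂((cubeMeasure d 1).prod (cubeMeasure d 1)) := by
          refine lintegral_mono_ae ?_
          filter_upwards [ae_cubeMeasure_prod (d := d)] with w hw
          refine lintegral_mono_ae ?_
          filter_upwards [ae_cubeMeasure_prod (d := d)] with v hv
          rw [← ENNReal.ofReal_mul (by positivity), ← ENNReal.ofReal_mul
            (mul_nonneg (by positivity) (invSqrtProd_nonneg _)), ← ofReal_norm]
          exact ENNReal.ofReal_le_ofReal (norm_integral_mixedOscProd_le hC ht hw hv)
      _ = _ := by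
          have hfin : ∀ w : (Fin d → ℝ) × (Fin d → ℝ), ENNReal.ofReal ((C * (√t)⁻¹) ^ d) *
              ENNReal.ofReal (invSqrtProd (w.2 - w.1)) ≠ ∞ := fun w => by finiteness
          simp only [lintegral_const_mul' _ _ (hfin _), ← hKdef]
          rw [lintegral_mul_const' _ _ hK.ne, lintegral_const_mul' _ _ ENNReal.ofReal_ne_top]
  rw [← ENNReal.ofReal_le_ofReal_iff (by positivity)]
  refine (h1.trans (mul_le_mul_right h2 _)).trans (le_of_eq ?_)
  nth_rewrite 1 [← ENNReal.ofReal_toReal hK.ne]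
  nth_rewrite 2 [← ENNReal.ofReal_toReal hK.ne]
  rw [← ENNReal.ofReal_mul (by positivity), ← ENNReal.ofReal_mul (by positivity),
    ← ENNReal.ofReal_mul (by positivity)]
  congr 1
  rw [mul_pow]
  ring

end Corners

namespace Corners

open scoped Topology

/-! ### Oscillatory averages of the corner counting function -/

variable {d : ℕ} {p t N : ℝ} {f : (Fin d → ℝ) × (Fin d → ℝ) → ℝ}

section Rotate

variable {X Y Z : Type*} [MeasurableSpace X] [MeasurableSpace Y] [MeasurableSpace Z]
  {μ : Measure X} {ν : Measure Y} {ρ : Measure Z} [IsFiniteMeasure μ] [IsFiniteMeasure ν]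
  [IsFiniteMeasure ρ]

lemma integral_integral_integral_rotate {H : Z → X → Y → ℂ} (C : ℝ)
    (hH : Measurable fun q : (Z × X) × Y => H q.1.1 q.1.2 q.2) (hC : ∀ z x y, ‖H z x y‖ ≤ C) :
    ∫ z, ∫ x, ∫ y, H z x y ∂ν ∂μ ∂ρ = ∫ x, ∫ y, ∫ z, H z x y ∂ρ ∂ν ∂μ := by
  rw [integral_integral_swap]
  · refine integral_congr_ae (Eventually.of_forall fun x => ?_)
    refine integral_integral_swap (integrable_of_norm_le ?_ C fun q => hC _ _ _)
    exact hH.comp ((measurable_fst.prodMk measurable_const).prodMk measurable_snd)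
  · refine integrable_of_norm_le ?_ (C * ν.real Set.univ) fun q => ?_
    · exact (StronglyMeasurable.integral_prod_right' (ν := ν) hH.stronglyMeasurable).measurable
    · exact norm_integral_le_of_norm_le_const (μ := ν) (Eventually.of_forall fun y => hC q.1 q.2 y)

end Rotate

lemma osc_eq_zero {u : Fin d → ℝ} {i : Fin d} (hi : u i ∉ Set.Icc (1 : ℝ) 2) : osc p t u = 0 :=
  Finset.prod_eq_zero (Finset.mem_univ i) (Set.indicator_of_notMem hi _)

lemma norm_ofReal_le_one (hf : IsBoxWeight N f) (q) : ‖(f q : ℂ)‖ ≤ 1 := by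
  rw [Complex.norm_real]
  exact hf.abs_le_one q

lemma setIntegral_oscForm_eq (hf : IsBoxWeight N f) (hN : 0 ≤ N) {α β : Fin d → ℝ}
    (hs : ∀ q, f q ≠ 0 → q ∈ Set.Icc α (α + fun _ => N) ×ˢ Set.Icc β (β + fun _ => N)) :
    ∫ q in Set.Icc (α - 1) (α - 1 + fun _ => N + 1) ×ˢ Set.Icc (β - 1) (β - 1 + fun _ => N + 1),
      oscForm p t (fun x y => (f (q.1 + x, q.2 + y) : ℂ))
        (fun z y => (f (q.1 + (z - y), q.2 + y) : ℂ))
        (fun z x => (f (q.1 + x, q.2 + (z - x)) : ℂ))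
      = ∫ u, (cornerCount f u : ℂ) * osc p t u := by
  set box := Set.Icc (α - 1) (α - 1 + fun _ => N + 1) ×ˢ
    Set.Icc (β - 1) (β - 1 + fun _ => N + 1) with hbox
  have hfm := hf.measurable
  have hfin : IsFiniteMeasure (volume.restrict box) := by
    refine ⟨?_⟩
    rw [Measure.restrict_apply_univ, hbox, volume_box _ _ (by linarith)]
    exact ENNReal.ofReal_lt_top
  let h : (Fin d → ℝ) → ℂ := fun u => (cornerCount f u : ℂ) * osc p t u
  have hhm : Measurable h :=
    (Complex.measurable_ofReal.comp (hf.continuous_cornerCount hN).measurable).mul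
      (measurable_osc p t)
  have hh1 : ∀ u, ‖h u‖ ≤ N ^ (2 * d) := fun u => by
    rw [norm_mul, Complex.norm_real, Real.norm_eq_abs, abs_of_nonneg (hf.cornerCount_nonneg u)]
    exact (mul_le_of_le_one_right (hf.cornerCount_nonneg u) (norm_osc_le p t u)).trans
      (hf.cornerCount_le hN u)
  have hinner : ∀ x ∈ Set.Icc (0 : Fin d → ℝ) (fun _ => 1),
      ∀ y ∈ Set.Icc (0 : Fin d → ℝ) (fun _ => 1), ∀ z : Fin d → ℝ,
      ∫ q in box, (f (q.1 + x, q.2 + (z - x)) : ℂ) * ((f (q.1 + x, q.2 + y) : ℂ)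
        * (f (q.1 + (z - y), q.2 + y) : ℂ) * osc p t (z - x - y)) = h (z - x - y) := by
    intro x hx y hy z
    have e : ∀ q : (Fin d → ℝ) × (Fin d → ℝ),
        (f (q.1 + x, q.2 + (z - x)) : ℂ) * ((f (q.1 + x, q.2 + y) : ℂ)
          * (f (q.1 + (z - y), q.2 + y) : ℂ) * osc p t (z - x - y))
        = ((f (q + (x, y)) * f ((q + (x, y)).1 + (z - x - y), (q + (x, y)).2)
          * f ((q + (x, y)).1, (q + (x, y)).2 + (z - x - y)) : ℝ) : ℂ) * osc p t (z - x - y) := by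
      intro q
      have e1 : q.2 + (z - x) = q.2 + y + (z - x - y) := by abel
      have e2 : q.1 + (z - y) = q.1 + x + (z - x - y) := by abel
      simp only [Prod.fst_add, Prod.snd_add, e1, e2, Complex.ofReal_mul, ← Prod.mk_add_mk]
      have e3 : q + (x, y) = (q.1 + x, q.2 + y) := rfl
      rw [e3]
      ring
    simp only [e]
    rw [setIntegral_eq_integral_of_forall_compl_eq_zero, integral_mul_const,
      integral_complex_ofReal]
    · congr 2
      exact integral_add_right_eq_self (μ := volume) (fun q : (Fin d → ℝ) × (Fin d → ℝ) =>
        f q * f (q.1 + (z - x - y), q.2) * f (q.1, q.2 + (z - x - y))) (x, y)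
    · intro q hq
      have h0 : f (q + (x, y)) = 0 := by
        by_contra h0
        obtain ⟨h1, h2⟩ := hs _ h0
        refine hq ⟨⟨fun i => ?_, fun i => ?_⟩, ⟨fun i => ?_, fun i => ?_⟩⟩
        all_goals
          have a1 := h1.1 i
          have a2 := h1.2 i
          have a3 := h2.1 i
          have a4 := h2.2 i
          have b1 := hx.1 i
          have b2 := hx.2 i
          have b3 := hy.1 i
          have b4 := hy.2 i
          simp only [Prod.fst_add, Prod.snd_add, Pi.add_apply, Pi.sub_apply, Pi.one_apply,
            Pi.zero_apply] at a1 a2 a3 a4 b1 b2 b3 b4 ⊢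
          linarith
      simp [h0]
  have hshift : ∀ x ∈ Set.Icc (0 : Fin d → ℝ) (fun _ => 1),
      ∀ y ∈ Set.Icc (0 : Fin d → ℝ) (fun _ => 1),
      ∫ z, h (z - x - y) ∂(cubeMeasure d 4) = ∫ u, h u := by
    intro x hx y hy
    rw [cubeMeasure, setIntegral_eq_integral_of_forall_compl_eq_zero]
    · simp only [sub_sub]
      exact integral_sub_right_eq_self h (x + y)
    · intro z hz
      have : ∃ i, (z - x - y) i ∉ Set.Icc (1 : ℝ) 2 := by
        by_contra! hcon
        refine hz ⟨fun i => ?_, fun i => ?_⟩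
        all_goals
          have a1 := (hcon i).1
          have a2 := (hcon i).2
          have b1 := hx.1 i
          have b2 := hx.2 i
          have b3 := hy.1 i
          have b4 := hy.2 i
          simp only [Pi.sub_apply, Pi.zero_apply] at a1 a2 b1 b2 b3 b4 ⊢
          linarith
      obtain ⟨i, hi⟩ := this
      simp only [h, osc_eq_zero hi, mul_zero]
  set κ := cubeMeasure d 1 with hκ
  set κ' := cubeMeasure d 4
  have hκ1 : κ.real Set.univ = 1 := by rw [cubeMeasure_real_univ zero_le_one, one_pow]
  simp only [oscForm, ← integral_const_mul]
  rw [integral_integral_integral_rotate 1]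
  · calc _ = ∫ w, ∫ y, h (w.1 - w.2 - y) ∂κ ∂(κ'.prod κ) := by
          refine integral_congr_ae ?_
          have hw : ∀ᵐ w ∂(κ'.prod κ), w.2 ∈ Set.Icc (0 : Fin d → ℝ) (fun _ => 1) :=
            Measure.quasiMeasurePreserving_snd.ae (ae_cubeMeasure_mem 1)
          filter_upwards [hw] with w hw
          refine integral_congr_ae ?_
          filter_upwards [ae_cubeMeasure_mem (d := d) 1] with y hy
          exact hinner _ hw _ hy _
      _ = ∫ x, ∫ z, ∫ y, h (z - x - y) ∂κ ∂κ' ∂κ := by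
          refine integral_prod_symm _ (integrable_of_norm_le ?_ (N ^ (2 * d) * κ.real Set.univ)
            fun w => norm_integral_le_of_norm_le_const (Eventually.of_forall fun y => hh1 _))
          exact (StronglyMeasurable.integral_prod_right' (ν := κ)
            (f := fun q : ((Fin d → ℝ) × (Fin d → ℝ)) × (Fin d → ℝ) => h (q.1.1 - q.1.2 - q.2))
            (hhm.comp (by fun_prop)).stronglyMeasurable).measurable
      _ = ∫ x, ∫ y, ∫ z, h (z - x - y) ∂κ' ∂κ ∂κ := by
          refine integral_congr_ae (Eventually.of_forall fun x => ?_)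
          exact integral_integral_swap (integrable_of_norm_le
            (hhm.comp (by fun_prop)) (N ^ (2 * d)) fun q => hh1 _)
      _ = ∫ _x, ∫ _y, (∫ u, h u) ∂κ ∂κ := by
          refine integral_congr_ae ?_
          filter_upwards [ae_cubeMeasure_mem (d := d) 1] with x hx
          refine integral_congr_ae ?_
          filter_upwards [ae_cubeMeasure_mem (d := d) 1] with y hy
          exact hshift x hx y hy
      _ = _ := by simp only [integral_const, hκ1, one_smul, h]
  · have m : Measurable fun q : (((Fin d → ℝ) × (Fin d → ℝ)) × (Fin d → ℝ) × (Fin d → ℝ)) ×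
        (Fin d → ℝ) => osc p t (q.1.2.1 - q.1.2.2 - q.2) := (measurable_osc p t).comp (by fun_prop)
    fun_prop
  · intro q w y
    exact norm_mul_le_one (norm_ofReal_le_one hf _) (norm_mul_le_one (norm_mul_le_one
      (norm_ofReal_le_one hf _) (norm_ofReal_le_one hf _)) (norm_osc_le p t _))

lemma exists_norm_integral_cornerCount_osc_le (hd : 24 ≤ d) (hp0 : p ≠ 0) (hp1 : p ≠ 1)
    (hp2 : p ≠ 2) :
    ∃ B : ℝ, 0 ≤ B ∧ ∀ (t N : ℝ) (f : (Fin d → ℝ) × (Fin d → ℝ) → ℝ), 1 ≤ t → 1 ≤ N →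
      IsBoxWeight N f →
      ‖∫ u, (cornerCount f u : ℂ) * osc p t u‖ ≤ B * N ^ (2 * d) * (t ^ 3)⁻¹ := by
  obtain ⟨B, hB, h⟩ := exists_pow_four_norm_oscForm_le d hp0 hp1 hp2
  refine ⟨max 1 B * 2 ^ (2 * d), by positivity, fun t N f ht hN hf => ?_⟩
  obtain ⟨α, β, hs⟩ := hf.support
  have hfm := hf.measurable
  rw [← setIntegral_oscForm_eq hf (by linarith) hs]
  have hbound : ∀ q : (Fin d → ℝ) × (Fin d → ℝ),
      ‖oscForm p t (fun x y => (f (q.1 + x, q.2 + y) : ℂ))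
        (fun z y => (f (q.1 + (z - y), q.2 + y) : ℂ))
        (fun z x => (f (q.1 + x, q.2 + (z - x)) : ℂ))‖ ≤ max 1 B * (t ^ 3)⁻¹ := by
    intro q
    have h4 := h t (fun x y => (f (q.1 + x, q.2 + y) : ℂ))
        (fun z y => (f (q.1 + (z - y), q.2 + y) : ℂ))
        (fun z x => (f (q.1 + x, q.2 + (z - x)) : ℂ)) (by linarith) (by fun_prop)
        (fun x y => norm_ofReal_le_one hf _) (by fun_prop) (fun x y => norm_ofReal_le_one hf _)
        (fun x y => norm_ofReal_le_one hf _)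
    refine le_of_pow_le_pow_left₀ (n := 4) (by norm_num) (by positivity) (h4.trans ?_)
    have hsq : 1 ≤ √t := Real.one_le_sqrt.2 ht
    have e1 : (√t)⁻¹ ^ d ≤ (√t)⁻¹ ^ 24 :=
      pow_le_pow_of_le_one (by positivity) (inv_le_one_of_one_le₀ hsq) hd
    have e2 : (√t)⁻¹ ^ 24 = (t ^ 3)⁻¹ ^ 4 := by
      rw [inv_pow, inv_pow, ← pow_mul]
      congr 1
      calc √t ^ 24 = (√t ^ 2) ^ 12 := by ring
        _ = t ^ 12 := by rw [Real.sq_sqrt (by linarith)]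
    have e3 : B ≤ max 1 B ^ 4 :=
      (le_max_right 1 B).trans (le_self_pow₀ (le_max_left 1 B) (by norm_num))
    rw [mul_pow]
    exact mul_le_mul e3 (e1.trans e2.le) (by positivity) (by positivity)
  have hvol := volume_box (α - 1) (β - 1) (N := N + 1) (by linarith)
  refine (norm_setIntegral_le_of_norm_le_const (by rw [hvol]; exact ENNReal.ofReal_lt_top)
    fun q _ => hbound q).trans ?_
  rw [measureReal_def, hvol, ENNReal.toReal_ofReal (by positivity)]
  calc max 1 B * (t ^ 3)⁻¹ * (N + 1) ^ (2 * d)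
      ≤ max 1 B * (t ^ 3)⁻¹ * (2 * N) ^ (2 * d) := by gcongr; linarith
    _ = _ := by rw [mul_pow]; ring

end Corners

namespace Corners

open scoped Topology

/-! ### Comparison of shell kernels of different widths -/

variable {d : ℕ} {p t N lam : ℝ} {f : (Fin d → ℝ) × (Fin d → ℝ) → ℝ}

lemma cornerCount_smul (f : (Fin d → ℝ) × (Fin d → ℝ) → ℝ) (hlam : 0 < lam) (u : Fin d → ℝ) :
    cornerCount f (lam • u) = lam ^ (2 * d) * cornerCount (fun q => f (lam • q)) u := by
  have h := Measure.integral_comp_smul (volume : Measure ((Fin d → ℝ) × (Fin d → ℝ)))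
    (fun q => f q * f (q.1 + lam • u, q.2) * f (q.1, q.2 + lam • u)) lam
  have hr : Module.finrank ℝ ((Fin d → ℝ) × (Fin d → ℝ)) = 2 * d := by
    simp [two_mul]
  rw [hr, abs_of_pos (by positivity), smul_eq_mul] at h
  simp only [cornerCount]
  rw [eq_comm, ← eq_inv_mul_iff_mul_eq₀ (by positivity), ← h]
  simp only [Prod.smul_fst, Prod.smul_snd, Prod.smul_mk, smul_add]

lemma IsBoxWeight.comp_smul (hf : IsBoxWeight N f) (hlam : 0 < lam) :
    IsBoxWeight (N / lam) (fun q => f (lam • q)) where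
  measurable := hf.measurable.comp (measurable_const_smul lam)
  nonneg q := hf.nonneg _
  le_one q := hf.le_one _
  support := by
    obtain ⟨a, b, h⟩ := hf.support
    refine ⟨lam⁻¹ • a, lam⁻¹ • b, fun q hq => ?_⟩
    obtain ⟨h1, h2⟩ := h _ hq
    have key : ∀ (a x : Fin d → ℝ), lam • x ∈ Set.Icc a (a + fun _ => N) →
        x ∈ Set.Icc (lam⁻¹ • a) (lam⁻¹ • a + fun _ => N / lam) := by
      intro a x hx
      refine ⟨fun i => ?_, fun i => ?_⟩
      · have := hx.1 i
        simp only [Pi.smul_apply, smul_eq_mul] at this ⊢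
        rwa [inv_mul_le_iff₀ hlam]
      · have := hx.2 i
        simp only [Pi.smul_apply, Pi.add_apply, smul_eq_mul] at this ⊢
        rw [div_eq_inv_mul, ← mul_add, le_inv_mul_iff₀ hlam]
        exact this
    exact ⟨key _ _ h1, key _ _ h2⟩

/-- The sum of the `p`-th powers of the coordinates. -/
noncomputable def powSum (p : ℝ) (u : Fin d → ℝ) : ℝ := ∑ i, u i ^ p

lemma measurable_powSum (p : ℝ) : Measurable (powSum (d := d) p) := by
  unfold powSum
  fun_prop

/-- The indicator function of the cube `[1, 2] ^ d`. -/
noncomputable def cubeInd (u : Fin d → ℝ) : ℝ :=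
  (Set.Icc (fun _ => 1) (fun _ => 2) : Set (Fin d → ℝ)).indicator 1 u

lemma measurable_cubeInd : Measurable (cubeInd (d := d)) :=
  measurable_one.indicator measurableSet_Icc

lemma cubeInd_nonneg (u : Fin d → ℝ) : 0 ≤ cubeInd u :=
  Set.indicator_nonneg (fun _ _ => zero_le_one) u

lemma cubeInd_le_one (u : Fin d → ℝ) : cubeInd u ≤ 1 :=
  Set.indicator_le_self' (fun _ _ => zero_le_one) u

lemma cubeInd_of_notMem {u : Fin d → ℝ} (hu : u ∉ Set.Icc (fun _ => 1) (fun _ => 2)) :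
    cubeInd u = 0 :=
  Set.indicator_of_notMem hu _

lemma norm_le_of_cubeInd_ne_zero {u : Fin d → ℝ} (hu : cubeInd u ≠ 0) : ‖u‖ ≤ 2 := by
  have hu' := Set.mem_of_indicator_ne_zero hu
  rw [pi_norm_le_iff_of_nonneg (by norm_num)]
  intro i
  have h1 := hu'.1 i
  have h2 := hu'.2 i
  simp only at h1 h2
  rw [Real.norm_eq_abs, abs_of_nonneg (by linarith)]
  exact h2

lemma integral_cubeInd : ∫ u : Fin d → ℝ, cubeInd u = 1 := by
  simp only [cubeInd]
  rw [integral_indicator_one measurableSet_Icc, measureReal_def, Real.volume_Icc_pi]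
  norm_num

lemma integrable_cubeInd : Integrable (cubeInd (d := d)) :=
  integrable_of_bounded_support measurable_cubeInd.aestronglyMeasurable 1 2
    (fun u => by rw [Real.norm_eq_abs, abs_of_nonneg (cubeInd_nonneg u)]; exact cubeInd_le_one u)
    (fun _ => norm_le_of_cubeInd_ne_zero)

lemma osc_eq (p t : ℝ) (u : Fin d → ℝ) :
    osc p t u = (cubeInd u : ℂ) * Complex.exp ((t * powSum p u : ℝ) * Complex.I) := by
  by_cases hu : u ∈ Set.Icc (fun _ => 1 : Fin d → ℝ) (fun _ => 2)
  · rw [cubeInd, Set.indicator_of_mem hu, osc]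
    have : ∀ i, oscOne p t (u i) = Complex.exp ((t * u i ^ p : ℝ) * Complex.I) := fun i =>
      Set.indicator_of_mem (Set.mem_Icc.2 ⟨hu.1 i, hu.2 i⟩) _
    simp only [this]
    rw [← Complex.exp_sum, powSum, Finset.mul_sum, Pi.one_apply, Complex.ofReal_one, one_mul,
      Complex.ofReal_sum, Finset.sum_mul]
  · rw [cubeInd_of_notMem hu, Complex.ofReal_zero, zero_mul]
    have : ∃ i, u i ∉ Set.Icc (1 : ℝ) 2 := by
      by_contra! hcon
      exact hu ⟨fun i => (hcon i).1, fun i => (hcon i).2⟩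
    obtain ⟨i, hi⟩ := this
    exact osc_eq_zero hi

lemma norm_osc_le_cubeInd (p t : ℝ) (u : Fin d → ℝ) : ‖osc p t u‖ ≤ cubeInd u := by
  rw [osc_eq, norm_mul, Complex.norm_exp_ofReal_mul_I, mul_one, Complex.norm_real,
    Real.norm_eq_abs, abs_of_nonneg (cubeInd_nonneg u)]

lemma exists_norm_integral_cornerCount_smul_osc_le (hd : 24 ≤ d) (hp0 : p ≠ 0) (hp1 : p ≠ 1)
    (hp2 : p ≠ 2) :
    ∃ B : ℝ, 0 ≤ B ∧ ∀ (t N lam : ℝ) (f : (Fin d → ℝ) × (Fin d → ℝ) → ℝ), 0 < t → 0 < lam →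
      lam ≤ N → IsBoxWeight N f →
      t * ‖∫ u, (cornerCount f (lam • u) : ℂ) * osc p t u‖ ≤ B * N ^ (2 * d) * (1 + t ^ 2)⁻¹ := by
  obtain ⟨B, hB, h⟩ := exists_norm_integral_cornerCount_osc_le hd hp0 hp1 hp2
  refine ⟨2 * max 1 B, by positivity, fun t N lam f ht hlam hN hf => ?_⟩
  have hN0 : 0 ≤ N := by linarith
  rcases le_total t 1 with h1 | h1
  · have htriv : ‖∫ u, (cornerCount f (lam • u) : ℂ) * osc p t u‖ ≤ N ^ (2 * d) := by
      calc ‖∫ u, (cornerCount f (lam • u) : ℂ) * osc p t u‖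
          ≤ ∫ u : Fin d → ℝ, N ^ (2 * d) * cubeInd u := by
            refine norm_integral_le_of_norm_le (integrable_cubeInd.const_mul _)
              (Eventually.of_forall fun u => ?_)
            rw [norm_mul, Complex.norm_real, Real.norm_eq_abs,
              abs_of_nonneg (hf.cornerCount_nonneg _)]
            exact mul_le_mul (hf.cornerCount_le hN0 _) (norm_osc_le_cubeInd p t u)
              (norm_nonneg _) (by positivity)
        _ = N ^ (2 * d) := by rw [integral_const_mul, integral_cubeInd, mul_one]
    have h2 : (1 : ℝ) ≤ 2 * (1 + t ^ 2)⁻¹ := by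
      rw [← div_eq_mul_inv, one_le_div (by positivity)]
      nlinarith
    calc t * ‖∫ u, (cornerCount f (lam • u) : ℂ) * osc p t u‖ ≤ 1 * N ^ (2 * d) := by gcongr
      _ ≤ (2 * (1 + t ^ 2)⁻¹) * (max 1 B * N ^ (2 * d)) := by
          gcongr
          exact le_mul_of_one_le_left (by positivity) (le_max_left 1 B)
      _ = _ := by ring
  · have h2 := h t (N / lam) _ h1 ((one_le_div hlam).2 hN) (hf.comp_smul hlam)
    have h3 : ∫ u, (cornerCount f (lam • u) : ℂ) * osc p t u
        = (lam ^ (2 * d) : ℝ) * ∫ u, (cornerCount (fun q => f (lam • q)) u : ℂ) * osc p t u := by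
      rw [← integral_const_mul]
      refine integral_congr_ae (Eventually.of_forall fun u => ?_)
      simp only [cornerCount_smul f hlam, Complex.ofReal_mul]
      ring
    rw [h3, norm_mul, Complex.norm_real, Real.norm_eq_abs, abs_of_pos (by positivity)]
    have h4 : t * (t ^ 3)⁻¹ ≤ 2 * (1 + t ^ 2)⁻¹ := by
      have e : t * (t ^ 3)⁻¹ = (t ^ 2)⁻¹ := by field_simp
      rw [e, inv_eq_one_div, ← div_eq_mul_inv, div_le_div_iff₀ (by positivity) (by positivity)]
      nlinarith
    calc _ ≤ t * (lam ^ (2 * d) * (B * (N / lam) ^ (2 * d) * (t ^ 3)⁻¹)) := by gcongr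
      _ = B * N ^ (2 * d) * (t * (t ^ 3)⁻¹) := by
          rw [div_pow]
          field_simp
      _ ≤ max 1 B * N ^ (2 * d) * (2 * (1 + t ^ 2)⁻¹) := by
          gcongr
          exact le_max_right 1 B
      _ = _ := by ring

/-- A Poisson kernel in the variable `powSum p u - c`, cut off to the cube `[1, 2] ^ d`. -/
noncomputable def shellKernel (p c η : ℝ) (u : Fin d → ℝ) : ℝ :=
  cubeInd u * (η / (η ^ 2 + (powSum p u - c) ^ 2))

lemma integral_exp_Ioi_re {η : ℝ} (hη : 0 < η) (v : ℝ) :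
    ∫ t in Set.Ioi (0 : ℝ), Complex.exp ((-η + v * Complex.I) * t)
      = (η + v * Complex.I) / ((η ^ 2 + v ^ 2 : ℝ) : ℂ) := by
  have hre : (-η + v * Complex.I : ℂ).re < 0 := by simp [hη]
  rw [integral_exp_mul_complex_Ioi hre]
  have h0 : (-η + v * Complex.I : ℂ) ≠ 0 := fun h => by simp [h] at hre
  have h1 : ((η ^ 2 + v ^ 2 : ℝ) : ℂ) ≠ 0 := by
    rw [Complex.ofReal_ne_zero]
    positivity
  rw [div_eq_div_iff h0 h1]
  simp only [Complex.ofReal_zero, mul_zero, Complex.exp_zero]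
  push_cast
  linear_combination (-v ^ 2 : ℂ) * Complex.I_sq

lemma integral_mul_shellKernel_eq {m : (Fin d → ℝ) → ℝ} (hm : Measurable m) {M : ℝ}
    (hM : ∀ u, |m u| ≤ M) (c : ℝ) {η : ℝ} (hη : 0 < η) :
    ∫ u, m u * shellKernel p c η u
      = (∫ t in Set.Ioi (0 : ℝ), Complex.exp ((-η - c * Complex.I) * t) *
          ∫ u, (m u : ℂ) * osc p t u).re ∧
    Integrable (fun t : ℝ => Complex.exp ((-η - c * Complex.I) * t) *
          ∫ u, (m u : ℂ) * osc p t u) (volume.restrict (Set.Ioi (0 : ℝ))) := by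
  let F : (Fin d → ℝ) → ℝ → ℂ := fun u t =>
    (m u : ℂ) * (cubeInd u : ℂ) * Complex.exp ((-η + (powSum p u - c : ℝ) * Complex.I) * t)
  have hpm := measurable_powSum (d := d) p
  have hcm := measurable_cubeInd (d := d)
  have hFm : Measurable (Function.uncurry F) := by
    unfold F Function.uncurry
    fun_prop
  have hexp : Integrable (fun t : ℝ => Real.exp (-η * t)) (volume.restrict (Set.Ioi (0 : ℝ))) :=
    exp_neg_integrableOn_Ioi 0 hη
  have hFi : Integrable (Function.uncurry F)
      ((volume : Measure (Fin d → ℝ)).prod (volume.restrict (Set.Ioi (0 : ℝ)))) := by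
    refine ((integrable_cubeInd.const_mul M).mul_prod hexp).mono' hFm.aestronglyMeasurable
      (Eventually.of_forall fun q => ?_)
    simp only [Function.uncurry, F]
    rw [norm_mul, norm_mul, Complex.norm_real, Complex.norm_real, Real.norm_eq_abs,
      Real.norm_eq_abs, abs_of_nonneg (cubeInd_nonneg _), Complex.norm_exp]
    have : ((-η + (powSum p q.1 - c : ℝ) * Complex.I) * q.2 : ℂ).re = -η * q.2 := by simp
    rw [this]
    have := cubeInd_nonneg q.1
    gcongr
    exact hM _
  have e1 : ∀ u, ∫ t in Set.Ioi (0 : ℝ), F u t = (m u : ℂ) * (cubeInd u : ℂ) *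
      ((η + (powSum p u - c : ℝ) * Complex.I) / ((η ^ 2 + (powSum p u - c) ^ 2 : ℝ) : ℂ)) := by
    intro u
    simp only [F]
    rw [integral_const_mul, integral_exp_Ioi_re hη]
  have e2 : ∀ t : ℝ, ∫ u, F u t = Complex.exp ((-η - c * Complex.I) * t) *
      ∫ u, (m u : ℂ) * osc p t u := by
    intro t
    rw [← integral_const_mul]
    refine integral_congr_ae (Eventually.of_forall fun u => ?_)
    simp only [F, osc_eq]
    have : ((-η + (powSum p u - c : ℝ) * Complex.I) * t : ℂ)
        = (-η - c * Complex.I) * t + (t * powSum p u : ℝ) * Complex.I := by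
      push_cast
      ring
    rw [this, Complex.exp_add]
    ring
  constructor
  · rw [← integral_congr_ae (Eventually.of_forall e2), ← integral_integral_swap hFi]
    have h3 := integral_re (𝕜 := ℂ) hFi.integral_prod_left
    simp only [RCLike.re_to_complex, Function.uncurry] at h3
    rw [← h3]
    refine integral_congr_ae (Eventually.of_forall fun u => ?_)
    simp only [e1]
    rw [← Complex.ofReal_mul, Complex.re_ofReal_mul, Complex.div_ofReal_re, shellKernel]
    simp [mul_assoc]
  · refine hFi.integral_prod_right.congr (Eventually.of_forall fun t => ?_)
    exact e2 t

lemma exists_abs_integral_shellKernel_sub_le (hd : 24 ≤ d) (hp0 : p ≠ 0) (hp1 : p ≠ 1)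
    (hp2 : p ≠ 2) :
    ∃ C : ℝ, 0 ≤ C ∧ ∀ (N lam c η ε : ℝ) (f : (Fin d → ℝ) × (Fin d → ℝ) → ℝ), 0 < lam →
      lam ≤ N → IsBoxWeight N f → 0 < η → η ≤ ε →
      |(∫ u, cornerCount f (lam • u) * shellKernel p c η u)
        - ∫ u, cornerCount f (lam • u) * shellKernel p c ε u| ≤ C * ε * N ^ (2 * d) := by
  obtain ⟨B, hB, h⟩ := exists_norm_integral_cornerCount_smul_osc_le hd hp0 hp1 hp2
  refine ⟨B * ∫ t in Set.Ioi (0 : ℝ), (1 + t ^ 2)⁻¹,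
    mul_nonneg hB (integral_nonneg fun t => by positivity),
    fun N lam c η ε f hlam hN hf hη hηε => ?_⟩
  have hN0 : 0 ≤ N := by linarith
  have hm : Measurable fun u : Fin d → ℝ => cornerCount f (lam • u) :=
    ((hf.continuous_cornerCount hN0).comp (continuous_const_smul lam)).measurable
  have hM : ∀ u : Fin d → ℝ, |cornerCount f (lam • u)| ≤ N ^ (2 * d) := fun u => by
    rw [abs_of_nonneg (hf.cornerCount_nonneg _)]
    exact hf.cornerCount_le hN0 _
  obtain ⟨e1, i1⟩ := integral_mul_shellKernel_eq (p := p) hm hM c hη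
  obtain ⟨e2, i2⟩ := integral_mul_shellKernel_eq (p := p) hm hM c (hη.trans_le hηε)
  rw [e1, e2, ← Complex.sub_re, ← integral_sub i1 i2]
  refine (Complex.abs_re_le_norm _).trans ?_
  have hInt : Integrable (fun t : ℝ => ε * (B * N ^ (2 * d) * (1 + t ^ 2)⁻¹))
      (volume.restrict (Set.Ioi (0 : ℝ))) :=
    ((integrable_inv_one_add_sq.const_mul _).const_mul _).restrict
  refine (norm_integral_le_of_norm_le hInt ?_).trans (le_of_eq ?_)
  · filter_upwards [ae_restrict_mem measurableSet_Ioi] with t ht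
    have ht0 : 0 < t := ht
    have hexp : ∀ η : ℝ, Complex.exp ((-η - c * Complex.I) * t)
        = (Real.exp (-η * t) : ℝ) * Complex.exp ((-c * t : ℝ) * Complex.I) := fun η => by
      rw [Complex.ofReal_exp, ← Complex.exp_add]
      congr 1
      push_cast
      ring
    rw [hexp, hexp, ← sub_mul, ← sub_mul, norm_mul, norm_mul, Complex.norm_exp_ofReal_mul_I,
      mul_one, ← Complex.ofReal_sub, Complex.norm_real, Real.norm_eq_abs]
    have h1 : |Real.exp (-η * t) - Real.exp (-ε * t)| ≤ ε * t := by
      have a1 : Real.exp (-ε * t) ≤ Real.exp (-η * t) := Real.exp_le_exp.2 (by nlinarith)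
      have a2 : Real.exp (-η * t) ≤ 1 := Real.exp_le_one_iff.2 (by nlinarith)
      have a3 := Real.add_one_le_exp (-ε * t)
      rw [abs_of_nonneg (by linarith)]
      linarith
    calc _ ≤ ε * t * ‖∫ u, (cornerCount f (lam • u) : ℂ) * osc p t u‖ := by gcongr
      _ = ε * (t * ‖∫ u, (cornerCount f (lam • u) : ℂ) * osc p t u‖) := by ring
      _ ≤ _ := mul_le_mul_of_nonneg_left (h t N lam f ht0 hlam hN hf) (by linarith)
  · rw [integral_const_mul, integral_const_mul]
    ring

end Corners

namespace Corners

open scoped Topology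

/-! ### Mass of shell kernels -/

variable {d : ℕ} {p c η N : ℝ} {f : (Fin d → ℝ) × (Fin d → ℝ) → ℝ}

lemma measurable_shellKernel (p c η : ℝ) : Measurable (shellKernel (d := d) p c η) := by
  have h1 := measurable_powSum (d := d) p
  have h2 := measurable_cubeInd (d := d)
  unfold shellKernel
  fun_prop

lemma shellKernel_nonneg (hη : 0 < η) (u : Fin d → ℝ) : 0 ≤ shellKernel p c η u :=
  mul_nonneg (cubeInd_nonneg u) (by positivity)

lemma shellKernel_le (hη : 0 < η) (u : Fin d → ℝ) : shellKernel p c η u ≤ η⁻¹ := by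
  refine (mul_le_of_le_one_left (by positivity) (cubeInd_le_one u)).trans ?_
  rw [inv_eq_one_div, div_le_div_iff₀ (by positivity) hη]
  nlinarith [sq_nonneg (powSum p u - c)]

lemma norm_le_of_shellKernel_ne_zero {u : Fin d → ℝ} (hu : shellKernel p c η u ≠ 0) : ‖u‖ ≤ 2 :=
  norm_le_of_cubeInd_ne_zero (left_ne_zero_of_mul hu)

lemma integrable_mul_shellKernel {g : (Fin d → ℝ) → ℝ} (hg : Measurable g) {G : ℝ}
    (hG : ∀ u, |g u| ≤ G) (hη : 0 < η) : Integrable fun u => g u * shellKernel p c η u := by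
  refine integrable_of_bounded_support (hg.mul (measurable_shellKernel p c η)).aestronglyMeasurable
    (G * η⁻¹) 2 (fun u => ?_) (fun u hu => norm_le_of_shellKernel_ne_zero (right_ne_zero_of_mul hu))
  rw [norm_mul, Real.norm_eq_abs, Real.norm_eq_abs, abs_of_nonneg (shellKernel_nonneg hη u)]
  exact mul_le_mul (hG u) (shellKernel_le hη u) (shellKernel_nonneg hη u)
    ((abs_nonneg _).trans (hG u))

lemma integrable_shellKernel (hη : 0 < η) : Integrable (shellKernel (d := d) p c η) := by
  simpa using integrable_mul_shellKernel (d := d) (p := p) (c := c) (g := fun _ => 1)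
    measurable_const (G := 1) (by simp) hη

lemma powSum_mem_of_cube (hp : 0 < p) {u : Fin d → ℝ}
    (hu : u ∈ Set.Icc (fun _ => 1) (fun _ => 2)) : powSum p u ∈ Set.Icc (d : ℝ) (d * 2 ^ p) := by
  have h1 : ∀ i, 1 ≤ u i ^ p := fun i => Real.one_le_rpow (hu.1 i) hp.le
  have h2 : ∀ i, u i ^ p ≤ 2 ^ p := fun i =>
    Real.rpow_le_rpow (zero_le_one.trans (hu.1 i)) (hu.2 i) hp.le
  constructor
  · simpa [powSum] using Finset.card_nsmul_le_sum Finset.univ (fun i => u i ^ p) 1 fun i _ => h1 i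
  · simpa [powSum] using Finset.sum_le_card_nsmul Finset.univ (fun i => u i ^ p) _ fun i _ => h2 i

/-- For every width there is a level whose shell kernel has mass bounded below. -/
lemma exists_le_integral_shellKernel (hd : 1 ≤ d) (hp : 0 < p) (hη : 0 < η) (hη1 : η ≤ 1) :
    ∃ c, 0 < c ∧ 1 / (4 * (d * 2 ^ p)) ≤ ∫ u : Fin d → ℝ, shellKernel p c η u := by
  have hd' : (1 : ℝ) ≤ d := by exact_mod_cast hd
  set D : ℝ := d * 2 ^ p with hD
  have hD0 : 0 < D := by positivity
  by_contra! hcon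
  have hkm : Measurable fun q : ℝ × (Fin d → ℝ) => shellKernel p q.1 η q.2 := by
    have h1 := measurable_powSum (d := d) p
    have h2 := measurable_cubeInd (d := d)
    unfold shellKernel
    fun_prop
  have hInt : Integrable (Function.uncurry fun (c : ℝ) (u : Fin d → ℝ) => shellKernel p c η u)
      ((volume.restrict (Set.Ioc 0 D)).prod volume) := by
    refine (((integrable_const (η⁻¹ : ℝ)).mul_prod integrable_cubeInd)).mono'
      hkm.aestronglyMeasurable (Eventually.of_forall fun q => ?_)
    simp only [Function.uncurry]
    rw [Real.norm_eq_abs, abs_of_nonneg (shellKernel_nonneg hη _), shellKernel, mul_comm]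
    refine mul_le_mul_of_nonneg_right ?_ (cubeInd_nonneg _)
    rw [inv_eq_one_div, div_le_div_iff₀ (by positivity) hη]
    nlinarith [sq_nonneg (powSum p q.2 - q.1)]
  have hupper : ∫ c in Set.Ioc 0 D, ∫ u : Fin d → ℝ, shellKernel p c η u ≤ 1 / 4 := by
    have h1 : ∫ c in Set.Ioc 0 D, ∫ u : Fin d → ℝ, shellKernel p c η u
        ≤ ∫ _c in Set.Ioc 0 D, 1 / (4 * D) := by
      refine setIntegral_mono_on hInt.integral_prod_left (integrable_const _) measurableSet_Ioc
        fun c hc => (hcon c hc.1).le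
    rw [setIntegral_const, measureReal_def, Real.volume_Ioc, ENNReal.toReal_ofReal (by linarith),
      smul_eq_mul] at h1
    refine h1.trans (le_of_eq ?_)
    field_simp
    ring
  rw [integral_integral_swap hInt] at hupper
  have hlower : ∫ u : Fin d → ℝ, cubeInd u * (1 / 2)
      ≤ ∫ u : Fin d → ℝ, ∫ c in Set.Ioc 0 D, shellKernel p c η u := by
    refine integral_mono (integrable_cubeInd.mul_const _) hInt.integral_prod_right fun u => ?_
    by_cases hu : u ∈ Set.Icc (fun _ => 1 : Fin d → ℝ) (fun _ => 2)
    · obtain ⟨hQ1, hQ2⟩ := powSum_mem_of_cube hp hu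
      have hi : IntegrableOn (fun c => shellKernel p c η u) (Set.Ioc 0 D) := by
        refine Integrable.of_bound (hkm.comp (measurable_id.prodMk
          measurable_const)).aestronglyMeasurable η⁻¹ (Eventually.of_forall fun c => ?_)
        rw [Real.norm_eq_abs, abs_of_nonneg (shellKernel_nonneg hη _)]
        exact shellKernel_le hη u
      have hsub : Set.Ioc (powSum p u - η) (powSum p u) ⊆ Set.Ioc 0 D :=
        Set.Ioc_subset_Ioc (by linarith) hQ2
      have hc1 : cubeInd u = 1 := Set.indicator_of_mem hu _
      simp only [hc1, one_mul]
      calc (1 / 2 : ℝ) = ∫ _c in Set.Ioc (powSum p u - η) (powSum p u), 1 / (2 * η) := by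
            rw [setIntegral_const, measureReal_def, Real.volume_Ioc, sub_sub_cancel,
              ENNReal.toReal_ofReal hη.le, smul_eq_mul]
            field_simp
        _ ≤ ∫ c in Set.Ioc (powSum p u - η) (powSum p u), shellKernel p c η u := by
            refine setIntegral_mono_on (integrable_const _) (hi.mono_set hsub) measurableSet_Ioc
              fun c hc => ?_
            rw [shellKernel, hc1, one_mul, div_le_div_iff₀ (by positivity) (by positivity)]
            nlinarith [hc.1, hc.2]
        _ ≤ _ := setIntegral_mono_set hi (Eventually.of_forall fun c => shellKernel_nonneg hη u)
            hsub.eventuallyLE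
    · simp only [cubeInd_of_notMem hu, zero_mul]
      exact integral_nonneg fun c => shellKernel_nonneg hη u
  rw [integral_mul_const, integral_cubeInd] at hlower
  linarith

lemma exists_integral_shellKernel_le (hd : 24 ≤ d) (hp0 : p ≠ 0) (hp1 : p ≠ 1) (hp2 : p ≠ 2) :
    ∃ K : ℝ, ∀ c η, 0 < η → η ≤ 1 → ∫ u : Fin d → ℝ, shellKernel p c η u ≤ K := by
  obtain ⟨C, hC, h⟩ := exists_abs_integral_shellKernel_sub_le hd hp0 hp1 hp2
  let S : Set ((Fin d → ℝ) × (Fin d → ℝ)) :=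
    Set.Icc 0 (0 + fun _ => 4) ×ˢ Set.Icc 0 (0 + fun _ => 4)
  have hSm : MeasurableSet S := measurableSet_Icc.prod measurableSet_Icc
  have hf : IsBoxWeight 4 (S.indicator fun _ => (1 : ℝ)) :=
    { measurable := measurable_const.indicator hSm
      nonneg := fun q => Set.indicator_nonneg (fun _ _ => zero_le_one) q
      le_one := fun q => Set.indicator_le_self' (fun _ _ => zero_le_one) q
      support := ⟨0, 0, fun q hq => Set.mem_of_indicator_ne_zero hq⟩ }
  set f := S.indicator fun _ => (1 : ℝ) with hfdef
  have hm : Measurable fun u : Fin d → ℝ => cornerCount f ((1 : ℝ) • u) :=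
    ((hf.continuous_cornerCount (by norm_num)).comp (continuous_const_smul (1 : ℝ))).measurable
  have hM : ∀ u : Fin d → ℝ, |cornerCount f ((1 : ℝ) • u)| ≤ 4 ^ (2 * d) := fun u => by
    rw [abs_of_nonneg (hf.cornerCount_nonneg _)]
    exact hf.cornerCount_le (by norm_num) _
  have hlow : ∀ u ∈ Set.Icc (fun _ => 1 : Fin d → ℝ) (fun _ => 2), 1 ≤ cornerCount f u := by
    intro u hu
    set B : Set ((Fin d → ℝ) × (Fin d → ℝ)) :=
      Set.Icc 0 (0 + fun _ => 1) ×ˢ Set.Icc 0 (0 + fun _ => 1) with hB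
    have hBm : MeasurableSet B := measurableSet_Icc.prod measurableSet_Icc
    have hvol : volume B = 1 := by
      rw [hB, volume_box _ _ zero_le_one]
      simp
    have h1 : ∫ q, B.indicator (fun _ => (1 : ℝ)) q = 1 := by
      rw [integral_indicator_const _ hBm, measureReal_def, hvol]
      simp
    rw [← h1]
    have hB' : Integrable (B.indicator fun _ => (1 : ℝ)) :=
      (integrable_indicator_iff hBm).2 (integrableOn_const (by simp [hvol]) (by simp))
    have hcorner := hf.integrable_corner (by norm_num) 0 (u, 0) (0, u)
    simp only [add_zero] at hcorner
    have heq : cornerCount f u = ∫ q, f q * f (q + (u, 0)) * f (q + (0, u)) := by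
      simp [cornerCount, Prod.add_def]
    rw [heq]
    refine integral_mono hB' hcorner fun q => ?_
    by_cases hq : q ∈ B
    · have hu1 : ∀ i, 1 ≤ u i := hu.1
      have hu2 : ∀ i, u i ≤ 2 := hu.2
      have hq1 : ∀ i, 0 ≤ q.1 i := hq.1.1
      have hq2 : ∀ i, q.1 i ≤ 0 + 1 := hq.1.2
      have hq3 : ∀ i, 0 ≤ q.2 i := hq.2.1
      have hq4 : ∀ i, q.2 i ≤ 0 + 1 := hq.2.2
      have hone : ∀ r ∈ S, f r = 1 := fun r hr => Set.indicator_of_mem hr _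
      have hmem : ∀ r : (Fin d → ℝ) × (Fin d → ℝ), (∀ i, 0 ≤ r.1 i) → (∀ i, r.1 i ≤ 0 + 4) →
          (∀ i, 0 ≤ r.2 i) → (∀ i, r.2 i ≤ 0 + 4) → r ∈ S :=
        fun r h1 h2 h3 h4 => ⟨⟨h1, h2⟩, ⟨h3, h4⟩⟩
      have e0 : q ∈ S := hmem q hq1 (fun i => by linarith [hq2 i]) hq3
        (fun i => by linarith [hq4 i])
      have e1 : q + (u, 0) ∈ S := by
        refine hmem _ (fun i => ?_) (fun i => ?_) (fun i => ?_) (fun i => ?_) <;>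
          simp only [Prod.fst_add, Prod.snd_add, Pi.add_apply, Pi.zero_apply] <;>
          linarith [hu1 i, hu2 i, hq1 i, hq2 i, hq3 i, hq4 i]
      have e2 : q + (0, u) ∈ S := by
        refine hmem _ (fun i => ?_) (fun i => ?_) (fun i => ?_) (fun i => ?_) <;>
          simp only [Prod.fst_add, Prod.snd_add, Pi.add_apply, Pi.zero_apply] <;>
          linarith [hu1 i, hu2 i, hq1 i, hq2 i, hq3 i, hq4 i]
      simp only [Set.indicator_of_mem hq, hone _ e0, hone _ e1, hone _ e2, mul_one, le_refl]
    · simp only [Set.indicator_of_notMem hq]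
      exact mul_nonneg (mul_nonneg (hf.nonneg _) (hf.nonneg _)) (hf.nonneg _)
  refine ⟨4 ^ (2 * d) + C * 1 * 4 ^ (2 * d), fun c η hη hη1 => ?_⟩
  have h1 := (abs_le.1 (h 4 1 c η 1 f zero_lt_one (by norm_num) hf hη hη1)).2
  have h2 : ∫ u : Fin d → ℝ, shellKernel p c η u
      ≤ ∫ u : Fin d → ℝ, cornerCount f ((1 : ℝ) • u) * shellKernel p c η u := by
    refine integral_mono (integrable_shellKernel hη) (integrable_mul_shellKernel hm hM hη)
      fun u => ?_
    by_cases hu : u ∈ Set.Icc (fun _ => 1 : Fin d → ℝ) (fun _ => 2)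
    · simp only [one_smul]
      exact le_mul_of_one_le_left (shellKernel_nonneg hη u) (hlow u hu)
    · simp [shellKernel, cubeInd_of_notMem hu]
  have h3 : ∫ u : Fin d → ℝ, cornerCount f ((1 : ℝ) • u) * shellKernel p c 1 u
      ≤ ∫ u : Fin d → ℝ, 4 ^ (2 * d) * cubeInd u := by
    refine integral_mono (integrable_mul_shellKernel hm hM zero_lt_one)
      (integrable_cubeInd.const_mul _) fun u => ?_
    refine mul_le_mul ((le_abs_self _).trans (hM u)) ?_ (shellKernel_nonneg zero_lt_one u)
      (by positivity)
    refine mul_le_of_le_one_right (cubeInd_nonneg u) ((div_le_one (by positivity)).2 ?_)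
    nlinarith [sq_nonneg (powSum p u - c)]
  rw [integral_const_mul, integral_cubeInd, mul_one] at h3
  linarith

lemma exists_integral_mul_shellKernel_le {g : (Fin d → ℝ) → ℝ} (hp : 0 < p) (hg : Continuous g)
    (hg0 : ∀ u, 0 ≤ g u) {G : ℝ} (hG : ∀ u, g u ≤ G) {K : ℝ}
    (hK : ∀ η, 0 < η → η ≤ 1 → ∫ u : Fin d → ℝ, shellKernel p c η u ≤ K)
    (hzero : ∀ u ∈ Set.Icc (fun _ => 1 : Fin d → ℝ) (fun _ => 2), powSum p u = c → g u = 0)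
    {τ ε : ℝ} (hτ : 0 < τ) (hε : 0 < ε) :
    ∃ η, 0 < η ∧ η ≤ ε ∧ ∫ u, g u * shellKernel p c η u ≤ τ := by
  have hG0 : 0 ≤ G := (hg0 0).trans (hG 0)
  have hK0 : 0 ≤ K := (integral_nonneg fun u => shellKernel_nonneg zero_lt_one u).trans
    (hK 1 zero_lt_one le_rfl)
  have hQ : Continuous (powSum (d := d) p) := continuous_finsetSum _ fun i _ =>
    (continuous_apply i).rpow_const fun u => Or.inr hp.le
  set τ' := τ / (2 * (K + 1)) with hτ'
  have hτ'0 : 0 < τ' := by positivity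
  have hcomp : IsCompact (Set.Icc (fun _ => 1 : Fin d → ℝ) (fun _ => 2) ∩ g ⁻¹' Set.Ici τ') :=
    isCompact_Icc.inter_right (isClosed_Ici.preimage hg)
  obtain ⟨v, hv, hvS⟩ := hcomp.exists_forall_le' (f := fun u => |powSum p u - c|) (a := 0)
    (by fun_prop) (fun u hu => abs_pos.2 fun h => by
      have := hzero u hu.1 (by linarith)
      have h2 : τ' ≤ g u := hu.2
      linarith)
  set η := min (min 1 ε) (τ * v ^ 2 / (2 * (G + 1))) with hη
  have hη0 : 0 < η := lt_min (lt_min zero_lt_one hε) (by positivity)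
  have hη1 : η ≤ 1 := (min_le_left _ _).trans (min_le_left _ _)
  refine ⟨η, hη0, (min_le_left _ _).trans (min_le_right _ _), ?_⟩
  calc ∫ u, g u * shellKernel p c η u
      ≤ ∫ u, (τ' * shellKernel p c η u + G * (η / v ^ 2) * cubeInd u) := by
        refine integral_mono (integrable_mul_shellKernel hg.measurable
          (fun u => by rw [abs_of_nonneg (hg0 u)]; exact hG u) hη0)
          (((integrable_shellKernel hη0).const_mul _).add (integrable_cubeInd.const_mul _))
          fun u => ?_
        have hk := shellKernel_nonneg (p := p) (c := c) hη0 u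
        have hci := cubeInd_nonneg u
        by_cases hu : u ∈ Set.Icc (fun _ => 1 : Fin d → ℝ) (fun _ => 2)
        · by_cases hgu : τ' ≤ g u
          · have h1 := hvS u ⟨hu, hgu⟩
            have h2 : shellKernel p c η u ≤ (η / v ^ 2) * cubeInd u := by
              rw [shellKernel, mul_comm]
              refine mul_le_mul_of_nonneg_right ?_ hci
              have : v ^ 2 ≤ (powSum p u - c) ^ 2 := by
                rw [← sq_abs (powSum p u - c)]
                gcongr
              gcongr
              nlinarith
            have h3 := mul_le_mul (hG u) h2 hk hG0
            have h4 := mul_nonneg hτ'0.le hk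
            simp only
            linarith
          · have h1 := mul_le_mul_of_nonneg_right (not_le.1 hgu).le hk
            have h2 : 0 ≤ G * (η / v ^ 2) * cubeInd u := by positivity
            simp only
            linarith
        · simp [shellKernel, cubeInd_of_notMem hu]
    _ = τ' * (∫ u, shellKernel p c η u) + G * (η / v ^ 2) := by
        rw [integral_add ((integrable_shellKernel hη0).const_mul _)
          (integrable_cubeInd.const_mul _), integral_const_mul, integral_const_mul,
          integral_cubeInd, mul_one]
    _ ≤ τ' * K + G * (τ / (2 * (G + 1))) := by
        have hη3 : η / v ^ 2 ≤ τ / (2 * (G + 1)) := by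
          rw [div_le_iff₀ (by positivity)]
          exact (min_le_right _ _).trans (le_of_eq (by ring))
        exact add_le_add (mul_le_mul_of_nonneg_left (hK η hη0 hη1) hτ'0.le)
          (mul_le_mul_of_nonneg_left hη3 hG0)
    _ ≤ τ / 2 + τ / 2 := by
        gcongr
        · rw [hτ', div_mul_eq_mul_div, div_le_div_iff₀ (by positivity) (by norm_num)]
          nlinarith
        · rw [mul_div_assoc', div_le_div_iff₀ (by positivity) (by norm_num)]
          nlinarith
    _ = τ := by ring

end Corners

namespace Corners

open scoped Topology

/-! ### Corners on a level set -/

variable {d : ℕ} {p c η N : ℝ} {f : (Fin d → ℝ) × (Fin d → ℝ) → ℝ}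

lemma integral_indicator_closedBall_one :
    ∫ u : Fin d → ℝ, (Metric.closedBall 0 1).indicator (fun _ => (1 : ℝ)) u = 2 ^ d := by
  rw [integral_indicator_const _ measurableSet_closedBall, measureReal_def,
    Real.volume_pi_closedBall _ zero_le_one, ENNReal.toReal_ofReal (by positivity)]
  simp

lemma integrable_indicator_closedBall_one :
    Integrable ((Metric.closedBall (0 : Fin d → ℝ) 1).indicator fun _ => (1 : ℝ)) :=
  (integrable_indicator_iff measurableSet_closedBall).2
    (integrableOn_const measure_closedBall_lt_top.ne (by simp))

/-- The difference of a shell kernel and the multiple of the indicator function of the unit ball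
with the same mass. -/
noncomputable def balancedKernel (p c η : ℝ) (u : Fin d → ℝ) : ℝ :=
  shellKernel p c η u - (∫ v : Fin d → ℝ, shellKernel p c η v) / 2 ^ d *
    (Metric.closedBall 0 1).indicator (fun _ => 1) u

lemma isKernel_balancedKernel (hη : 0 < η) :
    IsKernel (∫ u, |balancedKernel (d := d) p c η u|) (balancedKernel (d := d) p c η) := by
  set m := ∫ v : Fin d → ℝ, shellKernel p c η v with hm
  have hm0 : 0 ≤ m := integral_nonneg fun u => shellKernel_nonneg hη u
  refine ⟨?_, ⟨η⁻¹ + m / 2 ^ d, fun u => ?_⟩, ⟨2, fun u hu => ?_⟩, le_rfl, ?_⟩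
  · exact (measurable_shellKernel p c η).sub
      ((measurable_const.indicator measurableSet_closedBall).const_mul _)
  · refine (abs_sub _ _).trans (add_le_add ?_ ?_)
    · rw [abs_of_nonneg (shellKernel_nonneg hη u)]
      exact shellKernel_le hη u
    · rw [abs_of_nonneg (mul_nonneg (by positivity)
        (Set.indicator_nonneg (fun _ _ => zero_le_one) u))]
      exact mul_le_of_le_one_right (by positivity)
        (Set.indicator_le_self' (fun _ _ => zero_le_one) u)
  · by_contra! h
    refine hu ?_
    have h1 : shellKernel p c η u = 0 := by
      by_contra h'
      exact h.not_ge (norm_le_of_shellKernel_ne_zero h')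
    have h2 : u ∉ Metric.closedBall (0 : Fin d → ℝ) 1 := by
      rw [mem_closedBall_zero_iff]
      linarith
    simp [balancedKernel, h1, Set.indicator_of_notMem h2]
  · simp only [balancedKernel]
    rw [integral_sub (integrable_shellKernel hη)
      (integrable_indicator_closedBall_one.const_mul _), integral_const_mul,
      integral_indicator_closedBall_one, div_mul_cancel₀ _ (by positivity), sub_self]

lemma integral_cornerCount_mul_balancedKernel (hf : IsBoxWeight N f) (hN : 0 ≤ N) (hη : 0 < η)
    (l : ℝ) :
    ∫ u, cornerCount f (l • u) * balancedKernel p c η u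
      = (∫ u, cornerCount f (l • u) * shellKernel p c η u)
        - (∫ v : Fin d → ℝ, shellKernel p c η v) / 2 ^ d *
          ∫ u in Metric.closedBall 0 1, cornerCount f (l • u) := by
  have hm : Measurable fun u : Fin d → ℝ => cornerCount f (l • u) :=
    ((hf.continuous_cornerCount hN).comp (continuous_const_smul l)).measurable
  have hM : ∀ u : Fin d → ℝ, |cornerCount f (l • u)| ≤ N ^ (2 * d) := fun u => by
    rw [abs_of_nonneg (hf.cornerCount_nonneg _)]
    exact hf.cornerCount_le hN _
  have hb : Integrable ((Metric.closedBall (0 : Fin d → ℝ) 1).indicator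
      fun u => cornerCount f (l • u)) :=
    (integrable_indicator_iff measurableSet_closedBall).2
      (Measure.integrableOn_of_bounded (M := N ^ (2 * d)) measure_closedBall_lt_top.ne
        hm.aestronglyMeasurable (Eventually.of_forall hM))
  rw [← integral_indicator measurableSet_closedBall, ← integral_const_mul,
    ← integral_sub (integrable_mul_shellKernel hm hM hη) (hb.const_mul _)]
  refine integral_congr_ae (Eventually.of_forall fun u => ?_)
  by_cases hu : u ∈ Metric.closedBall (0 : Fin d → ℝ) 1
  · simp only [balancedKernel, Set.indicator_of_mem hu]
    ring
  · simp only [balancedKernel, Set.indicator_of_notMem hu]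
    ring

/-- Among sufficiently many sufficiently separated scales there is one at which a dense set has
a corner on a fixed level set of the sum of powers. -/
lemma exists_cornerCount_ne_zero (hd : 24 ≤ d) (hp : 0 < p) (hp1 : p ≠ 1) (hp2 : p ≠ 2) {δ : ℝ}
    (hδ : 0 < δ) :
    ∃ c : ℝ, 0 < c ∧ ∃ (J : ℕ) (R : ℝ), 0 < R ∧ ∀ l : ℕ → ℝ, (∀ j, 0 < l j) →
      (∀ j k, j < k → R * l j ≤ l k) → ∀ N : ℝ, 0 < N → (∀ j < J, l j ≤ N) →
        ∀ f : (Fin d → ℝ) × (Fin d → ℝ) → ℝ, IsBoxWeight N f → (∀ q, f q = 0 ∨ f q = 1) →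
          δ * N ^ (2 * d) ≤ ∫ q, f q →
            ∃ j, ∃ u ∈ Set.Icc (fun _ => 1 : Fin d → ℝ) (fun _ => 2),
              powSum p u = c ∧ cornerCount f (l j • u) ≠ 0 := by
  obtain ⟨b, hb, hS⟩ := exists_setIntegral_cornerCount_ge d hδ
  obtain ⟨C, hC, hU⟩ := exists_abs_integral_shellKernel_sub_le hd hp.ne' hp1 hp2
  obtain ⟨K, hK⟩ := exists_integral_shellKernel_le hd hp.ne' hp1 hp2
  have hd1 : 1 ≤ d := by omega
  have hd0 : (0 : ℝ) < d := by exact_mod_cast hd1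
  set m₀ : ℝ := 1 / (4 * (d * 2 ^ p)) with hm₀
  have hm₀0 : 0 < m₀ := by positivity
  set τ := m₀ / 2 ^ d * b / 4 with hτ
  have hτ0 : 0 < τ := by positivity
  set ε := min 1 (τ / (C + 1)) with hε
  have hε0 : 0 < ε := lt_min zero_lt_one (by positivity)
  have hCε : C * ε ≤ τ := by
    have h1 : ε * (C + 1) ≤ τ := (le_div_iff₀ (by positivity)).1 (min_le_right _ _)
    nlinarith
  obtain ⟨c, hc, hm⟩ := exists_le_integral_shellKernel hd1 hp hε0 (min_le_left _ _)
  obtain ⟨J, R, hR, hJ⟩ := exists_abs_integral_cornerCount_mul_le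
    (isKernel_balancedKernel (d := d) (p := p) (c := c) hε0) hτ0
  refine ⟨c, hc, J, R, hR, fun l hl0 hl N hN hlN f hf hf01 hδf => ?_⟩
  obtain ⟨j, hjJ, hj⟩ := hJ l hl0 hl N hN f hf
  by_contra! hcon
  have hNd : 0 < N ^ (2 * d) := by positivity
  have hball := hS N (l j) f (hl0 j) (hlN j hjJ) hf hf01 hδf
  rw [integral_cornerCount_mul_balancedKernel hf hN.le hε0] at hj
  obtain ⟨η, hη0, hηε, hη⟩ := exists_integral_mul_shellKernel_le (c := c) hp
    ((hf.continuous_cornerCount hN.le).comp (continuous_const_smul (l j)))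
    (fun u => hf.cornerCount_nonneg _) (fun u => hf.cornerCount_le hN.le _) (hK c)
    (fun u hu huc => hcon j u hu huc) (mul_pos hτ0 hNd) hε0
  simp only [Function.comp_apply] at hη
  have hηε' := (abs_le.1 (hU N (l j) c η ε f (hl0 j) (hlN j hjJ) hf hη0 hηε)).1
  have h1 := (abs_le.1 hj).1
  have h2 : C * ε * N ^ (2 * d) ≤ τ * N ^ (2 * d) := by gcongr
  have h3 : 4 * τ * N ^ (2 * d) ≤ (∫ v : Fin d → ℝ, shellKernel p c ε v) / 2 ^ d *
      ∫ u in Metric.closedBall 0 1, cornerCount f (l j • u) := by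
    calc 4 * τ * N ^ (2 * d) = m₀ / 2 ^ d * (b * N ^ (2 * d)) := by rw [hτ]; ring
      _ ≤ _ := mul_le_mul (div_le_div_of_nonneg_right hm (by positivity)) hball (by positivity)
          (div_nonneg (hm₀0.le.trans hm) (by positivity))
  have h4 := mul_pos hτ0 hNd
  linarith

lemma exists_corner_of_cornerCount_ne_zero {B : Set ((Fin d → ℝ) × (Fin d → ℝ))} {s : Fin d → ℝ}
    (hs : cornerCount (B.indicator fun _ => 1) s ≠ 0) :
    ∃ x y, (x, y) ∈ B ∧ (x + s, y) ∈ B ∧ (x, y + s) ∈ B := by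
  by_contra! hcon
  refine hs (integral_eq_zero_of_ae (Eventually.of_forall fun q => ?_))
  by_contra h
  exact hcon q.1 q.2 (Set.mem_of_indicator_ne_zero (left_ne_zero_of_mul (left_ne_zero_of_mul h)))
    (Set.mem_of_indicator_ne_zero (right_ne_zero_of_mul (left_ne_zero_of_mul h)))
    (Set.mem_of_indicator_ne_zero (right_ne_zero_of_mul h))

lemma lpNorm_smul_of_mem_cube (hp : 0 < p) {u : Fin d → ℝ}
    (hu : u ∈ Set.Icc (fun _ => 1 : Fin d → ℝ) (fun _ => 2)) {l : ℝ} (hl : 0 ≤ l) :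
    lpNorm p (l • u) = l * powSum p u ^ (1 / p) := by
  have hu0 : ∀ i, 0 ≤ u i := fun i => zero_le_one.trans (hu.1 i)
  have h1 : ∑ i, |(l • u) i| ^ p = l ^ p * powSum p u := by
    rw [powSum, Finset.mul_sum]
    refine Finset.sum_congr rfl fun i _ => ?_
    rw [Pi.smul_apply, smul_eq_mul, abs_of_nonneg (mul_nonneg hl (hu0 i)),
      Real.mul_rpow hl (hu0 i)]
  have h2 : 0 ≤ powSum p u := Finset.sum_nonneg fun i _ => Real.rpow_nonneg (hu0 i) p
  rw [_root_.lpNorm, h1, Real.mul_rpow (Real.rpow_nonneg hl p) h2, ← Real.rpow_mul hl,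
    mul_one_div_cancel hp.ne', Real.rpow_one]

lemma exists_box_of_upperBanachDensityProd_pos {A : Set ((Fin d → ℝ) × (Fin d → ℝ))}
    (hA : 0 < upperBanachDensityProd d A) :
    ∃ δ : ℝ, 0 < δ ∧ ∀ N₀ : ℝ, ∃ N ≥ N₀, 0 < N ∧ ∃ a b : Fin d → ℝ,
      δ * N ^ (2 * d)
        ≤ volume.real (A ∩ (Set.Icc a (a + fun _ => N) ×ˢ Set.Icc b (b + fun _ => N))) := by
  obtain ⟨δ, hδ0, hδ⟩ := exists_between hA
  have hδt : δ ≠ ∞ := (hδ.trans_le le_top).ne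
  refine ⟨δ.toReal, ENNReal.toReal_pos hδ0.ne' hδt, fun N₀ => ?_⟩
  obtain ⟨N, hN, hδN⟩ := frequently_atTop.1 (frequently_lt_of_lt_limsup (h := hδ)) (max 1 N₀)
  have hN1 : 0 < N := zero_lt_one.trans_le ((le_max_left _ _).trans hN)
  obtain ⟨z, hz⟩ := lt_iSup_iff.1 hδN
  refine ⟨N, (le_max_right _ _).trans hN, hN1, z.1, z.2, ?_⟩
  have hpos : ENNReal.ofReal (N ^ (2 * d)) ≠ 0 := by
    rw [Ne, ENNReal.ofReal_eq_zero, not_le]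
    positivity
  rw [ENNReal.lt_div_iff_mul_lt (Or.inl hpos) (Or.inl ENNReal.ofReal_ne_top)] at hz
  have hfin : volume (A ∩ (Set.Icc z.1 (z.1 + fun _ => N) ×ˢ Set.Icc z.2 (z.2 + fun _ => N)))
      ≠ ∞ := by
    refine ((measure_mono Set.inter_subset_right).trans_lt ?_).ne
    rw [volume_box _ _ hN1.le]
    exact ENNReal.ofReal_lt_top
  have h := ENNReal.toReal_mono hfin hz.le
  rwa [ENNReal.toReal_mul, ENNReal.toReal_ofReal (by positivity)] at h

lemma isBoxWeight_indicator {A : Set ((Fin d → ℝ) × (Fin d → ℝ))} (hA : MeasurableSet A)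
    (a b : Fin d → ℝ) :
    IsBoxWeight N ((A ∩ (Set.Icc a (a + fun _ => N) ×ˢ Set.Icc b (b + fun _ => N))).indicator
      fun _ => (1 : ℝ)) where
  measurable := measurable_const.indicator (hA.inter (measurableSet_Icc.prod measurableSet_Icc))
  nonneg q := Set.indicator_nonneg (fun _ _ => zero_le_one) q
  le_one q := Set.indicator_le_self' (fun _ _ => zero_le_one) q
  support := ⟨a, b, fun _ hq => (Set.mem_of_indicator_ne_zero hq).2⟩

/-- An unbounded set of reals contains arbitrarily fast growing sequences. -/
lemma exists_separated_seq {P : ℝ → Prop} (hP : ∀ x, ∃ y ≥ x, P y) (R : ℝ) :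
    ∃ l : ℕ → ℝ, (∀ j, 0 < l j) ∧ (∀ j, P (l j)) ∧ ∀ j k, j < k → R * l j ≤ l k := by
  choose g hg hgP using hP
  let l : ℕ → ℝ := fun n => Nat.rec (g 1) (fun _ x => g (max x (R * x))) n
  have hsucc : ∀ n, max (l n) (R * l n) ≤ l (n + 1) := fun n => hg _
  have hmono : Monotone l := monotone_nat_of_le_succ fun n => (le_max_left _ _).trans (hsucc n)
  refine ⟨l, fun j => ?_, fun j => ?_, fun j k hjk => ?_⟩
  · exact zero_lt_one.trans_le ((hg 1).le.trans (hmono (Nat.zero_le j)))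
  · cases j with
    | zero => exact hgP _
    | succ n => exact hgP _
  · exact ((le_max_right _ _).trans (hsucc j)).trans (hmono hjk)

end Corners

theorem corners_all_large_side_lengths (p : ℝ)
    (hp : p ∈ Set.Ioo (1 : ℝ) 2 ∪ Set.Ioi (2 : ℝ)) :
    ∃ dp : ℕ, 2 ≤ dp ∧ ∀ d : ℕ, dp ≤ d →
      ∀ A : Set ((Fin d → ℝ) × (Fin d → ℝ)), MeasurableSet A →
        0 < upperBanachDensityProd d A →
        ∃ lam0 : ℝ, 0 < lam0 ∧ ∀ lam : ℝ, lam0 ≤ lam →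
          ∃ x y s : Fin d → ℝ,
            (x, y) ∈ A ∧ (x + s, y) ∈ A ∧ (x, y + s) ∈ A ∧ lpNorm p s = lam := by
  have hp1 : 1 < p := by
    rcases hp with hp | hp
    · exact hp.1
    · exact one_lt_two.trans hp
  have hp2 : p ≠ 2 := by
    rcases hp with hp | hp
    · exact hp.2.ne
    · exact (Set.mem_Ioi.1 hp).ne'
  have hp0 : 0 < p := zero_lt_one.trans hp1
  refine ⟨24, by norm_num, fun d hd A hA hAd => ?_⟩
  obtain ⟨δ, hδ, hbox⟩ := Corners.exists_box_of_upperBanachDensityProd_pos hAd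
  obtain ⟨c, hc, J, R, hR, hmain⟩ := Corners.exists_cornerCount_ne_zero hd hp0 hp1.ne' hp2 hδ
  by_contra! hcon
  have hc' : 0 < c ^ (1 / p) := Real.rpow_pos_of_pos hc _
  obtain ⟨l, hl0, hlbad, hl⟩ := Corners.exists_separated_seq
    (P := fun l => ∀ x y s : Fin d → ℝ, (x, y) ∈ A → (x + s, y) ∈ A → (x, y + s) ∈ A →
      lpNorm p s ≠ l * c ^ (1 / p)) (fun x => by
    obtain ⟨lam, hlam, hbad⟩ := hcon (max 1 (x * c ^ (1 / p))) (zero_lt_one.trans_le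
      (le_max_left _ _))
    refine ⟨lam / c ^ (1 / p), (le_div_iff₀ hc').2 ((le_max_right _ _).trans hlam), ?_⟩
    rwa [div_mul_cancel₀ _ hc'.ne']) R
  obtain ⟨N, hN, hN0, a, b, hab⟩ := hbox (∑ j ∈ Finset.range J, l j)
  have hA' := hA.inter (measurableSet_Icc.prod measurableSet_Icc :
    MeasurableSet (Set.Icc a (a + fun _ => N) ×ˢ Set.Icc b (b + fun _ => N)))
  obtain ⟨j, u, hu, huc, hcount⟩ := hmain l hl0 hl N hN0
    (fun j hj => (Finset.single_le_sum (fun i _ => (hl0 i).le) (Finset.mem_range.2 hj)).trans hN)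
    _ (Corners.isBoxWeight_indicator hA a b) (fun q => Set.indicator_eq_zero_or_self _ _ q)
    (by rwa [integral_indicator_const _ hA', smul_eq_mul, mul_one])
  obtain ⟨x, y, h1, h2, h3⟩ := Corners.exists_corner_of_cornerCount_ne_zero hcount
  refine hlbad j x y _ h1.1 h2.1 h3.1 ?_
  rw [Corners.lpNorm_smul_of_mem_cube hp0 hu (hl0 j).le, huc]
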